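/- Let c > 30 be a real number and ε > 0 satisfy 0 < log(1/ε) < (5π/(4√6))·c − 3·log c − log(6⁵·14340). Define α = (4√6/π)·(log(1/ε) + 3·log c + log(6⁵·14340)) and ν(α) = 2c/π + (α/(2π))·log(16ec/α). Let n > 0 and 0 ≤ m ≤ n−1 be integers with n > ν(α). Then |∫_{-1}^{1} ψ_m(s) ds − Σ_{j=1}^{n} W_j·ψ_m(t_j)| < ε (all logarithms natural, e = exp(1)). -/

import Mathlib

open Real MeasureTheory Set

/-- A `k`-th prolate datum for band limit `c`: `ψ` is real-analytic with unit
`L²[-1,1]` norm, has exactly `k` zeros in `(-1,1)`, is an eigenfunction of the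
prolate integral operator with nonzero eigenvalue `lam`, and satisfies the
prolate differential equation with eigenvalue `χ`. -/
structure ProlateDatum (c : ℝ) (k : ℕ) (ψ : ℝ → ℝ) (lam : ℂ) (χ : ℝ) : Prop where
  analytic : ∀ x : ℝ, AnalyticAt ℝ ψ x
  normalized : ∫ t in (-1:ℝ)..1, (ψ t)^2 = 1
  zeros_card : {x : ℝ | x ∈ Set.Ioo (-1:ℝ) 1 ∧ ψ x = 0}.encard = k
  lam_ne_zero : lam ≠ 0
  integral_eig : ∀ x : ℝ,
    lam * (ψ x : ℂ) =
      ∫ t in (-1:ℝ)..1, (ψ t : ℂ) * Complex.exp (Complex.I * (c:ℂ) * (x:ℂ) * (t:ℂ))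
  diff_eq : ∀ x : ℝ,
    (1 - x^2) * deriv (deriv ψ) x - 2*x * deriv ψ x + (χ - c^2 * x^2) * ψ x = 0

/-- The `j`-th weight of the PSWF-based quadrature rule:
`W_j = (1/ψₙ'(t_j)) ∫_{-1}^1 ψₙ(s)/(s - t_j) ds`. -/
noncomputable def quadWeight (ψn : ℝ → ℝ) (tj : ℝ) : ℝ :=
  (1 / deriv ψn tj) * ∫ s in (-1:ℝ)..1, ψn s / (s - tj)

/-- real-line ODE data -/
structure RODE (c χ : ℝ) (ψ ψ' ψ'' : ℝ → ℝ) : Prop where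
  d1 : ∀ x, HasDerivAt ψ (ψ' x) x
  d2 : ∀ x, HasDerivAt ψ' (ψ'' x) x
  ode : ∀ x, (1 - x^2) * ψ'' x - 2*x * ψ' x + (χ - c^2 * x^2) * ψ x = 0

/-- entire extension data -/
structure CODE (c χ : ℝ) (ψ : ℝ → ℝ) (f : ℂ → ℂ) : Prop where
  diff : Differentiable ℂ f
  real : ∀ x : ℝ, f x = ψ x
  ode : ∀ z : ℂ, (1 - z^2) * deriv (deriv f) z - 2*z * deriv f z + (χ - c^2 * z^2) * f z = 0

theorem ProlateDatum.rode {c : ℝ} {k : ℕ} {ψ : ℝ → ℝ} {lam : ℂ} {χ : ℝ}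
    (h : ProlateDatum c k ψ lam χ) : RODE c χ ψ (deriv ψ) (deriv (deriv ψ)) where
  d1 := fun x => (h.analytic x).differentiableAt.hasDerivAt
  d2 := fun x => (h.analytic x).deriv.differentiableAt.hasDerivAt
  ode := h.diff_eq

/-- two entire functions agreeing on the real axis agree -/
theorem entire_eq_of_real {f g : ℂ → ℂ} (hf : Differentiable ℂ f) (hg : Differentiable ℂ g)
    (h : ∀ x : ℝ, f x = g x) : f = g := by
  have hf' : AnalyticOnNhd ℂ f univ := fun z _ => hf.analyticAt z
  have hg' : AnalyticOnNhd ℂ g univ := fun z _ => hg.analyticAt z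
  refine hf'.eq_of_frequently_eq hg' (z₀ := 0) ?_
  have hs : Filter.Tendsto (fun n : ℕ => (((1:ℝ) / ((n:ℝ) + 1) : ℝ) : ℂ)) Filter.atTop
      (nhdsWithin 0 {0}ᶜ) := by
    refine tendsto_nhdsWithin_iff.2 ⟨?_, ?_⟩
    · have := tendsto_one_div_add_atTop_nhds_zero_nat (𝕜 := ℝ)
      have h2 := (Complex.continuous_ofReal.tendsto 0).comp this
      rw [Complex.ofReal_zero] at h2
      exact h2
    · refine Filter.Eventually.of_forall fun n => ?_
      simp only [mem_compl_iff, mem_singleton_iff, Complex.ofReal_eq_zero]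
      positivity
  exact hs.frequently (Filter.Frequently.of_forall fun n => h _)

theorem entire_zero_of_real_interval {f : ℂ → ℂ} (hf : Differentiable ℂ f) {a b : ℝ} (hab : a < b)
    (h : ∀ x ∈ Ioo a b, f (x:ℝ) = 0) : f = 0 := by
  have hf' : AnalyticOnNhd ℂ f univ := fun z _ => hf.analyticAt z
  have hg' : AnalyticOnNhd ℂ (0 : ℂ → ℂ) univ := fun z _ => analyticAt_const
  set m := (a+b)/2
  refine hf'.eq_of_frequently_eq hg' (z₀ := (m:ℝ)) ?_
  have hs : Filter.Tendsto (fun n : ℕ => ((m + (b-a)/4 * ((1:ℝ) / ((n:ℝ) + 1)) : ℝ) : ℂ)) Filter.atTop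
      (nhdsWithin (m:ℝ) {((m:ℝ):ℂ)}ᶜ) := by
    refine tendsto_nhdsWithin_iff.2 ⟨?_, ?_⟩
    · have := tendsto_one_div_add_atTop_nhds_zero_nat (𝕜 := ℝ)
      have h3 : Filter.Tendsto (fun n : ℕ => m + (b-a)/4 * ((1:ℝ) / ((n:ℝ) + 1))) Filter.atTop (nhds m) := by
        simpa using (this.const_mul ((b-a)/4)).const_add m
      exact (Complex.continuous_ofReal.tendsto m).comp h3
    · refine Filter.Eventually.of_forall fun n => ?_
      simp only [mem_compl_iff, mem_singleton_iff, Complex.ofReal_inj]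
      have : 0 < (b-a)/4 * ((1:ℝ) / ((n:ℝ) + 1)) := by
        have : 0 < b - a := by linarith
        positivity
      linarith
  refine hs.frequently (Filter.Frequently.of_forall fun n => ?_)
  simp only [Pi.zero_apply]
  apply h
  have h1 : (1:ℝ) / ((n:ℝ) + 1) ≤ 1 := by
    rw [div_le_one (by positivity)]
    have : (0:ℝ) ≤ n := by positivity
    linarith
  have h2 : 0 < (1:ℝ) / ((n:ℝ) + 1) := by positivity
  constructor <;> simp only [m] <;> nlinarith

theorem hasDerivAt_ft1 {g : ℝ → ℂ} (hg : Continuous g) (c : ℝ) (z : ℂ) :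
    HasDerivAt (fun z : ℂ => ∫ t in (-1:ℝ)..1, g t * Complex.exp (Complex.I * c * z * t))
      (∫ t in (-1:ℝ)..1, g t * (Complex.I * c * t) * Complex.exp (Complex.I * c * z * t)) z := by
  obtain ⟨M, hM⟩ : ∃ M, ∀ x ∈ (Metric.closedBall z 1) ×ˢ (Icc (-1:ℝ) 1),
      ‖g x.2 * (Complex.I * c * x.2) * Complex.exp (Complex.I * c * x.1 * x.2)‖ ≤ M := by
    apply IsCompact.exists_bound_of_continuousOn
    · exact (isCompact_closedBall z 1).prod isCompact_Icc
    · apply Continuous.continuousOn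
      fun_prop
  refine (intervalIntegral.hasDerivAt_integral_of_dominated_loc_of_deriv_le
    (F := fun (z:ℂ) (t:ℝ) => g t * Complex.exp (Complex.I * c * z * t))
    (F' := fun (z:ℂ) (t:ℝ) => g t * (Complex.I * c * t) * Complex.exp (Complex.I * c * z * t))
    (bound := fun _ => M) (Metric.ball_mem_nhds z one_pos) ?_ ?_ ?_ ?_ ?_ ?_).2
  · refine Filter.Eventually.of_forall fun w => ?_
    apply Continuous.aestronglyMeasurable
    fun_prop
  · apply Continuous.intervalIntegrable
    fun_prop
  · apply Continuous.aestronglyMeasurable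
    fun_prop
  · refine Filter.Eventually.of_forall fun t ht w hw => ?_
    refine hM (w, t) ⟨Metric.ball_subset_closedBall hw, ?_⟩
    rw [uIoc_of_le (by norm_num)] at ht
    exact ⟨ht.1.le, ht.2⟩
  · exact intervalIntegrable_const
  · refine Filter.Eventually.of_forall fun t ht w hw => ?_
    have h1 : HasDerivAt (fun w : ℂ => Complex.I * c * w * t) (Complex.I * c * t) w := by
      have := ((hasDerivAt_id w).const_mul (Complex.I * (c:ℂ))).mul_const (t:ℂ)
      simpa using this
    have := (h1.cexp).const_mul (g t)
    refine this.congr_deriv ?_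
    ring

/-- entire extension -/
noncomputable def ent (c : ℝ) (ψ : ℝ → ℝ) (lam : ℂ) (z : ℂ) : ℂ :=
  lam⁻¹ * ∫ t in (-1:ℝ)..1, (ψ t : ℂ) * Complex.exp (Complex.I * c * z * t)

theorem ProlateDatum.cont {c : ℝ} {k : ℕ} {ψ : ℝ → ℝ} {lam : ℂ} {χ : ℝ}
    (h : ProlateDatum c k ψ lam χ) : Continuous ψ :=
  continuous_iff_continuousAt.2 fun x => (h.analytic x).continuousAt

theorem ProlateDatum.code {c : ℝ} {k : ℕ} {ψ : ℝ → ℝ} {lam : ℂ} {χ : ℝ}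
    (h : ProlateDatum c k ψ lam χ) : CODE c χ ψ (ent c ψ lam) := by
  have hcont : Continuous (fun t => (ψ t : ℂ)) := Complex.continuous_ofReal.comp h.cont
  have hd : Differentiable ℂ (ent c ψ lam) := fun z =>
    ((hasDerivAt_ft1 hcont c z).const_mul lam⁻¹).differentiableAt
  have hr : ∀ x : ℝ, ent c ψ lam x = ψ x := by
    intro x
    unfold ent
    rw [← h.integral_eig x, inv_mul_cancel_left₀ h.lam_ne_zero]
  have hd' : Differentiable ℂ (deriv (ent c ψ lam)) := hd.contDiff.differentiable_deriv_two
  have hd'' : Differentiable ℂ (deriv (deriv (ent c ψ lam))) := hd'.contDiff.differentiable_deriv_two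
  have hr' : ∀ x : ℝ, deriv (ent c ψ lam) x = (deriv ψ x : ℝ) := by
    intro x
    have h1 := (hd x).hasDerivAt.comp_ofReal
    have h2 := (h.rode.d1 x).ofReal_comp
    have h3 : (fun y : ℝ => ent c ψ lam y) = fun y : ℝ => (ψ y : ℂ) := funext hr
    rw [h3] at h1
    exact h1.unique h2
  have hr'' : ∀ x : ℝ, deriv (deriv (ent c ψ lam)) x = (deriv (deriv ψ) x : ℝ) := by
    intro x
    have h1 := (hd' x).hasDerivAt.comp_ofReal
    have h2 := (h.rode.d2 x).ofReal_comp
    have h3 : (fun y : ℝ => deriv (ent c ψ lam) y) = fun y : ℝ => ((deriv ψ y : ℝ) : ℂ) := funext hr'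
    rw [h3] at h1
    exact h1.unique h2
  refine ⟨hd, hr, ?_⟩
  have := entire_eq_of_real (f := fun z => (1 - z^2) * deriv (deriv (ent c ψ lam)) z - 2*z * deriv (ent c ψ lam) z + (χ - c^2 * z^2) * (ent c ψ lam) z) (g := fun _ => 0) (by fun_prop) (by fun_prop) ?_
  · intro z
    exact congrFun this z
  · intro x
    simp only [hr, hr', hr'']
    exact_mod_cast h.diff_eq x

theorem CODE.diff' {c χ : ℝ} {ψ : ℝ → ℝ} {f : ℂ → ℂ} (h : CODE c χ ψ f) :
    Differentiable ℂ (deriv f) := h.diff.contDiff.differentiable_deriv_two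

theorem CODE.real' {c χ : ℝ} {ψ : ℝ → ℝ} {f : ℂ → ℂ} (h : CODE c χ ψ f) (x : ℝ) :
    deriv f x = (deriv ψ x : ℝ) := by
  have h1 := (h.diff x).hasDerivAt.comp_ofReal
  have h3 : (fun y : ℝ => f y) = fun y : ℝ => (ψ y : ℂ) := funext h.real
  rw [h3] at h1
  have h4 : HasDerivAt ψ (deriv f x).re x := by
    have := (h.diff x).hasDerivAt.real_of_complex
    simpa [h.real] using this
  have h5 := h1.unique h4.ofReal_comp
  rw [h4.deriv]; exact h5

theorem CODE.conj {c χ : ℝ} {ψ : ℝ → ℝ} {f : ℂ → ℂ} (h : CODE c χ ψ f) (z : ℂ) :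
    f (starRingEnd ℂ z) = starRingEnd ℂ (f z) := by
  have hd : Differentiable ℂ (fun w => starRingEnd ℂ (f (starRingEnd ℂ w))) := by
    intro w
    have := (h.diff (starRingEnd ℂ w)).hasDerivAt.conj_conj
    simpa [Function.comp_def] using this.differentiableAt
  have := entire_eq_of_real hd h.diff (fun x => by simp [h.real])
  have h2 := congrFun this (starRingEnd ℂ z)
  simp only [Complex.conj_conj] at h2
  exact h2.symm

theorem le_of_hasDerivAt_nonneg {f f' : ℝ → ℝ} {a b : ℝ} (hab : a ≤ b)
    (hc : ContinuousOn f (Icc a b))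
    (h : ∀ x ∈ Ioo a b, HasDerivAt f (f' x) x) (h0 : ∀ x ∈ Ioo a b, 0 ≤ f' x) : f a ≤ f b := by
  have : MonotoneOn f (Icc a b) := by
    apply monotoneOn_of_deriv_nonneg (convex_Icc a b) hc
    · intro x hx
      rw [interior_Icc] at hx
      exact (h x hx).differentiableAt.differentiableWithinAt
    · intro x hx
      rw [interior_Icc] at hx
      rw [(h x hx).deriv]
      exact h0 x hx
  exact this (left_mem_Icc.2 hab) (right_mem_Icc.2 hab) hab

theorem growth_of_hasDerivAt {f f' θ θ' : ℝ → ℝ} {a b : ℝ} (hab : a ≤ b)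
    (hc : ContinuousOn f (Icc a b)) (hcθ : ContinuousOn θ (Icc a b))
    (h : ∀ x ∈ Ioo a b, HasDerivAt f (f' x) x) (hθ : ∀ x ∈ Ioo a b, HasDerivAt θ (θ' x) x)
    (h0 : ∀ x ∈ Ioo a b, θ' x * f x ≤ f' x) : f a * exp (θ b - θ a) ≤ f b := by
  have := le_of_hasDerivAt_nonneg (f := fun x => f x * exp (- θ x))
    (f' := fun x => f' x * exp (- θ x) + f x * (exp (- θ x) * (- θ' x))) hab
    (hc.mul hcθ.neg.rexp) (fun x hx => (h x hx).mul (hθ x hx).neg.exp) (by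
      intro x hx
      have := h0 x hx
      have he := exp_pos (- θ x)
      have : 0 ≤ (f' x - θ' x * f x) * exp (- θ x) := mul_nonneg (by linarith) he.le
      nlinarith)
  have h2 := mul_le_mul_of_nonneg_right this (exp_pos (θ b)).le
  rw [mul_assoc, mul_assoc, ← exp_add, ← exp_add] at h2
  simp only [neg_add_cancel, exp_zero, mul_one] at h2
  rwa [show - θ a + θ b = θ b - θ a by ring] at h2

section
variable {c χ : ℝ} {ψ ψ' ψ'' : ℝ → ℝ}

theorem RODE.cont (h : RODE c χ ψ ψ' ψ'') : Continuous ψ :=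
  continuous_iff_continuousAt.2 fun x => (h.d1 x).continuousAt

theorem RODE.cont' (h : RODE c χ ψ ψ' ψ'') : Continuous ψ' :=
  continuous_iff_continuousAt.2 fun x => (h.d2 x).continuousAt

/-- derivative of `pψ'` -/
theorem RODE.dw (h : RODE c χ ψ ψ' ψ'') (x : ℝ) :
    HasDerivAt (fun x => (1 - x^2) * ψ' x) (-(χ - c^2 * x^2) * ψ x) x := by
  have h1 : HasDerivAt (fun x : ℝ => 1 - x^2) (-(2*x)) x := by
    have := (hasDerivAt_pow 2 x).const_sub 1
    simpa using this
  refine (h1.mul (h.d2 x)).congr_deriv ?_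
  have := h.ode x
  linarith

theorem RODE.neg (h : RODE c χ ψ ψ' ψ'') : RODE c χ (fun x => - ψ x) (fun x => - ψ' x) (fun x => - ψ'' x) :=
  ⟨fun x => (h.d1 x).neg, fun x => (h.d2 x).neg, fun x => by have := h.ode x; linarith⟩

theorem RODE.refl (h : RODE c χ ψ ψ' ψ'') :
    RODE c χ (fun x => ψ (-x)) (fun x => - ψ' (-x)) (fun x => ψ'' (-x)) := by
  refine ⟨fun x => ?_, fun x => ?_, fun x => ?_⟩
  · have := (h.d1 (-x)).comp x (hasDerivAt_neg x)
    refine this.congr_deriv (by ring)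
  · have := ((h.d2 (-x)).comp x (hasDerivAt_neg x)).neg
    refine this.congr_deriv (by ring)
  · have := h.ode (-x)
    simp only [neg_sq] at this
    linarith

theorem RODE.sub (h : RODE c χ ψ ψ' ψ'') {g g' g'' : ℝ → ℝ} (hg : RODE c χ g g' g'') :
    RODE c χ (fun x => ψ x - g x) (fun x => ψ' x - g' x) (fun x => ψ'' x - g'' x) :=
  ⟨fun x => (h.d1 x).sub (hg.d1 x), fun x => (h.d2 x).sub (hg.d2 x),
    fun x => by have := h.ode x; have := hg.ode x; linarith⟩

theorem RODE.unique_right (h : RODE c χ ψ ψ' ψ'') {t : ℝ} (ht : -1 < t)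
    (h0 : ψ t = 0) (h1 : ψ' t = 0) : ∀ x ∈ Ico t 1, ψ x = 0 := by
  intro x hx
  have hp : ∀ y ∈ Icc t x, 0 < 1 - y^2 := by
    intro y hy
    nlinarith [hy.1, hy.2, hx.2]
  obtain ⟨p0, hp0, hpm⟩ : ∃ p0 > 0, ∀ y ∈ Icc t x, p0 ≤ 1 - y^2 := by
    obtain ⟨y, hy, hmin⟩ := (isCompact_Icc (a := t) (b := x)).exists_isMinOn
      (nonempty_Icc.2 hx.1) (f := fun y : ℝ => 1 - y^2) (by fun_prop)
    exact ⟨1 - y^2, hp y hy, fun z hz => hmin hz⟩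
  set C := 1 + (2*2 + (|χ| + c^2)) / p0 with hC
  have hE := growth_of_hasDerivAt (f := fun x => -(ψ x ^2 + ψ' x^2))
    (f' := fun x => -(2 * ψ x * ψ' x + 2 * ψ' x * ψ'' x)) (θ := fun x => C * x) (θ' := fun _ => C) hx.1
    (by have := h.cont; have := h.cont'; fun_prop) (by fun_prop)
    (fun y _ => by
      refine (((h.d1 y).pow 2).add ((h.d2 y).pow 2)).neg.congr_deriv ?_
      simp)
    (fun y _ => by simpa using (hasDerivAt_id y).const_mul C)
    (by
      intro y hy
      have hy' : y ∈ Icc t x := ⟨hy.1.le, hy.2.le⟩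
      have hpy := hpm y hy'
      have hode := h.ode y
      have hyy : |y| ≤ 1 := by
        have := hp y hy'
        exact abs_le_one_iff_mul_self_le_one.2 (by nlinarith)
      have hq : |χ - c^2*y^2| ≤ |χ| + c^2 := by
        have h3 : y^2 ≤ 1 := by have := hp y hy'; linarith
        calc |χ - c^2*y^2| ≤ |χ| + |c^2*y^2| := abs_sub _ _
          _ ≤ |χ| + c^2 := by
            rw [abs_of_nonneg (show 0 ≤ c^2*y^2 by positivity)]
            nlinarith [sq_nonneg c]
      -- bound
      have h4 : p0 * |ψ'' y| ≤ 2 * |ψ' y| + (|χ| + c^2) * |ψ y| := by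
        calc p0 * |ψ'' y| ≤ (1 - y^2) * |ψ'' y| := by gcongr
          _ = |(1-y^2) * ψ'' y| := by rw [abs_mul, abs_of_pos (show (0:ℝ) < 1 - y^2 by linarith)]
          _ = |2*y*ψ' y - (χ - c^2*y^2) * ψ y| := by congr 1; linarith
          _ ≤ |2*y*ψ' y| + |(χ - c^2*y^2) * ψ y| := abs_sub _ _
          _ ≤ 2 * |ψ' y| + (|χ| + c^2) * |ψ y| := by
            rw [abs_mul, abs_mul, abs_mul, abs_two]
            gcongr
            nlinarith [abs_nonneg (ψ' y)]
      have h5 : |ψ'' y| ≤ (2 * |ψ' y| + (|χ| + c^2) * |ψ y|) / p0 := by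
        rw [le_div_iff₀ hp0]; linarith
      have h6 : ψ' y * ψ'' y ≤ |ψ' y| * ((2 * |ψ' y| + (|χ| + c^2) * |ψ y|) / p0) := by
        calc ψ' y * ψ'' y ≤ |ψ' y * ψ'' y| := le_abs_self _
          _ = |ψ' y| * |ψ'' y| := abs_mul _ _
          _ ≤ _ := by gcongr
      have h7 : |ψ' y| * ((2 * |ψ' y| + (|χ| + c^2) * |ψ y|) / p0) * 2 ≤
          ((2*2 + (|χ| + c^2)) / p0) * (ψ y ^2 + ψ' y^2) := by
        rw [mul_div_assoc', div_mul_eq_mul_div, div_mul_eq_mul_div]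
        apply div_le_div_of_nonneg_right _ hp0.le
        have hk : 0 ≤ |χ| + c^2 := by positivity
        have e1 := sq_abs (ψ y)
        have e2 := sq_abs (ψ' y)
        nlinarith [mul_nonneg hk (sq_nonneg (|ψ y| - |ψ' y|)), sq_nonneg (|ψ y|)]
      have h8 : 2 * ψ y * ψ' y ≤ ψ y^2 + ψ' y^2 := by nlinarith [sq_nonneg (ψ y - ψ' y)]
      rw [hC]
      linarith)
  simp only [h0, h1] at hE
  have : ψ x ^2 ≤ 0 := by nlinarith [sq_nonneg (ψ' x)]
  exact pow_eq_zero_iff (two_ne_zero) |>.1 (le_antisymm this (sq_nonneg _))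

theorem RODE.unique (h : RODE c χ ψ ψ' ψ'') {t : ℝ} (ht : t ∈ Ioo (-1:ℝ) 1)
    (h0 : ψ t = 0) (h1 : ψ' t = 0) : ∀ x ∈ Ioo (-1:ℝ) 1, ψ x = 0 := by
  intro x hx
  rcases le_total t x with hle | hle
  · exact h.unique_right ht.1 h0 h1 x ⟨hle, hx.2⟩
  · have := h.refl.unique_right (t := -t) (by linarith [ht.2]) (by simpa using h0) (by simpa using h1) (-x)
      ⟨by linarith, by linarith [hx.1]⟩
    simpa using this

theorem RODE.not_both_zero (h : RODE c χ ψ ψ' ψ'') (hn : ∫ t in (-1:ℝ)..1, (ψ t)^2 = 1)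
    {t : ℝ} (ht : t ∈ Ioo (-1:ℝ) 1) (h0 : ψ t = 0) : ψ' t ≠ 0 := by
  intro h1
  have hz := h.unique ht h0 h1
  have hcl : ∀ x ∈ Icc (-1:ℝ) 1, ψ x = 0 := by
    have : closure (Ioo (-1:ℝ) 1) = Icc (-1) 1 := closure_Ioo (by norm_num)
    rw [← this]
    intro x hx
    have hcl : IsClosed {x | ψ x = 0} := isClosed_eq h.cont continuous_const
    exact hcl.closure_subset_iff.2 (fun y hy => hz y hy) hx
  have : ∫ t in (-1:ℝ)..1, (ψ t)^2 = 0 := by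
    rw [intervalIntegral.integral_congr (g := fun _ => 0)]
    · simp
    · intro x hx
      rw [uIcc_of_le (by norm_num)] at hx
      simp [hcl x hx]
  linarith

theorem RODE.psi_zero_mul (h : RODE c χ ψ ψ' ψ'') : ψ 0 * ψ' 0 = 0 := by
  have hd : ∀ x, HasDerivAt (fun x => ((1 - x^2) * ψ' x) * ψ (-x) - ψ x * ((1 - x^2) * (-ψ' (-x)))) 0 x := by
    intro x
    have e1 := h.dw x
    have e2 := h.refl.dw x
    refine ((e1.mul (h.refl.d1 x)).sub ((h.d1 x).mul e2)).congr_deriv ?_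
    ring
  have := is_const_of_deriv_eq_zero (fun x => (hd x).differentiableAt) (fun x => (hd x).deriv) 0 1
  simp at this
  nlinarith

end

section
variable {c χ : ℝ} {ψ ψ' ψ'' : ℝ → ℝ}

theorem sqrt_hasDerivAt_one_sub (k : ℝ) {x : ℝ} (A : ℝ) (hx : 0 < A - k * x^2) :
    HasDerivAt (fun x => √(A - k * x^2)) (- (k * x) / √(A - k * x^2)) x := by
  have h1 : HasDerivAt (fun x : ℝ => A - k * x^2) (-(2*k*x)) x := by
    have := ((hasDerivAt_pow 2 x).const_mul k).const_sub A
    refine this.congr_deriv ?_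
    simp; ring
  refine (h1.sqrt hx.ne').congr_deriv ?_
  have := sqrt_pos.2 hx
  field_simp

/-- derivative of the Prüfer variable, bound -/
theorem prufer_deriv (h : RODE c χ ψ ψ' ψ'') (hc : 0 < c) {σ : ℝ} (hσ : 0 < σ)
    (hχ : χ ≤ c^2 * (1 + σ)) {x : ℝ} (hx : x ∈ Ioo (-1:ℝ) 1) (hw : ψ' x ≠ 0) :
    ∃ r', HasDerivAt (fun x => √(1 - 1 * x^2) * √(c^2*(1+σ) - c^2 * x^2) * (ψ x / ((1 - x^2) * ψ' x))
        - x/2 * (√(c^2*(1+σ) - c^2 * x^2)^2 + c^2 * √(1 - 1 * x^2)^2) /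
          (√(c^2*(1+σ) - c^2 * x^2)^3 * √(1 - 1 * x^2))) r' x ∧
      r' ≤ (√(c^2*(1+σ) - c^2 * x^2) / √(1 - 1 * x^2)) * (1 + (√(1 - 1 * x^2) * √(c^2*(1+σ) - c^2 * x^2) * (ψ x / ((1 - x^2) * ψ' x))
        - x/2 * (√(c^2*(1+σ) - c^2 * x^2)^2 + c^2 * √(1 - 1 * x^2)^2) /
          (√(c^2*(1+σ) - c^2 * x^2)^3 * √(1 - 1 * x^2)))^2) := by
  have hx2 : x^2 < 1 := by nlinarith [hx.1, hx.2]
  have hp : 0 < 1 - 1 * x^2 := by linarith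
  have hQ : 0 < c^2*(1+σ) - c^2 * x^2 := by
    have : 0 < c^2 * (1 + σ - x^2) := by apply mul_pos (by positivity); linarith
    linarith
  have du := sqrt_hasDerivAt_one_sub 1 1 hp
  have dv := sqrt_hasDerivAt_one_sub (c^2) (c^2*(1+σ)) hQ
  have hp' : (1 - x^2) * ψ' x ≠ 0 := mul_ne_zero (by linarith) hw
  have dy := (h.d1 x).div (h.dw x) hp'
  have hu0 := sqrt_pos.2 hp
  have hv0 := sqrt_pos.2 hQ
  have hu2 := sq_sqrt hp.le
  have hv2 := sq_sqrt hQ.le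
  have dm := (((hasDerivAt_id x).div_const 2).mul ((dv.pow 2).add ((du.pow 2).const_mul (c^2)))).div
    ((dv.pow 3).mul du) (by simp only [Pi.mul_apply, Pi.pow_apply]; positivity)
  refine ⟨_, ((du.mul dv).mul dy).sub dm, ?_⟩
  simp only [Pi.mul_apply, Pi.div_apply, Pi.pow_apply, Pi.add_apply, id]
  set u := √(1 - 1 * x^2)
  set v := √(c^2*(1+σ) - c^2 * x^2)
  set y := ψ x / ((1 - x^2) * ψ' x) with hy
  have e1 : (ψ' x * ((1 - x ^ 2) * ψ' x) - ψ x * (-(χ - c ^ 2 * x ^ 2) * ψ x)) / ((1 - x ^ 2) * ψ' x) ^ 2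
      = 1/u^2 + (χ - c^2*x^2) * y^2 := by
    rw [hy, hu2, one_mul, div_pow]
    have : (1 - x^2) ≠ 0 := by linarith
    field_simp
    ring
  rw [e1]
  have hq : χ - c^2*x^2 ≤ v^2 := by rw [hv2]; linarith
  have key : (v / u) * (1 + (u * v * y - x/2 * (v^2 + c^2*u^2) / (v^3*u))^2) -
     (( -(1 * x) / u * v + u * (-(c ^ 2 * x) / v)) * y + u * v * (1 / u ^ 2 + v^2 * y ^ 2) -
      ((1 / 2 * (v ^ 2 + c ^ 2 * u ^ 2) +
              x / 2 * (2 * v ^ (2 - 1) * (-(c ^ 2 * x) / v) + c ^ 2 * (2 * u ^ (2 - 1) * (-(1 * x) / u)))) *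
            (v ^ 3 * u) -
          x / 2 * (v ^ 2 + c ^ 2 * u ^ 2) *
            (3 * v ^ (3 - 1) * (-(c ^ 2 * x) / v) * u + v ^ 3 * (-(1 * x) / u))) /
        (v ^ 3 * u) ^ 2) = (v/u) * (x/2 * (v^2 + c^2*u^2) / (v^3*u))^2 + (1/2) * (v^2+c^2*u^2)/(v^3*u) +
          (x^2/2) * (v^4 + 3*c^4*u^4)/(v^5*u^3) := by
    norm_num
    field_simp
    ring
  have pos : 0 ≤ (v/u) * (x/2 * (v^2 + c^2*u^2) / (v^3*u))^2 + (1/2) * (v^2+c^2*u^2)/(v^3*u) +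
          (x^2/2) * (v^4 + 3*c^4*u^4)/(v^5*u^3) := by positivity
  have h3 : u * v * ((χ - c^2*x^2) * y^2) ≤ u * v * (v^2 * y^2) := by gcongr
  push_cast
  linarith

end

section
variable {c χ : ℝ} {ψ ψ' ψ'' : ℝ → ℝ}

theorem prufer_gap_pos (h : RODE c χ ψ ψ' ψ'') (hc : 0 < c) {σ : ℝ} (hσ : 0 < σ)
    (hχ : χ ≤ c^2 * (1 + σ)) {S : ℝ → ℝ}
    (hS : ∀ x ∈ Ioo (-1:ℝ) 1, HasDerivAt S (√(c^2*(1+σ) - c^2 * x^2) / √(1 - 1 * x^2)) x)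
    {a b : ℝ} (ha : -1 < a) (hab : a < b) (hb : b < 1)
    (hpos : ∀ x ∈ Ioo a b, 0 < ψ' x) (ha0 : ψ' a = 0) (hb0 : ψ' b = 0)
    (hψa : ψ a < 0) (hψb : 0 < ψ b) : π ≤ S b - S a := by
  obtain ⟨ρ, hρ⟩ : ∃ ρ : ℝ → ℝ, ρ = (fun x => √(1 - 1 * x^2) * √(c^2*(1+σ) - c^2 * x^2) * (ψ x / ((1 - x^2) * ψ' x))
        - x/2 * (√(c^2*(1+σ) - c^2 * x^2)^2 + c^2 * √(1 - 1 * x^2)^2) /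
          (√(c^2*(1+σ) - c^2 * x^2)^3 * √(1 - 1 * x^2))) := ⟨_, rfl⟩
  have hsub : Ioo a b ⊆ Ioo (-1:ℝ) 1 := fun x hx => ⟨by linarith [hx.1], by linarith [hx.2]⟩
  have hd : ∀ x ∈ Ioo a b, ∃ r', HasDerivAt ρ r' x ∧
      r' ≤ (√(c^2*(1+σ) - c^2 * x^2) / √(1 - 1 * x^2)) * (1 + (ρ x)^2) := by
    intro x hx
    rw [hρ]
    exact prufer_deriv h hc hσ hχ (hsub hx) (hpos x hx).ne'
  choose! r' hr' hr'' using hd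
  have mono : ∀ x1 ∈ Ioo a b, ∀ x2 ∈ Ioo a b, x1 ≤ x2 → S x1 - arctan (ρ x1) ≤ S x2 - arctan (ρ x2) := by
    intro x1 h1 x2 h2 h12
    have hs2 : Icc x1 x2 ⊆ Ioo a b := fun x hx => ⟨by linarith [hx.1, h1.1], by linarith [hx.2, h2.2]⟩
    have hD : ∀ x ∈ Icc x1 x2, HasDerivAt (fun x => S x - arctan (ρ x))
       (√(c^2*(1+σ) - c^2 * x^2) / √(1 - 1 * x^2) - 1 / (1 + (ρ x)^2) * r' x) x :=
      fun x hx => (hS x (hsub (hs2 hx))).sub (hr' x (hs2 hx)).arctan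
    refine le_of_hasDerivAt_nonneg h12 (fun x hx => (hD x hx).continuousAt.continuousWithinAt)
      (fun x hx => hD x (Ioo_subset_Icc_self hx)) ?_
    intro x hx
    have h5 := hr'' x (hs2 (Ioo_subset_Icc_self hx))
    have h6 : 0 < 1 + (ρ x)^2 := by positivity
    rw [sub_nonneg, one_div, inv_mul_le_iff₀ h6]
    linarith
  have hp : ∀ x ∈ Ioo (-1:ℝ) 1, 0 < 1 - 1 * x^2 := fun x hx => by nlinarith [hx.1, hx.2]
  have hQ : ∀ x ∈ Ioo (-1:ℝ) 1, 0 < c^2*(1+σ) - c^2 * x^2 := fun x hx => by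
    have := hp x hx
    have : 0 < c^2 * (1 + σ - x^2) := by apply mul_pos (by positivity); linarith
    linarith
  have hwlim : ∀ e ∈ Ioo (-1:ℝ) 1, ψ' e = 0 →
      Filter.Tendsto (fun x => ((1 - x^2) * ψ' x)⁻¹) (nhdsWithin e (Ioo a b)) Filter.atTop := by
    intro e he he0
    have h1 : Filter.Tendsto (fun x => (1 - x^2) * ψ' x) (nhdsWithin e (Ioo a b)) (nhdsWithin 0 (Ioi 0)) := by
      refine tendsto_nhdsWithin_iff.2 ⟨?_, ?_⟩
      · have : ContinuousAt (fun x => (1 - x^2) * ψ' x) e := (h.dw e).continuousAt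
        have h2 := this.tendsto
        simp only [he0, mul_zero] at h2
        exact h2.mono_left nhdsWithin_le_nhds
      · filter_upwards [self_mem_nhdsWithin] with x hx
        have := hp x (hsub hx)
        exact mul_pos (by linarith) (hpos x hx)
    exact tendsto_inv_nhdsGT_zero.comp h1
  have hBc : ∀ e ∈ Ioo (-1:ℝ) 1, Filter.Tendsto (fun x => √(1 - 1 * x^2) * √(c^2*(1+σ) - c^2 * x^2) * ψ x)
      (nhdsWithin e (Ioo a b)) (nhds (√(1 - 1 * e^2) * √(c^2*(1+σ) - c^2 * e^2) * ψ e)) := by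
    intro e he
    have : Continuous (fun x => √(1 - 1 * x^2) * √(c^2*(1+σ) - c^2 * x^2) * ψ x) := by
      have := h.cont; fun_prop
    exact (this.tendsto e).mono_left nhdsWithin_le_nhds
  have hmc : ∀ e ∈ Ioo (-1:ℝ) 1, Filter.Tendsto (fun x => - (x/2 * (√(c^2*(1+σ) - c^2 * x^2)^2 + c^2 * √(1 - 1 * x^2)^2) /
          (√(c^2*(1+σ) - c^2 * x^2)^3 * √(1 - 1 * x^2))))
      (nhdsWithin e (Ioo a b)) (nhds (- (e/2 * (√(c^2*(1+σ) - c^2 * e^2)^2 + c^2 * √(1 - 1 * e^2)^2) /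
          (√(c^2*(1+σ) - c^2 * e^2)^3 * √(1 - 1 * e^2))))) := by
    intro e he
    have h1 := sqrt_pos.2 (hp e he)
    have h2 := sqrt_pos.2 (hQ e he)
    have h3 : √(c^2*(1+σ) - c^2 * e^2)^3 * √(1 - 1 * e^2) ≠ 0 := by positivity
    have : ContinuousAt (fun x => - (x/2 * (√(c^2*(1+σ) - c^2 * x^2)^2 + c^2 * √(1 - 1 * x^2)^2) /
          (√(c^2*(1+σ) - c^2 * x^2)^3 * √(1 - 1 * x^2)))) e := by
      apply ContinuousAt.neg
      refine ContinuousAt.div (f := fun x => x/2 * (√(c^2*(1+σ) - c^2 * x^2)^2 + c^2 * √(1 - 1 * x^2)^2))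
        (g := fun x => (√(c^2*(1+σ) - c^2 * x^2)^3 * √(1 - 1 * x^2))) ?_ ?_ h3
      · fun_prop
      · fun_prop
    exact this.tendsto.mono_left nhdsWithin_le_nhds
  have hBpos : ∀ e ∈ Ioo (-1:ℝ) 1, 0 < √(1 - 1 * e^2) * √(c^2*(1+σ) - c^2 * e^2) := fun e he =>
    mul_pos (sqrt_pos.2 (hp e he)) (sqrt_pos.2 (hQ e he))
  have haI : a ∈ Ioo (-1:ℝ) 1 := ⟨ha, by linarith⟩
  have hbI : b ∈ Ioo (-1:ℝ) 1 := ⟨by linarith, hb⟩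
  have hρe : ρ = fun x => (√(1 - 1 * x^2) * √(c^2*(1+σ) - c^2 * x^2) * ψ x) * ((1 - x^2) * ψ' x)⁻¹ +
      - (x/2 * (√(c^2*(1+σ) - c^2 * x^2)^2 + c^2 * √(1 - 1 * x^2)^2) /
          (√(c^2*(1+σ) - c^2 * x^2)^3 * √(1 - 1 * x^2))) := by
    rw [hρ]; funext x; ring
  have la : Filter.Tendsto ρ (nhdsWithin a (Ioo a b)) Filter.atBot := by
    rw [hρe]
    refine Filter.Tendsto.atBot_add ?_ (hmc a haI)
    exact (hBc a haI).neg_mul_atTop (mul_neg_of_pos_of_neg (hBpos a haI) hψa) (hwlim a haI ha0)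
  have lb : Filter.Tendsto ρ (nhdsWithin b (Ioo a b)) Filter.atTop := by
    rw [hρe]
    refine Filter.Tendsto.atTop_add ?_ (hmc b hbI)
    exact (hBc b hbI).pos_mul_atTop (mul_pos (hBpos b hbI) hψb) (hwlim b hbI hb0)
  have nea : (nhdsWithin a (Ioo a b)).NeBot := left_nhdsWithin_Ioo_neBot hab
  have neb : (nhdsWithin b (Ioo a b)).NeBot := right_nhdsWithin_Ioo_neBot hab
  have Ta : Filter.Tendsto (fun x => S x - arctan (ρ x)) (nhdsWithin a (Ioo a b)) (nhds (S a - (-(π/2)))) :=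
    ((hS a haI).continuousAt.tendsto.mono_left nhdsWithin_le_nhds).sub
      ((tendsto_arctan_atBot.mono_right nhdsWithin_le_nhds).comp la)
  have Tb : Filter.Tendsto (fun x => S x - arctan (ρ x)) (nhdsWithin b (Ioo a b)) (nhds (S b - (π/2))) :=
    ((hS b hbI).continuousAt.tendsto.mono_left nhdsWithin_le_nhds).sub
      ((tendsto_arctan_atTop.mono_right nhdsWithin_le_nhds).comp lb)
  have step : ∀ x2 ∈ Ioo a b, S a - (-(π/2)) ≤ S x2 - arctan (ρ x2) := by
    intro x2 h2
    refine le_of_tendsto Ta ?_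
    have : Iio x2 ∈ nhdsWithin a (Ioo a b) := mem_nhdsWithin_of_mem_nhds (Iio_mem_nhds h2.1)
    filter_upwards [this, self_mem_nhdsWithin] with x hx hx'
    exact mono x hx' x2 h2 (le_of_lt hx)
  have : S a - (-(π/2)) ≤ S b - π/2 := by
    refine ge_of_tendsto Tb ?_
    filter_upwards [self_mem_nhdsWithin] with x hx
    exact step x hx
  linarith

theorem prufer_gap (h : RODE c χ ψ ψ' ψ'') (hn : ∫ t in (-1:ℝ)..1, (ψ t)^2 = 1) (hc : 0 < c) {σ : ℝ} (hσ : 0 < σ)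
    (hχ : χ ≤ c^2 * (1 + σ)) {S : ℝ → ℝ}
    (hS : ∀ x ∈ Ioo (-1:ℝ) 1, HasDerivAt S (√(c^2*(1+σ) - c^2 * x^2) / √(1 - 1 * x^2)) x)
    {d t e : ℝ} (hd : -1 < d) (hdt : d < t) (hte : t < e) (he : e < 1)
    (hd0 : ψ' d = 0) (he0 : ψ' e = 0) (ht0 : ψ t = 0) : π ≤ S e - S d := by
  have hnz : ∀ x ∈ Ioo (-1:ℝ) 1, ψ x = 0 → ψ' x ≠ 0 := fun x hx => h.not_both_zero hn hx
  have htn : ψ' t ≠ 0 := hnz t ⟨by linarith, by linarith⟩ ht0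
  have hcl : IsClosed {x | ψ' x = 0} := isClosed_eq h.cont' continuous_const
  -- last zero before t
  obtain ⟨a, haG⟩ : ∃ a, IsGreatest ({x | ψ' x = 0} ∩ Icc d t) a :=
    (isCompact_Icc.inter_left hcl).exists_isGreatest ⟨d, hd0, left_mem_Icc.2 hdt.le⟩
  obtain ⟨b, hbL⟩ : ∃ b, IsLeast ({x | ψ' x = 0} ∩ Icc t e) b :=
    (isCompact_Icc.inter_left hcl).exists_isLeast ⟨e, he0, right_mem_Icc.2 hte.le⟩
  have ha0 : ψ' a = 0 := haG.1.1
  have hb0 : ψ' b = 0 := hbL.1.1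
  have hat : a < t := lt_of_le_of_ne haG.1.2.2 (fun h => htn (h ▸ ha0))
  have htb : t < b := lt_of_le_of_ne hbL.1.2.1 (fun h => htn (h ▸ hb0))
  have had := haG.1.2.1
  have hbe := hbL.1.2.2
  have hab : a < b := hat.trans htb
  have hne : ∀ x ∈ Ioo a b, ψ' x ≠ 0 := by
    intro x hx h0
    rcases le_total x t with hxt | hxt
    · exact absurd (haG.2 ⟨h0, by linarith [hx.1], hxt⟩) (not_le.2 hx.1)
    · exact absurd (hbL.2 ⟨h0, hxt, by linarith [hx.2]⟩) (not_le.2 hx.2)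
  -- S is monotone
  have Smono : ∀ x1 x2, -1 < x1 → x1 ≤ x2 → x2 < 1 → S x1 ≤ S x2 := by
    intro x1 x2 h1 h12 h2
    have hI : Icc x1 x2 ⊆ Ioo (-1:ℝ) 1 := fun x hx => ⟨by linarith [hx.1], by linarith [hx.2]⟩
    exact le_of_hasDerivAt_nonneg h12 (fun x hx => (hS x (hI hx)).continuousAt.continuousWithinAt)
      (fun x hx => hS x (hI (Ioo_subset_Icc_self hx))) (fun x hx => by positivity)
  have hS1 := Smono d a hd had (by linarith)
  have hS2 := Smono b e (by linarith) hbe he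
  suffices π ≤ S b - S a by linarith
  -- sign
  have hsgn : (∀ x ∈ Ioo a b, 0 < ψ' x) ∨ (∀ x ∈ Ioo a b, ψ' x < 0) := by
    by_contra hcon
    push Not at hcon
    obtain ⟨⟨x1, h1, h1'⟩, ⟨x2, h2, h2'⟩⟩ := hcon
    have := isPreconnected_Ioo.intermediate_value h1 h2 h.cont'.continuousOn ⟨h1', h2'⟩
    obtain ⟨x, hx, hx0⟩ := this
    exact hne x hx hx0
  have core : ∀ {ψ ψ' ψ'' : ℝ → ℝ}, RODE c χ ψ ψ' ψ'' → (∀ x ∈ Ioo a b, 0 < ψ' x) → ψ t = 0 → ψ' a = 0 →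
      ψ' b = 0 → π ≤ S b - S a := by
    intro ψ ψ' ψ'' h hpos ht0 ha0 hb0
    have sm : StrictMonoOn ψ (Icc a b) := by
      apply strictMonoOn_of_deriv_pos (convex_Icc a b) h.cont.continuousOn
      intro x hx
      rw [interior_Icc] at hx
      rw [(h.d1 x).deriv]; exact hpos x hx
    have hlt1 := sm (left_mem_Icc.2 hab.le) ⟨hat.le, htb.le⟩ hat
    have hlt2 := sm ⟨hat.le, htb.le⟩ (right_mem_Icc.2 hab.le) htb
    exact prufer_gap_pos h hc hσ hχ hS (by linarith) hab (by linarith) hpos ha0 hb0 (by linarith) (by linarith)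
  rcases hsgn with hs | hs
  · exact core h hs ht0 ha0 hb0
  · exact core h.neg (fun x hx => by have := hs x hx; linarith) (by simp [ht0]) (by simp [ha0]) (by simp [hb0])

theorem count_gaps (h : RODE c χ ψ ψ' ψ'') (hn : ∫ t in (-1:ℝ)..1, (ψ t)^2 = 1) (hc : 0 < c) {σ : ℝ} (hσ : 0 < σ)
    (hχ : χ ≤ c^2 * (1 + σ)) {S : ℝ → ℝ}
    (hS : ∀ x ∈ Ioo (-1:ℝ) 1, HasDerivAt S (√(c^2*(1+σ) - c^2 * x^2) / √(1 - 1 * x^2)) x)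
    {n : ℕ} {t : Fin n → ℝ} (htm : StrictMono t) (ht : ∀ j, t j ∈ Ioo (-1:ℝ) 1) (ht0 : ∀ j, ψ (t j) = 0)
    (hn2 : 2 ≤ n) : ∃ x ∈ Ioo (-1:ℝ) 1, ∃ y ∈ Ioo (-1:ℝ) 1, ((n:ℝ) - 2) * π ≤ S y - S x := by
  have hroll : ∀ j : ℕ, ∀ hj : j + 1 < n, ∃ d ∈ Ioo (t ⟨j, by omega⟩) (t ⟨j+1, hj⟩), ψ' d = 0 := by
    intro j hj
    have hlt : t ⟨j, by omega⟩ < t ⟨j+1, hj⟩ := htm (by simp)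
    exact exists_hasDerivAt_eq_zero hlt h.cont.continuousOn (by rw [ht0, ht0]) (fun x _ => h.d1 x)
  choose d hd hd0 using hroll
  have hdI : ∀ j hj, d j hj ∈ Ioo (-1:ℝ) 1 := fun j hj =>
    ⟨by linarith [(hd j hj).1, (ht ⟨j, by omega⟩).1], by linarith [(hd j hj).2, (ht ⟨j+1, hj⟩).2]⟩
  have key : ∀ k : ℕ, ∀ hk : k + 1 < n, (k:ℝ) * π ≤ S (d k hk) - S (d 0 (by omega)) := by
    intro k
    induction k with
    | zero => intro hk; simp
    | succ k ih =>
      intro hk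
      have := ih (by omega)
      have h2 := prufer_gap h hn hc hσ hχ hS (hdI k (by omega)).1 (hd k (by omega)).2 (hd (k+1) hk).1
        (hdI (k+1) hk).2 (hd0 _ _) (hd0 _ _) (ht0 _)
      push_cast
      linarith
  refine ⟨_, hdI 0 (by omega), _, hdI (n-2) (by omega), ?_⟩
  have := key (n-2) (by omega)
  rw [Nat.cast_sub hn2] at this
  exact_mod_cast this

end

noncomputable def Vf (σ u : ℝ) : ℝ := (u * √(σ + u^2) + σ * log (u + √(σ + u^2))) / 2 - u^2/2

theorem Vf_deriv {σ u : ℝ} (hσ : 0 < σ) : HasDerivAt (Vf σ) (√(σ + u^2) - u) u := by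
  have hpos : 0 < σ + u^2 := by positivity
  have hr := sqrt_pos.2 hpos
  have h1 : HasDerivAt (fun u : ℝ => √(σ + u^2)) (u / √(σ + u^2)) u := by
    have : HasDerivAt (fun u : ℝ => σ + u^2) (2*u) u := by
      simpa using (hasDerivAt_pow 2 u).const_add σ
    refine (this.sqrt hpos.ne').congr_deriv ?_
    field_simp
  have h2 : 0 < u + √(σ + u^2) := by
    have : |u| < √(σ + u^2) := by
      rw [← sqrt_sq_eq_abs]
      exact sqrt_lt_sqrt (sq_nonneg u) (by linarith)
    linarith [neg_abs_le u]
  have h3 := ((((hasDerivAt_id u).mul h1).add ((((hasDerivAt_id u).add h1).log h2.ne').const_mul σ)).div_const 2).sub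
    ((hasDerivAt_pow 2 u).div_const 2)
  refine (h3.congr_deriv ?_)
  have h4 := sq_sqrt hpos.le
  simp only [id, Pi.add_apply]
  set r := √(σ + u^2)
  have h5 : σ = r^2 - u^2 := by linarith
  have h6 : (u + r) ≠ 0 := h2.ne'
  push_cast
  rw [h5]
  field_simp
  ring

theorem Vf_mono {σ u v : ℝ} (hσ : 0 < σ) (huv : u ≤ v) : Vf σ u ≤ Vf σ v := by
  refine le_of_hasDerivAt_nonneg huv (fun x _ => (Vf_deriv hσ).continuousAt.continuousWithinAt)
    (fun x _ => Vf_deriv hσ) (fun x _ => ?_)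
  have : |x| ≤ √(σ + x^2) := by
    rw [← sqrt_sq_eq_abs]
    exact sqrt_le_sqrt (by linarith)
  linarith [le_abs_self x]

noncomputable def Jf (σ : ℝ) : ℝ := 1 - Vf σ 0 + Vf σ 2

theorem S_bound {c σ : ℝ} (hc : 0 < c) (hσ : 0 < σ) {T : ℝ → ℝ} (hT0 : T 0 = 0)
    (hT : ∀ x ∈ Ioo (-1:ℝ) 1, HasDerivAt T (√(c^2*(1+σ) - c^2 * x^2) / √(1 - 1 * x^2)) x)
    {x : ℝ} (hx : x ∈ Ico (0:ℝ) 1) : T x ≤ c * Jf σ := by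
  have hd : ∀ y ∈ Ico (0:ℝ) 1, HasDerivAt (fun y => c * (y - Vf σ (2 * √((1-y)/(1+y)))) - T y)
      (c * (1 - (√(σ + (2 * √((1-y)/(1+y)))^2) - (2 * √((1-y)/(1+y)))) *
        (2 * ((((-1) * (1+y) - (1-y) * 1) / (1+y)^2) / (2 * √((1-y)/(1+y))))))
        - √(c^2*(1+σ) - c^2 * y^2) / √(1 - 1 * y^2)) y := by
    intro y hy
    have h1 : 0 < (1-y)/(1+y) := div_pos (by linarith [hy.2]) (by linarith [hy.1])
    have h2 : HasDerivAt (fun y : ℝ => (1-y)/(1+y)) (((-1) * (1+y) - (1-y) * 1) / (1+y)^2) y :=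
      ((hasDerivAt_id y).const_sub 1).div ((hasDerivAt_id y).const_add 1) (by
        have := hy.1
        simp; linarith)
    have h3 := (h2.sqrt h1.ne').const_mul 2
    have h4 : HasDerivAt (fun y => Vf σ (2 * √((1-y)/(1+y)))) _ y := (Vf_deriv hσ).comp y h3
    exact ((((hasDerivAt_id y).sub h4).const_mul c).sub (hT y ⟨by linarith [hy.1], hy.2⟩))
  have hI : Icc 0 x ⊆ Ico (0:ℝ) 1 := fun y hy => ⟨hy.1, lt_of_le_of_lt hy.2 hx.2⟩
  have := le_of_hasDerivAt_nonneg hx.1 (fun y hy => (hd y (hI hy)).continuousAt.continuousWithinAt)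
    (fun y hy => hd y (hI (Ioo_subset_Icc_self hy))) (by
      intro y hy
      have hy' := hI (Ioo_subset_Icc_self hy)
      have h1 : 0 < (1-y)/(1+y) := div_pos (by linarith [hy'.2]) (by linarith [hy'.1])
      have hv := sqrt_pos.2 h1
      have hv2 := sq_sqrt h1.le
      set v := √((1-y)/(1+y)) with hvdef
      have hy1 : 0 < 1 + y := by linarith [hy'.1]
      have hy2 : 0 < 1 - y := by linarith [hy'.2]
      have hp : 0 < 1 - 1 * y^2 := by nlinarith
      rw [← sqrt_div (by nlinarith [mul_pos (pow_pos hc 2) hσ, mul_pos (pow_pos hc 2) hp])]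
      -- r
      set r := √(σ + (2*v)^2) with hr
      have hr2 : r^2 = σ + (2*v)^2 := sq_sqrt (by positivity)
      have hrv : 2*v ≤ r := by
        rw [hr]; apply le_sqrt_of_sq_le; linarith
      have e1 : 1 - (r - 2*v) * (2 * ((-1 * (1 + y) - (1 - y) * 1) / (1 + y)^2 / (2*v))) =
          1 + (4/(1+y)^2) * (r/(2*v) - 1) := by
        field_simp
        ring
      rw [e1, sub_nonneg]
      rw [sqrt_le_left (by
        have : 0 ≤ r/(2*v) - 1 := by
          rw [sub_nonneg, le_div_iff₀ (by positivity)]; linarith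
        positivity)]
      have e2 : (c^2*(1+σ) - c^2*y^2)/(1 - 1*y^2) = c^2 * (1 + (4/(1+y)^2) * ((r/(2*v))^2 - 1)) := by
        rw [div_pow, hr2]
        have : (2*v)^2 = 4 * ((1-y)/(1+y)) := by rw [mul_pow, hv2]; norm_num
        rw [this]
        have h7 : (1 - 1*y^2) = (1-y)*(1+y) := by ring
        rw [h7]
        field_simp
        ring
      rw [e2, mul_pow]
      apply mul_le_mul_of_nonneg_left _ (by positivity)
      set k := 4/(1+y)^2 with hk
      have hk1 : 1 ≤ k := by
        rw [hk, le_div_iff₀ (by positivity)]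
        nlinarith [hy'.1, hy'.2]
      have hw : 0 ≤ r/(2*v) - 1 := by
        rw [sub_nonneg, le_div_iff₀ (by positivity)]; linarith
      set w := r/(2*v)
      have : 0 ≤ k * (w - 1) * ((k - 1) * (w - 1)) := by
        have : 0 ≤ k - 1 := by linarith
        positivity
      nlinarith)
  have h0 : 2 * √((1-(0:ℝ))/(1+0)) = 2 := by norm_num
  rw [h0, hT0] at this
  have hV : Vf σ 0 ≤ Vf σ (2 * √((1-x)/(1+x))) := Vf_mono hσ (by positivity)
  have : T x ≤ c * (x - Vf σ (2 * √((1-x)/(1+x))) + Vf σ 2) := by linarith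
  refine this.trans ?_
  unfold Jf
  apply mul_le_mul_of_nonneg_left _ hc.le
  linarith [hx.2]

theorem exists_S {c σ : ℝ} : ∃ S : ℝ → ℝ, S 0 = 0 ∧
    (0 < c → 0 < σ → ∀ x ∈ Ioo (-1:ℝ) 1, HasDerivAt S (√(c^2*(1+σ) - c^2 * x^2) / √(1 - 1 * x^2)) x) := by
  refine ⟨fun x => ∫ y in (0:ℝ)..x, √(c^2*(1+σ) - c^2 * y^2) / √(1 - 1 * y^2), by simp, ?_⟩
  intro hc hσ x hx
  have hco : ContinuousOn (fun y : ℝ => √(c^2*(1+σ) - c^2 * y^2) / √(1 - 1 * y^2)) (Ioo (-1:ℝ) 1) := by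
    apply ContinuousOn.div (by fun_prop) (by fun_prop)
    intro y hy
    exact (sqrt_pos.2 (by nlinarith [hy.1, hy.2])).ne'
  apply intervalIntegral.integral_hasDerivAt_right
  · apply ContinuousOn.intervalIntegrable
    apply hco.mono
    intro y hy
    have h0 : (0:ℝ) ∈ Ioo (-1:ℝ) 1 := by norm_num
    exact (ordConnected_Ioo.uIcc_subset h0 hx) hy
  · exact hco.stronglyMeasurableAtFilter isOpen_Ioo x hx
  · exact hco.continuousAt (isOpen_Ioo.mem_nhds hx)

theorem count_bound {c χ : ℝ} {ψ ψ' ψ'' : ℝ → ℝ} (h : RODE c χ ψ ψ' ψ'') (hn : ∫ t in (-1:ℝ)..1, (ψ t)^2 = 1) (hc : 0 < c) {σ : ℝ} (hσ : 0 < σ)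
    (hχ : χ ≤ c^2 * (1 + σ)) 
    {n : ℕ} {t : Fin n → ℝ} (htm : StrictMono t) (ht : ∀ j, t j ∈ Ioo (-1:ℝ) 1) (ht0 : ∀ j, ψ (t j) = 0)
    (hn2 : 2 ≤ n) : ((n:ℝ) - 2) * π ≤ 2 * c * Jf σ := by
  obtain ⟨S, hS0, hS⟩ := exists_S (c := c) (σ := σ)
  replace hS := hS hc hσ
  obtain ⟨x, hx, y, hy, hxy⟩ := count_gaps h hn hc hσ hχ hS htm ht ht0 hn2
  have Smono : ∀ x1 x2, -1 < x1 → x1 ≤ x2 → x2 < 1 → S x1 ≤ S x2 := by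
    intro x1 x2 h1 h12 h2
    have hI : Icc x1 x2 ⊆ Ioo (-1:ℝ) 1 := fun x hx => ⟨by linarith [hx.1], by linarith [hx.2]⟩
    exact le_of_hasDerivAt_nonneg h12 (fun x hx => (hS x (hI hx)).continuousAt.continuousWithinAt)
      (fun x hx => hS x (hI (Ioo_subset_Icc_self hx))) (fun x hx => by positivity)
  have b1 : S y ≤ c * Jf σ := by
    have hyy : |y| < 1 := abs_lt.2 ⟨hy.1, hy.2⟩
    exact (Smono y |y| hy.1 (le_abs_self y) hyy).trans (S_bound hc hσ hS0 hS ⟨abs_nonneg y, hyy⟩)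
  have b2 : - S x ≤ c * Jf σ := by
    have hxx : |x| < 1 := abs_lt.2 ⟨hx.1, hx.2⟩
    have h1 := Smono (-|x|) x (by linarith) (neg_abs_le x) hx.2
    have h2 := S_bound (T := fun x => - S (-x)) hc hσ (by simp [hS0]) (by
      intro z hz
      have := ((hS (-z) ⟨by linarith [hz.2], by linarith [hz.1]⟩).comp z (hasDerivAt_neg z)).neg
      refine this.congr_deriv ?_
      simp) ⟨abs_nonneg x, hxx⟩
    linarith
  linarith

/-- simple upper bound for `Jf` -/
theorem Jf_le {σ : ℝ} (hσ : 0 < σ) :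
    Jf σ ≤ 1 + σ/4 + (σ/2) * (log 4 + σ/16) - (σ/4) * log σ := by
  unfold Jf Vf
  have h1 : √(σ + 0^2) = √σ := by norm_num
  have h2 : log (0 + √(σ+0^2)) = log σ / 2 := by rw [zero_add, h1, log_sqrt hσ.le]
  rw [h2]
  have h3 : √(σ + 2^2) ≤ 2 + σ/4 := by
    rw [sqrt_le_left (by positivity)]
    nlinarith
  have h4 : log (2 + √(σ + 2^2)) ≤ log 4 + σ/16 := by
    have h5 : 2 + √(σ+2^2) ≤ 4 * (1 + σ/16) := by linarith
    calc log (2 + √(σ + 2^2)) ≤ log (4 * (1 + σ/16)) := log_le_log (by positivity) h5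
      _ = log 4 + log (1 + σ/16) := log_mul (by norm_num) (by positivity)
      _ ≤ log 4 + σ/16 := by
        have := log_le_sub_one_of_pos (show 0 < 1 + σ/16 by positivity)
        linarith
  have h6 : σ * log (2 + √(σ + 2^2)) ≤ σ * (log 4 + σ/16) := by gcongr
  linarith

noncomputable def gnum (β s : ℝ) : ℝ := (1-β)/4 * (4 * log 2 + 1 - log s) + (β/4) * log β - β^2 * s/32

theorem chi_lower {c χ : ℝ} {ψ ψ' ψ'' : ℝ → ℝ} (h : RODE c χ ψ ψ' ψ'')
    (hn : ∫ t in (-1:ℝ)..1, (ψ t)^2 = 1) (hc : 30 < c) {s β : ℝ} (hs : 0 < s) (hs5 : s < 5) (hβ : 0 < β)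
    {n : ℕ} {t : Fin n → ℝ} (htm : StrictMono t) (ht : ∀ j, t j ∈ Ioo (-1:ℝ) 1) (ht0 : ∀ j, ψ (t j) = 0)
    (hnν : 2*c/π + (c*s/(2*π)) * log (16 * exp 1 * c / (c*s)) < n)
    (hg : π ≤ c * s * gnum β s) : c^2 * (1 + β * s) < χ := by
  by_contra hcon
  push Not at hcon
  have hc0 : 0 < c := by linarith
  have hlog : log (16 * exp 1 * c / (c*s)) = 4 * log 2 + 1 - log s := by
    have : 16 * exp 1 * c / (c*s) = 2^4 * exp 1 / s := by field_simp; norm_num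
    rw [this, log_div (by positivity) hs.ne', log_mul (by positivity) (by positivity), log_exp, log_pow]
    norm_num
  have hpos : 0 < 4 * log 2 + 1 - log s := by
    have h1 : log s < log 8 := log_lt_log hs (by linarith)
    have h2 : log 8 = 3 * log 2 := by
      rw [show (8:ℝ) = 2^3 by norm_num, log_pow]; norm_num
    have := log_two_gt_d9
    linarith
  rw [hlog] at hnν
  have hπ := pi_pos
  have e1 : 2*c/π + (c*s/(2*π)) * (4 * log 2 + 1 - log s) = (2*c + (c*s/2) * (4 * log 2 + 1 - log s)) / π := by
    field_simp
  rw [e1, div_lt_iff₀ hπ] at hnν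
  have hn2 : 2 ≤ n := by
    by_contra hlt
    have : (n:ℝ) ≤ 1 := by
      have : n ≤ 1 := by omega
      exact_mod_cast this
    have h4 := pi_lt_four
    have : 0 < (c*s/2) * (4 * log 2 + 1 - log s) := by positivity
    nlinarith
  have hJ := count_bound h hn hc0 (σ := β * s) (by positivity) hcon htm ht ht0 hn2
  have hJ2 := Jf_le (σ := β * s) (by positivity)
  have hl4 : log 4 = 2 * log 2 := by rw [show (4:ℝ) = 2^2 by norm_num, log_pow]; norm_num
  rw [log_mul hβ.ne' hs.ne', hl4] at hJ2
  have : 2 * c * Jf (β*s) ≤ 2 * c * (1 + β*s/4 + (β*s/2) * (2 * log 2 + β*s/16) - (β*s/4) * (log β + log s)) :=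
    mul_le_mul_of_nonneg_left hJ2 (by positivity)
  unfold gnum at hg
  have e3 : 2 * c * (1 + β*s/4 + (β*s/2) * (2 * log 2 + β*s/16) - (β*s/4) * (log β + log s)) =
     2*c + (c*s/2) * (4 * log 2 + 1 - log s) - 2 * (c * s * ((1-β)/4 * (4 * log 2 + 1 - log s) + (β/4) * log β - β^2 * s/32)) := by
    ring
  linarith

theorem log_le_of_pow {x : ℝ} (hx : 0 < x) (a b : ℕ) (hb : 0 < b) (h : x^b ≤ 2^a) : log x ≤ a / b * log 2 := by
  have h1 := log_le_log (by positivity) h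
  rw [log_pow, log_pow] at h1
  have hb' : (0:ℝ) < b := by exact_mod_cast hb
  rw [div_mul_eq_mul_div, le_div_iff₀ hb']
  linarith

theorem log_ge_of_pow {x : ℝ} (hx : 0 < x) (a b : ℕ) (hb : 0 < b) (h : 1 ≤ 2^a * x^b) : -(a / b * log 2) ≤ log x := by
  have h1 := log_le_log (by positivity) h
  rw [log_mul (by positivity) (by positivity), log_pow, log_pow, log_one] at h1
  have hb' : (0:ℝ) < b := by exact_mod_cast hb
  rw [div_mul_eq_mul_div, neg_le, ← neg_le_neg_iff, neg_neg]
  rw [neg_le_iff_add_nonneg, ← sub_nonneg] 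
  have : 0 ≤ (a * log 2 + b * log x) / b := by positivity
  have e : (a * log 2 + b * log x) / b = a * log 2 / b + log x := by field_simp
  rw [e] at this
  linarith

theorem gnum_anti {β s s' : ℝ} (hβ1 : β ≤ 1) (hs : 0 < s) (hss : s ≤ s') : gnum β s' ≤ gnum β s := by
  unfold gnum
  have h1 : log s ≤ log s' := log_le_log hs hss
  have h2 : (1-β)/4 * (4 * log 2 + 1 - log s') ≤ (1-β)/4 * (4 * log 2 + 1 - log s) := by
    apply mul_le_mul_of_nonneg_left _ (by linarith); linarith
  have h3 : β^2 * s ≤ β^2 * s' := by gcongr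
  linarith

theorem gnum_70 {c s : ℝ} (hc : 30 < c) (hs : 0 < s) (hs5 : s < 5) (hα : 89.6 ≤ c * s) :
    π ≤ c * s * gnum 0.7 s := by
  have h2 := log_two_gt_d9
  have h2' := log_two_lt_d9
  have hπ := pi_lt_d4
  have l7 := log_ge_of_pow (x := 0.7) (by norm_num) 35 68 (by norm_num) (by norm_num)
  rcases le_total s 4.6 with h | h
  · have h1 := gnum_anti (β := 0.7) (by norm_num) hs h
    have l46 := log_le_of_pow (x := 4.6) (by norm_num) 75 34 (by norm_num) (by norm_num)
    have : 0.0352 ≤ gnum 0.7 4.6 := by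
      unfold gnum
      push_cast at *
      linarith
    nlinarith
  · have h1 := gnum_anti (β := 0.7) (by norm_num) hs hs5.le
    have l5 := log_le_of_pow (x := 5) (by norm_num) 72 31 (by norm_num) (by norm_num)
    have : 0.023 ≤ gnum 0.7 5 := by
      unfold gnum
      push_cast at *
      linarith
    have : 138 ≤ c * s := by nlinarith
    nlinarith

theorem gnum_85 {c s : ℝ} (hs : 0 < s) (hs1 : s ≤ 1) (hα : 89.6 ≤ c * s) :
    π ≤ c * s * gnum 0.85 s := by
  have h2 := log_two_gt_d9
  have h2' := log_two_lt_d9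
  have hπ := pi_lt_d4
  have l85 := log_ge_of_pow (x := 0.85) (by norm_num) 4 17 (by norm_num) (by norm_num)
  have h1 := gnum_anti (β := 0.85) (by norm_num) hs hs1
  have : 0.08 ≤ gnum 0.85 1 := by
    unfold gnum
    push_cast at *
    rw [log_one]
    linarith
  nlinarith

section
variable {c χ : ℝ} {ψ ψ' ψ'' : ℝ → ℝ}

theorem hasDerivAt_p (x : ℝ) : HasDerivAt (fun x : ℝ => 1 - x^2) (-(2*x)) x := by
  have := (hasDerivAt_pow 2 x).const_sub 1
  simpa using this

theorem hasDerivAt_q (c χ x : ℝ) : HasDerivAt (fun x : ℝ => χ - c^2 * x^2) (-(2*c^2*x)) x := by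
  have := ((hasDerivAt_pow 2 x).const_mul (c^2)).const_sub χ
  refine this.congr_deriv ?_
  simp; ring

/-- Q-energy derivative -/
theorem RODE.dE (h : RODE c χ ψ ψ' ψ'') {x : ℝ} (hq : χ - c^2*x^2 ≠ 0) :
    HasDerivAt (fun x => ψ x^2 + (1 - x^2) * ψ' x^2 / (χ - c^2*x^2))
      (2*x*ψ' x^2/(χ - c^2*x^2) + (1-x^2) * ψ' x^2 * (2*c^2*x)/(χ - c^2*x^2)^2) x := by
  have h1 := ((h.d1 x).pow 2).add (((hasDerivAt_p x).mul ((h.d2 x).pow 2)).div (hasDerivAt_q c χ x) hq)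
  refine h1.congr_deriv ?_
  have ho := h.ode x
  simp only [Pi.mul_apply, Pi.pow_apply]
  have e : (1 - x^2) * ψ'' x = 2*x*ψ' x - (χ - c^2*x^2) * ψ x := by linarith
  have e2 : (1 - x ^ 2) * (((2:ℕ):ℝ) * ψ' x ^ (2 - 1) * ψ'' x) = 2 * ψ' x * (2*x*ψ' x - (χ - c^2*x^2) * ψ x) := by
    rw [← e]; norm_num; ring
  rw [e2]
  generalize χ - c^2*x^2 = q at hq ⊢
  norm_num
  field_simp
  ring

theorem RODE.E_mono (h : RODE c χ ψ ψ' ψ'') (hχ : c^2 < χ) {x y : ℝ} (hx : 0 ≤ x) (hxy : x ≤ y) (hy : y ≤ 1) :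
    ψ x^2 + (1 - x^2) * ψ' x^2 / (χ - c^2*x^2) ≤ ψ y^2 + (1 - y^2) * ψ' y^2 / (χ - c^2*y^2) := by
  have hq : ∀ z ∈ Icc x y, 0 < χ - c^2*z^2 := by
    intro z hz
    have : z^2 ≤ 1 := by nlinarith [hz.1, hz.2]
    nlinarith [sq_nonneg c]
  refine le_of_hasDerivAt_nonneg hxy (fun z hz => (h.dE (hq z hz).ne').continuousAt.continuousWithinAt)
    (fun z hz => h.dE (hq z (Ioo_subset_Icc_self hz)).ne') ?_
  intro z hz
  have h1 := hq z (Ioo_subset_Icc_self hz)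
  have h2 : 0 ≤ z := by linarith [hz.1]
  have h3 : 0 ≤ 1 - z^2 := by nlinarith [hz.2]
  positivity

theorem RODE.le_one (h : RODE c χ ψ ψ' ψ'') (hχ : c^2 < χ) {x : ℝ} (hx : x ∈ Icc (0:ℝ) 1) :
    ψ x^2 + (1 - x^2) * ψ' x^2 / (χ - c^2*x^2) ≤ ψ 1^2 := by
  have := h.E_mono hχ hx.1 hx.2 le_rfl
  simpa using this

theorem RODE.abs_le_one (h : RODE c χ ψ ψ' ψ'') (hχ : c^2 < χ) {x : ℝ} (hx : x ∈ Icc (0:ℝ) 1) :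
    |ψ x| ≤ |ψ 1| := by
  have h1 := h.le_one hχ hx
  have hq : 0 < χ - c^2*x^2 := by
    have : x^2 ≤ 1 := by nlinarith [hx.1, hx.2]
    nlinarith [sq_nonneg c]
  have h3 : 0 ≤ 1 - x^2 := by nlinarith [hx.1, hx.2]
  have : 0 ≤ (1 - x^2) * ψ' x^2 / (χ - c^2*x^2) := by positivity
  exact sq_le_sq.1 (by linarith)

/-- derivative bound from `w' = -qψ` -/
theorem RODE.deriv_bound (h : RODE c χ ψ ψ' ψ'') {L a : ℝ} (ha : 0 ≤ a)
    (hq : ∀ x ∈ Icc a 1, |(χ - c^2*x^2) * ψ x| ≤ L) {x : ℝ} (hx : x ∈ Icc a 1) :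
    (1 + x) * |ψ' x| ≤ L := by
  have h1 : ∀ y ∈ Icc a 1, (1 + y) * |ψ' y| ≤ L ∨ y = 1 := by
    intro y hy
    rcases eq_or_lt_of_le hy.2 with h1 | h1
    · right; exact h1
    left
    have := Convex.norm_image_sub_le_of_norm_hasDerivWithin_le (f := fun x => (1 - x^2) * ψ' x)
      (f' := fun x => -(χ - c^2 * x^2) * ψ x) (C := L) (s := Icc a 1)
      (fun z _ => (h.dw z).hasDerivWithinAt) (fun z hz => by
        rw [neg_mul, norm_neg]; exact hq z hz) (convex_Icc a 1) (right_mem_Icc.2 (by linarith [hy.1])) hy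
    simp only [one_pow, sub_self, zero_mul, sub_zero, norm_eq_abs] at this
    have hy0 : 0 ≤ y := by linarith [hy.1]
    rw [abs_mul, abs_of_pos (show 0 < 1 - y^2 by nlinarith), abs_sub_comm, abs_of_pos (show 0 < 1 - y by linarith)] at this
    have e : 1 - y^2 = (1-y) * (1+y) := by ring
    rw [e] at this
    have hpos : 0 < 1 - y := by linarith
    exact le_of_mul_le_mul_left (by linarith) hpos
  rcases h1 x hx with h2 | h2
  · exact h2
  · -- x = 1, by continuity
    rcases eq_or_lt_of_le (show a ≤ 1 by linarith [hx.1, hx.2]) with ha1 | ha1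
    · -- a = 1 : use the ode at 1
      subst h2
      have ho := h.ode 1
      have hq1 := hq 1 (right_mem_Icc.2 ha1.le)
      have : (1 + 1) * ψ' 1 = (χ - c^2*1^2) * ψ 1 := by linarith
      rw [← this, abs_mul] at hq1
      norm_num at hq1 ⊢
      linarith
    · subst h2
      have ho := h.ode 1
      have hq1 := hq 1 (right_mem_Icc.2 ha1.le)
      have : (1 + 1) * ψ' 1 = (χ - c^2*1^2) * ψ 1 := by linarith
      rw [← this, abs_mul] at hq1
      norm_num at hq1 ⊢
      linarith

theorem RODE.dR (h : RODE c χ ψ ψ' ψ'') (x : ℝ) :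
    HasDerivAt (fun x => (1 - x^2) * (χ - c^2*x^2) * ψ x^2 + ((1 - x^2) * ψ' x)^2)
      (((-(2*x)) * (χ - c^2*x^2) + (1 - x^2) * (-(2*c^2*x))) * ψ x^2) x := by
  have h1 := (((hasDerivAt_p x).mul (hasDerivAt_q c χ x)).mul ((h.d1 x).pow 2)).add ((h.dw x).pow 2)
  refine h1.congr_deriv ?_
  simp only [Pi.mul_apply, Pi.pow_apply]
  norm_num
  ring

theorem RODE.R0_ge (h : RODE c χ ψ ψ' ψ'') (hc : 0 < c) {s : ℝ} (hχ : χ = c^2*(1+s)) (hcs : 1 ≤ c * s) (hs : 0 < s)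
    (hc1 : 1 ≤ c) : ψ 1^2/64 ≤ χ * ψ 0^2 + ψ' 0^2 := by
  have hχ1 : c^2 < χ := by rw [hχ]; nlinarith [mul_pos (pow_pos hc 2) hs]
  -- reduce to ψ 1 ≥ 0
  wlog hp : 0 ≤ ψ 1 generalizing ψ ψ' ψ''
  · have := this h.neg (by show 0 ≤ -ψ 1; linarith)
    simpa using this
  set δ := 1/(4*(c^2*s)) with hδ
  have hcs2 : 1 ≤ c^2*s := by nlinarith
  have hδ0 : 0 < δ := by positivity
  have hδ1 : δ * (c^2*s) = 1/4 := by rw [hδ]; field_simp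
  have hδ4 : δ ≤ 1/4 := by nlinarith
  have hδs : 4 * δ ≤ s := by
    have h1 : 1 ≤ (c*s)^2 := by nlinarith
    have h2 : 4 * (δ * (c^2*s)) * s ≥ 4 * δ := by
      have : 4 * (δ * (c^2*s)) * s = 4 * δ * (c*s)^2 := by ring
      rw [this]; nlinarith
    rw [hδ1] at h2; linarith
  have hq : ∀ x ∈ Icc (1-δ) 1, c^2*s ≤ χ - c^2*x^2 ∧ χ - c^2*x^2 ≤ 3/2*(c^2*s) := by
    intro x hx
    have hx0 : 0 ≤ x := by linarith [hx.1]
    have e : χ - c^2*x^2 = c^2*s + c^2*(1-x^2) := by rw [hχ]; ring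
    rw [e]
    constructor
    · have : 0 ≤ c^2 * (1 - x^2) := mul_nonneg (by positivity) (by nlinarith [hx.2])
      linarith
    · have : 1 - x^2 ≤ s/2 := by nlinarith [hx.1, hx.2]
      have := mul_le_mul_of_nonneg_left this (sq_nonneg c)
      linarith
  have hd : ∀ x ∈ Icc (1-δ) 1, |ψ' x| ≤ c^2*s*ψ 1 := by
    intro x hx
    have h1 := h.deriv_bound (a := 1-δ) (L := 3/2*(c^2*s)*ψ 1) (by linarith) (fun y hy => by
      rw [abs_mul, abs_of_nonneg (by linarith [(hq y hy).1])]
      have := h.abs_le_one hχ1 (x := y) ⟨by linarith [hy.1], hy.2⟩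
      rw [abs_of_nonneg hp] at this
      exact mul_le_mul (hq y hy).2 this (abs_nonneg _) (by positivity)) hx
    have h2 : 3/2 ≤ 1 + x := by linarith [hx.1]
    nlinarith [abs_nonneg (ψ' x)]
  have hlow : ∀ x ∈ Icc (1-δ) 1, ψ 1/2 ≤ ψ x := by
    intro x hx
    have := Convex.norm_image_sub_le_of_norm_hasDerivWithin_le (f := ψ)
      (f' := ψ') (C := c^2*s*ψ 1) (s := Icc (1-δ) 1)
      (fun z _ => (h.d1 z).hasDerivWithinAt) (fun z hz => by rw [norm_eq_abs]; exact hd z hz) (convex_Icc _ 1) (right_mem_Icc.2 (by linarith)) hx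
    rw [norm_eq_abs, norm_eq_abs, abs_sub_comm x 1, abs_of_nonneg (show 0 ≤ 1 - x by linarith [hx.2])] at this
    have h2 : c^2*s*ψ 1 * (1-x) ≤ ψ 1/4 := by
      calc c^2*s*ψ 1 * (1-x) ≤ c^2*s*ψ 1 * δ := by gcongr; linarith [hx.1]
        _ = (δ * (c^2*s)) * ψ 1 := by ring
        _ = ψ 1/4 := by rw [hδ1]; ring
    have := (abs_le.1 this).1
    linarith
  have hw : ψ 1/8 ≤ (1 - (1-δ)^2) * ψ' (1-δ) := by
    have := le_of_hasDerivAt_nonneg (f := fun x => -((1 - x^2) * ψ' x) + (c^2*s*(ψ 1/2)) * (1 - x))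
      (f' := fun x => -(-(χ - c^2 * x^2) * ψ x) + (c^2*s*(ψ 1/2)) * (-1)) (a := 1 - δ) (b := 1) (by linarith)
      (by have := h.cont'; fun_prop)
      (fun x _ => (h.dw x).neg.add (((hasDerivAt_id x).const_sub 1).const_mul _)) (by
        intro x hx
        have hx' := Ioo_subset_Icc_self hx
        have h1 := (hq x hx').1
        have h2 := hlow x hx'
        have : c^2*s*(ψ 1/2) ≤ (χ - c^2*x^2) * ψ x := mul_le_mul h1 h2 (by linarith) (by
          have : 0 < c^2*s := by positivity
          linarith)
        linarith)
    simp only [one_pow, sub_self, zero_mul, neg_zero, mul_zero, add_zero] at this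
    have e : c^2*s*(ψ 1/2) * (1 - (1-δ)) = (δ * (c^2*s)) * ψ 1/2 := by ring
    rw [e, hδ1] at this
    linarith
  have hR := le_of_hasDerivAt_nonneg (f := fun x => -((1 - x^2) * (χ - c^2*x^2) * ψ x^2 + ((1 - x^2) * ψ' x)^2))
    (f' := fun x => -(((-(2*x)) * (χ - c^2*x^2) + (1 - x^2) * (-(2*c^2*x))) * ψ x^2)) (a := 0) (b := 1 - δ) (by linarith)
    (by have := h.cont'; have := h.cont; fun_prop) (fun x _ => (h.dR x).neg) (by
      intro x hx
      have hx0 := hx.1.le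
      have hx1 : x^2 ≤ 1 := by nlinarith [hx.2]
      have hq : 0 ≤ χ - c^2*x^2 := by nlinarith [sq_nonneg c]
      have h1 : 0 ≤ 1 - x^2 := by linarith
      have : 0 ≤ (2*x*(χ - c^2*x^2) + (1-x^2)*(2*c^2*x)) * ψ x^2 := by positivity
      linarith)
  have hpq : 0 ≤ (1 - (1-δ)^2) * (χ - c^2*(1-δ)^2) * ψ (1-δ)^2 := by
    have h1 := (hq (1-δ) (left_mem_Icc.2 (by linarith))).1
    have h2 : 0 ≤ 1 - (1-δ)^2 := by nlinarith
    have h3 : 0 < c^2*s := by positivity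
    have : 0 ≤ χ - c^2*(1-δ)^2 := by linarith
    positivity
  nlinarith

/-- generic sup bound -/
theorem sup_sq_le {K M : ℝ} (hK : 1 ≤ K) (hd : ∀ x, HasDerivAt ψ (ψ' x) x) (hcont : Continuous ψ)
    (hn : ∫ t in (-1:ℝ)..1, (ψ t)^2 = 1)
    (hder : ∀ x ∈ Icc (-1:ℝ) 1, |ψ' x| ≤ K * M) {x0 : ℝ} (hx0 : x0 ∈ Icc (-1:ℝ) 1) (hM : M = |ψ x0|) :
    M^2 ≤ 8*K := by
  have hM0 : 0 ≤ M := by rw [hM]; positivity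
  have hKp : 0 < K := by linarith
  set δ := 1/(2*K) with hδ
  have hδK : δ * K = 1/2 := by rw [hδ]; field_simp
  have hδ0 : 0 < δ := by positivity
  have hδ1 : δ ≤ 1 := by nlinarith
  have hlow : ∀ x ∈ Icc (-1:ℝ) 1, |x - x0| ≤ δ → M^2/4 ≤ ψ x^2 := by
    intro x hx hxd
    have := Convex.norm_image_sub_le_of_norm_hasDerivWithin_le (f := ψ)
      (f' := ψ') (C := K*M) (s := Icc (-1:ℝ) 1)
      (fun z _ => (hd z).hasDerivWithinAt) (fun z hz => by rw [norm_eq_abs]; exact hder z hz) (convex_Icc _ 1) hx0 hx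
    rw [norm_eq_abs, norm_eq_abs] at this
    have h2 : K*M*|x - x0| ≤ M/2 := by
      calc K*M*|x-x0| ≤ K*M*δ := by gcongr
        _ = (δ*K)*M := by ring
        _ = M/2 := by rw [hδK]; ring
    have h3 : M/2 ≤ |ψ x| := by
      have := abs_sub_abs_le_abs_sub (ψ x0) (ψ x)
      rw [abs_sub_comm] at this
      linarith
    rw [← sq_abs (ψ x)]
    nlinarith
  obtain ⟨a, ha, hab, hsub⟩ : ∃ a, -1 ≤ a ∧ a + δ ≤ 1 ∧ ∀ x ∈ Icc a (a+δ), |x - x0| ≤ δ := by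
    rcases le_total x0 0 with h0 | h0
    · refine ⟨x0, hx0.1, by linarith, fun x hx => ?_⟩
      rw [abs_le]; constructor <;> linarith [hx.1, hx.2]
    · refine ⟨x0 - δ, by linarith, by linarith [hx0.2], fun x hx => ?_⟩
      rw [abs_le]; constructor <;> linarith [hx.1, hx.2]
  have hIntv : ∀ a b, IntervalIntegrable (fun t => ψ t^2) volume a b := fun a b =>
    (hcont.pow 2).intervalIntegrable a b
  have i1 : ∫ t in a..(a+δ), (M^2/4 : ℝ) ≤ ∫ t in a..(a+δ), ψ t^2 := by
    apply intervalIntegral.integral_mono_on (by linarith) (by simp) (hIntv _ _)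
    intro x hx
    exact hlow x ⟨by linarith [hx.1], by linarith [hx.2]⟩ (hsub x hx)
  have i2 : ∫ t in a..(a+δ), ψ t^2 ≤ ∫ t in (-1:ℝ)..1, ψ t^2 := by
    apply intervalIntegral.integral_mono_interval ha (by linarith) hab
    · exact Filter.Eventually.of_forall fun x => sq_nonneg _
    · exact hIntv _ _
  rw [intervalIntegral.integral_const, hn.symm.symm] at *
  simp only [add_sub_cancel_left, smul_eq_mul] at i1
  have : δ * (M^2/4) ≤ 1 := by linarith
  have h5 : K * (δ * (M^2/4)) ≤ K * 1 := by gcongr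
  have h6 : K * (δ * (M^2/4)) = (δ*K)*(M^2/4) := by ring
  rw [h6, hδK] at h5
  linarith

end

section
variable {c χ : ℝ} {k : ℕ} {ψ : ℝ → ℝ} {lam : ℂ}

theorem parity_aux (h : RODE c χ ψ (deriv ψ) (deriv (deriv ψ))) {f : ℂ → ℂ} (hf : CODE c χ ψ f) :
    ∃ σ : ℝ, (σ = 1 ∨ σ = -1) ∧ ∀ z, f (-z) = σ * f z := by
  rcases mul_eq_zero.1 h.psi_zero_mul with h0 | h0
  · refine ⟨-1, Or.inr rfl, ?_⟩
    have hr := (h.sub h.refl.neg)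
    have hz := hr.unique (t := 0) (by norm_num) (by simp [h0]) (by simp)
    have hd : Differentiable ℂ (fun z => f z + f (-z)) :=
      hf.diff.add (hf.diff.comp differentiable_neg)
    have := entire_zero_of_real_interval hd (a := -1) (b := 1) (by norm_num) (fun x hx => by
      have := hz x hx
      simp only [sub_neg_eq_add] at this
      have e : ((-x : ℝ) : ℂ) = -(x:ℂ) := by push_cast; rfl
      rw [← e, hf.real, hf.real]
      exact_mod_cast this)
    intro z
    have := congrFun this z
    simp only [Pi.zero_apply] at this
    push_cast
    linear_combination this
  · refine ⟨1, Or.inl rfl, ?_⟩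
    have hr := (h.sub h.refl)
    have hz := hr.unique (t := 0) (by norm_num) (by simp) (by simp [h0])
    have hd : Differentiable ℂ (fun z => f z - f (-z)) :=
      hf.diff.sub (hf.diff.comp differentiable_neg)
    have := entire_zero_of_real_interval hd (a := -1) (b := 1) (by norm_num) (fun x hx => by
      have := hz x hx
      have e : ((-x : ℝ) : ℂ) = -(x:ℂ) := by push_cast; rfl
      rw [← e, hf.real, hf.real]
      exact_mod_cast this)
    intro z
    have := congrFun this z
    simp only [Pi.zero_apply] at this
    push_cast
    linear_combination -this

theorem ProlateDatum.parity (h : ProlateDatum c k ψ lam χ) :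
    ∃ σ : ℝ, (σ = 1 ∨ σ = -1) ∧ (∀ z, ent c ψ lam (-z) = σ * ent c ψ lam z) ∧
      (∀ x, ψ (-x) = σ * ψ x) ∧ (∀ x, deriv ψ (-x) = -(σ * deriv ψ x)) := by
  obtain ⟨σ, hσ, hz⟩ := parity_aux h.rode h.code
  have h1 : ∀ x, ψ (-x) = σ * ψ x := by
    intro x
    have := hz x
    have e : ((-x : ℝ) : ℂ) = -(x:ℂ) := by push_cast; rfl
    rw [← e, h.code.real, h.code.real] at this
    exact_mod_cast this
  refine ⟨σ, hσ, hz, h1, fun x => ?_⟩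
  have a := h.rode.refl.d1 x
  have b := (h.rode.d1 x).const_mul σ
  have e : (fun x => ψ (-x)) = fun x => σ * ψ x := funext h1
  rw [e] at a
  have := a.unique b
  linarith

theorem ProlateDatum.abs_parity (h : ProlateDatum c k ψ lam χ) (x : ℝ) : |ψ (-x)| = |ψ x| := by
  obtain ⟨σ, hσ, -, h1, -⟩ := h.parity
  rw [h1]; rcases hσ with rfl | rfl <;> simp

theorem ProlateDatum.abs_parity' (h : ProlateDatum c k ψ lam χ) (x : ℝ) : |deriv ψ (-x)| = |deriv ψ x| := by
  obtain ⟨σ, hσ, -, -, h1⟩ := h.parity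
  rw [h1]; rcases hσ with rfl | rfl <;> simp

theorem ProlateDatum.abs_le (h : ProlateDatum c k ψ lam χ) (hχ : c^2 < χ) {x : ℝ} (hx : x ∈ Icc (-1:ℝ) 1) :
    |ψ x| ≤ |ψ 1| := by
  rcases le_total 0 x with h0 | h0
  · exact h.rode.abs_le_one hχ ⟨h0, hx.2⟩
  · rw [← h.abs_parity]
    exact h.rode.abs_le_one hχ ⟨by linarith, by linarith [hx.1]⟩

theorem ProlateDatum.psi_one_sq (h : ProlateDatum c k ψ lam χ) (hχ : c^2 < χ) : 1/2 ≤ ψ 1^2 := by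
  have h1 : ∫ t in (-1:ℝ)..1, (ψ t)^2 ≤ ∫ t in (-1:ℝ)..1, (ψ 1)^2 := by
    apply intervalIntegral.integral_mono_on (by norm_num) ((h.cont.pow 2).intervalIntegrable _ _) (by simp)
    intro x hx
    exact sq_le_sq.2 (h.abs_le hχ hx)
  rw [h.normalized] at h1
  simp at h1
  linarith

theorem ProlateDatum.deriv_le (h : ProlateDatum c k ψ lam χ) (hχ : c^2 < χ) {x : ℝ} (hx : x ∈ Icc (-1:ℝ) 1) :
    |deriv ψ x| ≤ χ * |ψ 1| := by
  have key : ∀ x ∈ Icc (0:ℝ) 1, |deriv ψ x| ≤ χ * |ψ 1| := by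
    intro x hx
    have := h.rode.deriv_bound (a := 0) (L := χ * |ψ 1|) le_rfl (fun y hy => by
      rw [abs_mul]
      have h1 : y^2 ≤ 1 := by nlinarith [hy.1, hy.2]
      rw [abs_of_nonneg (show 0 ≤ χ - c^2*y^2 by nlinarith [sq_nonneg c])]
      apply mul_le_mul _ (h.rode.abs_le_one hχ hy) (abs_nonneg _) (by nlinarith [sq_nonneg c])
      nlinarith [mul_nonneg (sq_nonneg c) (sq_nonneg y)]) hx
    nlinarith [abs_nonneg (deriv ψ x), hx.1]
  rcases le_total 0 x with h0 | h0
  · exact key x ⟨h0, hx.2⟩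
  · rw [← h.abs_parity']
    exact key _ ⟨by linarith, by linarith [hx.1]⟩

theorem ProlateDatum.deriv_zero_sq (h : ProlateDatum c k ψ lam χ) (hχ : c^2 < χ) :
    χ * ψ 0^2 + deriv ψ 0^2 ≤ χ * ψ 1^2 := by
  have := h.rode.le_one hχ (x := 0) (by simp)
  have hχ0 : 0 < χ := by nlinarith [sq_nonneg c]
  simp at this
  have h2 := mul_le_mul_of_nonneg_left this hχ0.le
  rw [mul_add, mul_div_cancel₀ _ hχ0.ne'] at h2
  exact h2

end

section
variable {c χ s : ℝ} {ψ ψ' ψ'' : ℝ → ℝ}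

theorem RODE.dF (h : RODE c χ ψ ψ' ψ'') (x : ℝ) :
    HasDerivAt (fun x => (x^2 - 1) * (ψ x * ψ' x)) ((χ - c^2*x^2) * ψ x^2 + (x^2-1) * ψ' x^2) x := by
  have h1 := ((h.dw x).neg.mul (h.d1 x))
  have e : (fun x => (x^2 - 1) * (ψ x * ψ' x)) = ((-fun x => (1 - x^2) * ψ' x) * ψ) := by
    funext y; simp only [Pi.mul_apply, Pi.neg_apply]; ring
  rw [e]
  refine h1.congr_deriv ?_
  simp only [Pi.neg_apply]; ring

theorem RODE.F_nonneg (h : RODE c χ ψ ψ' ψ'') (hχ : χ = c^2*(1+s)) {x : ℝ} (hx : 1 ≤ x) (hxt : x^2 ≤ 1 + s) :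
    0 ≤ (x^2 - 1) * (ψ x * ψ' x) := by
  have := le_of_hasDerivAt_nonneg (f := fun x => (x^2 - 1) * (ψ x * ψ' x)) hx
    (fun y _ => (h.dF y).continuousAt.continuousWithinAt) (fun y _ => h.dF y) (fun y hy => by
      have h1 : y^2 ≤ 1 + s := by nlinarith [hy.1, hy.2]
      have h2 : 1 ≤ y^2 := by nlinarith [hy.1]
      have h3 : 0 ≤ χ - c^2*y^2 := by rw [hχ]; nlinarith [sq_nonneg c]
      have h4 : 0 ≤ y^2 - 1 := by linarith
      positivity)
  simpa using this

theorem RODE.psi_ge (h : RODE c χ ψ ψ' ψ'') (hχ : χ = c^2*(1+s)) (h1 : 0 < ψ 1) {x : ℝ} (hx : 1 ≤ x) (hxt : x^2 ≤ 1 + s) :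
    ψ 1 ≤ ψ x := by
  have key : ∀ y ∈ Icc 1 x, ψ 1^2 ≤ ψ y^2 := by
    intro y hy
    refine le_of_hasDerivAt_nonneg (f := fun x => ψ x^2) (f' := fun x => 2 * (ψ x * ψ' x)) hy.1 (h.cont.pow 2).continuousOn
      (fun z _ => ((h.d1 z).pow 2).congr_deriv (by norm_num; ring)) ?_
    intro z hz
    have := h.F_nonneg hχ (x := z) hz.1.le (by nlinarith [hz.1, hz.2, hy.2])
    have hz2 : 0 < z^2 - 1 := by nlinarith [hz.1]
    have := nonneg_of_mul_nonneg_right this hz2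
    linarith
  have hpos : 0 < ψ x := by
    by_contra hn
    push Not at hn
    obtain ⟨y, hy, hy0⟩ := intermediate_value_Icc' hx h.cont.continuousOn (show (0:ℝ) ∈ Icc (ψ x) (ψ 1) from ⟨hn, h1.le⟩)
    have := key y hy
    rw [hy0] at this
    nlinarith
  have := key x ⟨hx, le_rfl⟩
  exact le_of_sq_le_sq this hpos.le

theorem RODE.psi'_nonneg (h : RODE c χ ψ ψ' ψ'') (hχ : χ = c^2*(1+s)) (h1 : 0 < ψ 1) {x : ℝ} (hx : 1 < x) (hxt : x^2 ≤ 1 + s) :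
    0 ≤ ψ' x := by
  have h2 := h.F_nonneg hχ hx.le hxt
  have h3 := h.psi_ge hχ h1 hx.le hxt
  have hz2 : 0 < x^2 - 1 := by nlinarith
  have := nonneg_of_mul_nonneg_right h2 hz2
  exact nonneg_of_mul_nonneg_right this (by linarith)

theorem RODE.psi_mono (h : RODE c χ ψ ψ' ψ'') (hχ : χ = c^2*(1+s)) (h1 : 0 < ψ 1) {x y : ℝ} (hx : 1 ≤ x) (hxy : x ≤ y) (hyt : y^2 ≤ 1 + s) :
    ψ x ≤ ψ y := le_of_hasDerivAt_nonneg hxy h.cont.continuousOn (fun z _ => h.d1 z) (fun z hz =>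
      h.psi'_nonneg hχ h1 (by linarith [hz.1]) (by nlinarith [hz.1, hz.2]))

theorem RODE.w_mono (h : RODE c χ ψ ψ' ψ'') (hχ : χ = c^2*(1+s)) (h1 : 0 < ψ 1) {x y : ℝ} (hx : 1 ≤ x) (hxy : x ≤ y) (hyt : y^2 ≤ 1 + s) :
    (x^2-1) * ψ' x ≤ (y^2-1) * ψ' y := by
  have := le_of_hasDerivAt_nonneg (f := fun x => - ((1 - x^2) * ψ' x)) hxy (by have := h.cont'; fun_prop) (fun z _ => (h.dw z).neg) (fun z hz => by
      have := h.psi_ge hχ h1 (x := z) (by linarith [hz.1]) (by nlinarith [hz.1, hz.2])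
      have h4 : z^2 ≤ 1 + s := by nlinarith [hz.1, hz.2]
      have h3 : 0 ≤ χ - c^2*z^2 := by rw [hχ]; nlinarith [sq_nonneg c]
      have : 0 ≤ (χ - c^2*z^2) * ψ z := mul_nonneg h3 (by linarith)
      linarith)
  linarith

/-- growth in the angle variable -/
theorem RODE.growth_phi (h : RODE c χ ψ ψ' ψ'') (hc : 0 < c) (hs : 0 < s) (hχ : χ = c^2*(1+s)) (h1 : 0 < ψ 1)
    {φ : ℝ} (hφ : 0 < φ) (hφ2 : φ < π/2) :
    (√(1 + s * sin φ^2)^2 - 1) * (ψ (√(1 + s * sin φ^2)) * ψ' (√(1 + s * sin φ^2))) *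
      exp (π/2 * c * s / √(1 + s/4) - 3 * c * s * φ / √(1 + s/4)) ≤ s * (ψ (√(1+s)) * ψ' (√(1+s))) := by
  set γ := √(1 + s/4) with hγ
  have hγ2 : γ^2 = 1 + s/4 := sq_sqrt (by positivity)
  have hγ0 : 0 < γ := sqrt_pos.2 (by positivity)
  set X : ℝ → ℝ := fun φ => √(1 + s * sin φ^2) with hX
  have hX2 : ∀ φ, X φ^2 = 1 + s * sin φ^2 := fun φ => sq_sqrt (by positivity)
  have hX0 : ∀ φ, 0 < X φ := fun φ => sqrt_pos.2 (by positivity)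
  have hX1 : ∀ φ, 1 ≤ X φ := fun φ => by
    rw [hX]; simp only; rw [Real.one_le_sqrt]; nlinarith [mul_nonneg hs.le (sq_nonneg (sin φ))]
  have hXt : ∀ φ, X φ^2 ≤ 1 + s := fun φ => by
    rw [hX2]; nlinarith [sin_sq_le_one φ]
  have hdX : ∀ φ, HasDerivAt X (s * sin φ * cos φ / X φ) φ := by
    intro φ
    have h1 : HasDerivAt (fun φ => 1 + s * sin φ^2) (s * (2 * sin φ * cos φ)) φ := by
      refine ((((hasDerivAt_sin φ).pow 2).const_mul s).const_add 1).congr_deriv ?_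
      norm_num
    refine (h1.sqrt (by positivity)).congr_deriv ?_
    have := hX0 φ
    simp only [hX] at this ⊢
    field_simp
  set θ : ℝ → ℝ := fun φ => (2*c*s/γ) * (φ/2 + sin (2*φ)/4 + s/(2*γ^2) * (sin (4*φ)/32 + sin (2*φ)/16)) with hθ
  set θ' : ℝ → ℝ := fun φ => (2*c*s/γ) * (cos φ^2 * (1 - s/(2*γ^2) * (sin φ^2 - 1/4))) with hθ'
  have hdθ : ∀ φ, HasDerivAt θ (θ' φ) φ := by
    intro φ
    have a2 : HasDerivAt (fun φ : ℝ => sin (2*φ)) (cos (2*φ) * 2) φ := by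
      simpa using ((hasDerivAt_id φ).const_mul 2).sin
    have a4 : HasDerivAt (fun φ : ℝ => sin (4*φ)) (cos (4*φ) * 4) φ := by
      simpa using ((hasDerivAt_id φ).const_mul 4).sin
    have := ((((hasDerivAt_id φ).div_const 2).add (a2.div_const 4)).add
      (((a4.div_const 32).add (a2.div_const 16)).const_mul (s/(2*γ^2)))).const_mul (2*c*s/γ)
    refine this.congr_deriv ?_
    have c2 : cos (2*φ) = 2 * cos φ^2 - 1 := cos_two_mul φ
    have c4 : cos (4*φ) = 2 * (2 * cos φ^2 - 1)^2 - 1 := by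
      rw [← c2, ← cos_two_mul]; ring_nf
    have s2 : sin φ^2 = 1 - cos φ^2 := by linarith [sin_sq_add_cos_sq φ]
    simp only [hθ', c2, c4, s2]
    ring
  have hg := growth_of_hasDerivAt (f := fun φ => (X φ^2 - 1) * (ψ (X φ) * ψ' (X φ)))
    (f' := fun φ => ((χ - c^2*X φ^2) * ψ (X φ)^2 + (X φ^2-1) * ψ' (X φ)^2) * (s * sin φ * cos φ / X φ))
    (θ := θ) (θ' := θ') hφ2.le
    (fun y _ => ((h.dF (X y)).comp y (hdX y)).continuousAt.continuousWithinAt)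
    (fun y _ => (hdθ y).continuousAt.continuousWithinAt)
    (fun y _ => (h.dF (X y)).comp y (hdX y)) (fun y _ => hdθ y)
    (fun y hy => by
      have hsy : 0 < sin y := sin_pos_of_pos_of_lt_pi (by linarith [hy.1]) (by linarith [hy.2, pi_pos])
      have hcy : 0 < cos y := cos_pos_of_mem_Ioo ⟨by linarith [hy.1, pi_pos], hy.2⟩
      have hsc := sin_sq_add_cos_sq y
      have hX1' : 1 < X y := by
        rw [hX]; simp only; rw [Real.lt_sqrt (by norm_num)]; nlinarith [mul_pos hs (pow_pos hsy 2)]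
      have p1 := h.psi_ge hχ h1 (hX1 y) (hXt y)
      have p2 := h.psi'_nonneg hχ h1 hX1' (hXt y)
      have hq : χ - c^2*X y^2 = c^2*s*cos y^2 := by rw [hχ, hX2]; linear_combination (c^2*s) * (-hsc)
      have hP : X y^2 - 1 = s * sin y^2 := by rw [hX2]; ring
      rw [hq, hP]
      have hv := hX0 y
      have tang : 1/γ * (1 - s/(2*γ^2) * (sin y^2 - 1/4)) ≤ 1 / X y := by
        have e : s * (sin y^2 - 1/4) = X y^2 - γ^2 := by rw [hX2, hγ2]; ring
        have e2 : 1/γ * (1 - s/(2*γ^2) * (sin y^2 - 1/4)) = (3*γ^2 - X y^2)/(2*γ^3) := by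
          have : s/(2*γ^2) * (sin y^2 - 1/4) = (X y^2 - γ^2)/(2*γ^2) := by rw [← e]; ring
          rw [this]; field_simp; ring
        rw [e2, div_le_div_iff₀ (by positivity) hv]
        nlinarith [mul_nonneg (sq_nonneg (X y - γ)) (show 0 ≤ X y + 2*γ by positivity)]
      have amgm : 2 * c * s * (sin y * cos y) * (ψ (X y) * ψ' (X y)) ≤ c^2*s*cos y^2 * ψ (X y)^2 + s * sin y^2 * ψ' (X y)^2 := by
        nlinarith [mul_nonneg hs.le (sq_nonneg (c * cos y * ψ (X y) - sin y * ψ' (X y)))]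
      have hk : 0 ≤ s * sin y * cos y / X y := by positivity
      calc θ' y * (s * sin y^2 * (ψ (X y) * ψ' (X y)))
          = (2*c*s*cos y^2 * (s * sin y^2 * (ψ (X y) * ψ' (X y)))) * (1/γ * (1 - s/(2*γ^2) * (sin y^2 - 1/4))) := by
            simp only [hθ']; ring
        _ ≤ (2*c*s*cos y^2 * (s * sin y^2 * (ψ (X y) * ψ' (X y)))) * (1 / X y) := by
            apply mul_le_mul_of_nonneg_left tang
            have : 0 ≤ ψ (X y) := by linarith
            positivity
        _ = 2 * c * s * (sin y * cos y) * (ψ (X y) * ψ' (X y)) * (s * sin y * cos y / X y) := by ring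
        _ ≤ _ := mul_le_mul_of_nonneg_right amgm hk)
  have hend : X (π/2) = √(1+s) := by simp [hX]
  have hxt2 : √(1+s)^2 = 1 + s := sq_sqrt (by positivity)
  simp only [hend, hxt2] at hg
  have hF0 := h.F_nonneg hχ (hX1 φ) (hXt φ)
  have hθe : θ (π/2) = π/2*c*s/γ := by
    simp only [hθ]
    have e1 : 2*(π/2) = π := by ring
    have e2 : 4*(π/2) = 2*π := by ring
    rw [e1, e2, sin_pi, sin_two_pi]; ring
  have hθ0 : θ φ ≤ 3*c*s*φ/γ := by
    simp only [hθ]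
    have a2 : sin (2*φ) ≤ 2*φ := sin_le (by linarith)
    have a4 : sin (4*φ) ≤ 4*φ := sin_le (by linarith)
    have hk : s/(2*γ^2) ≤ 2 := by rw [div_le_iff₀ (by positivity), hγ2]; linarith
    have hk0 : 0 ≤ s/(2*γ^2) := by positivity
    have : φ/2 + sin (2*φ)/4 + s/(2*γ^2) * (sin (4*φ)/32 + sin (2*φ)/16) ≤ 3/2*φ := by
      have : s/(2*γ^2) * (sin (4*φ)/32 + sin (2*φ)/16) ≤ s/(2*γ^2) * (φ/4) := by
        apply mul_le_mul_of_nonneg_left _ hk0; linarith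
      nlinarith
    calc _ ≤ (2*c*s/γ) * (3/2*φ) := mul_le_mul_of_nonneg_left this (by positivity)
      _ = _ := by ring
  calc _ ≤ (X φ^2 - 1) * (ψ (X φ) * ψ' (X φ)) * exp (θ (π/2) - θ φ) := by
        apply mul_le_mul_of_nonneg_left _ hF0
        apply exp_le_exp.2; rw [hθe]; linarith
    _ ≤ _ := hg
    _ = _ := by ring

set_option maxHeartbeats 1600000 in
theorem RODE.wt_ge (h : RODE c χ ψ ψ' ψ'') (hc : 30 ≤ c) (hs : 0 < s) (hcs : 60 ≤ c * s) (hχ : χ = c^2*(1+s)) (h1 : 0 < ψ 1)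
    (hbig : 2 ≤ (1/16) * (s/(1+s)) * exp (π/2*c*s/√(1+s/4))) :
    ψ 1^2 * (s/(1+s)) * exp (π/2*c*s/√(1+s/4)) ≤ 32 * log (2*c*(1+s)) * (s * ψ' (√(1+s)))^2 := by
  have hc0 : 0 < c := by linarith
  set γ := √(1 + s/4) with hγ
  have hγ2 : γ^2 = 1 + s/4 := sq_sqrt (by positivity)
  have hγ0 : 0 < γ := sqrt_pos.2 (by positivity)
  set r := c * √(s*(1+s)) with hr
  have hr2 : r^2 = c^2*(s*(1+s)) := by rw [hr, mul_pow, sq_sqrt (by positivity)]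
  have hr0 : 0 < r := by positivity
  have hr42 : 42 ≤ r := by
    apply le_of_sq_le_sq _ hr0.le
    rw [hr2]
    have : (1800:ℝ) ≤ c*s*c := by nlinarith only [hc, hcs]
    nlinarith only [this, mul_pos (mul_pos hc0 hs) (mul_pos hc0 hs)]
  set φ := 1/r with hφ
  have hφ0 : 0 < φ := by positivity
  have hφr : φ * r = 1 := by rw [hφ]; field_simp
  have hφ42 : φ ≤ 1/42 := by rw [hφ]; exact one_div_le_one_div_of_le (by norm_num) hr42
  have hφ2 : φ^2 * (c^2*(s*(1+s))) = 1 := by rw [← hr2, ← mul_pow, hφr]; norm_num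
  have hs1 : φ - φ^3/4 < sin φ := by
    have := sin_gt_sub_cube hφ0
    nlinarith only [pow_pos hφ0 3, this]
  have hs2 : sin φ ≤ φ := sin_le hφ0.le
  have hs3 : 0.9998 * φ ≤ sin φ := by
    have : φ^3 ≤ φ * (1/42)^2 := by rw [pow_succ']; gcongr
    linarith
  have hs0 : 0 < sin φ := by linarith [mul_pos (show (0:ℝ) < 0.9998 by norm_num) hφ0]
  have hcs2 : sin φ^2 + cos φ^2 = 1 := sin_sq_add_cos_sq φ
  have hsq : sin φ^2 ≤ φ^2 := by gcongr
  have hsq2 : 0.9996 * φ^2 ≤ sin φ^2 := by nlinarith only [hs3, hφ0]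
  have hcos : 0.9994 ≤ cos φ^2 := by nlinarith only [hsq, hcs2, hφ42, hφ0]
  have hg := h.growth_phi hc0 hs hχ h1 hφ0 (by linarith [pi_gt_three])
  set x0 := √(1 + s * sin φ^2) with hx0
  have hx02 : x0^2 = 1 + s * sin φ^2 := sq_sqrt (by positivity)
  have hsp : 0 < s * sin φ^2 := by positivity
  have hx01 : 1 < x0 := by rw [hx0, Real.lt_sqrt (by norm_num)]; linarith
  have hsin1 := sin_sq_le_one φ
  have hx0t : x0^2 ≤ 1 + s := by rw [hx02]; nlinarith only [hsin1, hs]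
  have hsφ : s * φ^2 ≤ 1/900 := by
    have : s * φ^2 * (c^2*(1+s)) = 1 := by linear_combination hφ2
    have h2 : 900 ≤ c^2 := by nlinarith only [hc]
    have h3 : 900 ≤ c^2*(1+s) := by nlinarith only [h2, hs]
    have h4 : 0 < s * φ^2 := by positivity
    have h5 : s * φ^2 * 900 ≤ s * φ^2 * (c^2*(1+s)) := mul_le_mul_of_nonneg_left h3 h4.le
    linarith
  have hx0u : x0 ≤ 1.001 := by
    apply le_of_sq_le_sq _ (by norm_num)
    rw [hx02]; nlinarith only [hsφ, mul_le_mul_of_nonneg_left hsq hs.le]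
  -- lower bound for w(x0)
  have hq0 : ∀ y ∈ Icc 1 x0, c^2*s*cos φ^2 ≤ χ - c^2*y^2 := by
    intro y hy
    have : y^2 ≤ x0^2 := by nlinarith only [hy.1, hy.2]
    rw [hχ]
    have e : cos φ^2 = 1 - sin φ^2 := by linarith
    rw [e]
    have : y^2 ≤ 1 + s * sin φ^2 := by linarith
    nlinarith only [this, mul_le_mul_of_nonneg_left this (sq_nonneg c)]
  have hw0 : ψ 1 * (c^2*s*cos φ^2) * (x0 - 1) ≤ (x0^2 - 1) * ψ' x0 := by
    have := le_of_hasDerivAt_nonneg (f := fun x => -((1 - x^2) * ψ' x) - (ψ 1 * (c^2*s*cos φ^2)) * (x - 1))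
      (f' := fun x => -(-(χ - c^2 * x^2) * ψ x) - (ψ 1 * (c^2*s*cos φ^2)) * 1) (a := 1) (b := x0) hx01.le
      (by have := h.cont'; fun_prop)
      (fun x _ => (h.dw x).neg.sub (((hasDerivAt_id x).sub_const 1).const_mul _)) (fun y hy => by
        have h2 := h.psi_ge hχ h1 (x := y) hy.1.le (by nlinarith only [hy.1, hy.2, hx0t])
        have h3 := hq0 y (Ioo_subset_Icc_self hy)
        have : c^2*s*cos φ^2 * ψ 1 ≤ (χ - c^2*y^2) * ψ y := mul_le_mul h3 h2 h1.le (by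
          have : 0 ≤ c^2*s*cos φ^2 := by positivity
          linarith)
        linarith)
    simp at this
    linarith
  have hkey : c^2 * s * (s * φ^2) = s/(1+s) := by
    rw [eq_div_iff (by positivity)]
    linear_combination s * hφ2
  have hss : 0 < s/(1+s) := by positivity
  have hw0' : 0.4985 * (s/(1+s)) * ψ 1 ≤ (x0^2-1) * ψ' x0 := by
    have e : (x0 - 1) * (x0 + 1) = s * sin φ^2 := by linear_combination hx02
    have h3 : s * sin φ^2 ≤ (x0 - 1) * 2.001 := by rw [← e]; nlinarith only [hx01, hx0u]
    have h4 : 0.9996 * (s * φ^2) ≤ s * sin φ^2 := by nlinarith only [mul_le_mul_of_nonneg_left hsq2 hs.le]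
    have h5 : 0.4995 * (s*φ^2) ≤ x0 - 1 := by nlinarith only [mul_pos hs (pow_pos hφ0 2), h3, h4]
    have h6 : c^2*s*0.9994 ≤ c^2*s*cos φ^2 := mul_le_mul_of_nonneg_left hcos (by positivity)
    have h7 : (c^2*s*0.9994) * (0.4995 * (s*φ^2)) ≤ (c^2*s*cos φ^2) * (x0 - 1) :=
      mul_le_mul h6 h5 (by positivity) (by positivity)
    have h8 : (c^2*s*0.9994) * (0.4995 * (s*φ^2)) = 0.9994*0.4995*(s/(1+s)) := by rw [← hkey]; ring
    rw [h8] at h7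
    have h9 := mul_le_mul_of_nonneg_left h7 h1.le
    nlinarith only [mul_pos hss h1, h9, hw0]
  have hF0 : 0.4985 * (s/(1+s)) * ψ 1^2 ≤ (x0^2-1) * (ψ x0 * ψ' x0) := by
    have := h.psi_ge hχ h1 hx01.le hx0t
    calc 0.4985 * (s/(1+s)) * ψ 1^2 = (0.4985 * (s/(1+s)) * ψ 1) * ψ 1 := by ring
      _ ≤ ((x0^2-1) * ψ' x0) * ψ x0 := mul_le_mul hw0' this h1.le (le_trans (by positivity) hw0')
      _ = _ := by ring
  have hexp2 : 3 * c * s * φ / γ ≤ 2 := by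
    rw [div_le_iff₀ hγ0]
    apply le_of_sq_le_sq _ (by positivity)
    have e : (3*c*s*φ)^2 = 9 * (s/(1+s)) := by rw [← hkey]; ring
    rw [e, mul_pow, hγ2, mul_div_assoc', div_le_iff₀ (by positivity)]
    nlinarith only [sq_nonneg (s/2 - 1)]
  set E := exp (π/2*c*s/γ) with hE
  have hE0 : 0 < E := exp_pos _
  have hK : 1/16 * (s/(1+s)) * E * ψ 1^2 ≤ s * (ψ (√(1+s)) * ψ' (√(1+s))) := by
    refine le_trans ?_ hg
    have h2 : E * 0.1353 ≤ exp (π/2*c*s/γ - 3*c*s*φ/γ) := by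
      calc E * 0.1353 ≤ E * exp (-2) := by
            gcongr
            have : exp (-2) = (exp (-1))^2 := by rw [← exp_nat_mul]; norm_num
            rw [this]
            have := exp_neg_one_gt_d9
            nlinarith only [this]
        _ = exp (π/2*c*s/γ - 2) := by rw [hE, ← exp_add]; ring_nf
        _ ≤ _ := exp_le_exp.2 (by linarith)
    calc 1/16 * (s/(1+s)) * E * ψ 1^2 ≤ (0.4985 * (s/(1+s)) * ψ 1^2) * (E * 0.1353) := by
          have : 0 < (s/(1+s)) * E * ψ 1^2 := by positivity
          nlinarith only [this]
      _ ≤ _ := mul_le_mul hF0 h2 (by positivity) (le_trans (by positivity) hF0)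
  set xt := √(1+s) with hxt
  have hxt2 : xt^2 = 1 + s := sq_sqrt (by positivity)
  have hxt1 : 1 < xt := by rw [hxt, Real.lt_sqrt (by norm_num)]; linarith
  have hx0xt : x0 ≤ xt := le_of_sq_le_sq (by rw [hxt2]; exact hx0t) (by linarith)
  -- upper bound for psi(x0)
  have hψ0 : ψ x0 ≤ 4/3 * ψ 1 := by
    have hd : ∀ y ∈ Ioo 1 x0, ψ' y ≤ ψ x0 * (c^2*s)/2 := by
      intro y hy
      have hle := le_of_hasDerivAt_nonneg (f := fun x => ((1 - x^2) * ψ' x) + (ψ x0 * (c^2*s)) * (x - 1))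
        (f' := fun x => (-(χ - c^2 * x^2) * ψ x) + (ψ x0 * (c^2*s)) * 1) (a := 1) (b := y) hy.1.le
        (by have := h.cont'; fun_prop)
        (fun x _ => (h.dw x).add (((hasDerivAt_id x).sub_const 1).const_mul _)) (fun z hz => by
          have h2 := h.psi_mono hχ h1 (x := z) (y := x0) hz.1.le (by linarith [hz.2, hy.2]) hx0t
          have h2' := h.psi_ge hχ h1 (x := z) hz.1.le (by nlinarith only [hz.1, hz.2, hy.2, hx0t])
          have h3 : χ - c^2*z^2 ≤ c^2*s := by rw [hχ]; nlinarith only [mul_nonneg (sq_nonneg c) (show 0 ≤ z^2 - 1 by nlinarith only [hz.1])]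
          have : (χ - c^2*z^2) * ψ z ≤ c^2*s * ψ x0 := mul_le_mul h3 h2 (by linarith) (by positivity)
          linarith)
      simp at hle
      have hy1 : 0 < y - 1 := by linarith [hy.1]
      have : (y - 1) * ((y+1) * ψ' y) ≤ (y - 1) * (ψ x0 * (c^2*s)) := by nlinarith only [hle]
      have h5 := le_of_mul_le_mul_left this hy1
      have h6 := h.psi'_nonneg hχ h1 hy.1 (by nlinarith only [hy.1, hy.2, hx0t])
      nlinarith only [hy.1, h5, h6]
    have := le_of_hasDerivAt_nonneg (f := fun x => (ψ x0 * (c^2*s)/2) * x - ψ x) (f' := fun x => (ψ x0 * (c^2*s)/2) * 1 - ψ' x)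
      hx01.le (by have := h.cont; fun_prop) (fun x _ => ((hasDerivAt_id x).const_mul _).sub (h.d1 x)) (fun y hy => by
        have := hd y hy; linarith)
    have e : (x0 - 1) * (x0 + 1) = s * sin φ^2 := by linear_combination hx02
    have h3 : (x0 - 1) * 2 ≤ s * φ^2 := by nlinarith only [e, hx01, mul_le_mul_of_nonneg_left hsq hs.le]
    have hp : 0 < ψ x0 := lt_of_lt_of_le h1 (h.psi_ge hχ h1 hx01.le hx0t)
    have h4 : (ψ x0 * (c^2*s)/2) * (x0 - 1) ≤ ψ x0 / 4 := by
      have a1 : c^2*s*((x0-1)*2) ≤ c^2*s*(s*φ^2) := mul_le_mul_of_nonneg_left h3 (by positivity)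
      have a2 : s/(1+s) ≤ 1 := by rw [div_le_one (by positivity)]; linarith
      have a3 : c^2*s*(x0-1) ≤ 1/2 := by linarith
      nlinarith only [a3, hp]
    linarith
  -- upper bound for psi(xt)
  set w := s * ψ' xt with hw
  have hwd : (xt^2 - 1) * ψ' xt = w := by rw [hxt2, hw]; ring
  have hw00 : 0 ≤ w := mul_nonneg hs.le (h.psi'_nonneg hχ h1 hxt1 hxt2.le)
  have hψt : ψ xt ≤ 4/3 * ψ 1 + w * log (1.001 * c * (1+s)) := by
    have hmon := le_of_hasDerivAt_nonneg (f := fun x => w * (1/2 * (log (x - 1) - log (x+1))) - ψ x)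
      (f' := fun x => w * (1/2 * (1/(x-1) - 1/(x+1))) - ψ' x) hx0xt
      (fun y hy => by
        have := h.d1 y
        have h2 : HasDerivAt (fun x => w * (1/2 * (log (x - 1) - log (x+1))) - ψ x) (w * (1/2 * (1/(y-1) - 1/(y+1))) - ψ' y) y :=
          ((((((hasDerivAt_id y).sub_const 1).log (by simp; linarith [hy.1])).sub (((hasDerivAt_id y).add_const 1).log (by simp; linarith [hy.1])))).const_mul (1/2)).const_mul w |>.sub this
        exact h2.continuousAt.continuousWithinAt)
      (fun y hy => ((((((hasDerivAt_id y).sub_const 1).log (by simp; linarith [hy.1])).sub (((hasDerivAt_id y).add_const 1).log (by simp; linarith [hy.1])))).const_mul (1/2)).const_mul w |>.sub (h.d1 y))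
      (fun y hy => by
        have hy1 : 1 < y := by linarith [hy.1]
        have h2 := h.w_mono hχ h1 (x := y) (y := xt) hy1.le hy.2.le hxt2.le
        rw [hwd] at h2
        have h3 : 0 < y^2 - 1 := by nlinarith only [hy1]
        have e : 1/2 * (1/(y-1) - 1/(y+1)) = 1/(y^2-1) := by
          have : y - 1 ≠ 0 := by linarith
          have : y + 1 ≠ 0 := by linarith
          have e3 : y^2 - 1 = (y-1)*(y+1) := by ring
          rw [e3]; field_simp; ring
        rw [e, mul_one_div, sub_nonneg, le_div_iff₀ h3]
        linarith)
    have hl : 1/2 * (log (xt - 1) - log (xt+1)) - 1/2 * (log (x0 - 1) - log (x0+1)) ≤ log (1.001*c*(1+s)) := by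
      have l1 : log (xt - 1) - log (xt + 1) = log s - 2 * log (xt+1) := by
        have : s = (xt - 1) * (xt+1) := by linear_combination -hxt2
        rw [this, log_mul (by linarith) (by linarith)]; ring
      have l2 : log (x0 - 1) - log (x0 + 1) = log (s * sin φ^2) - 2 * log (x0+1) := by
        have : s * sin φ^2 = (x0 - 1) * (x0+1) := by linear_combination -hx02
        rw [this, log_mul (by linarith) (by linarith)]; ring
      have l3 : log (x0+1) ≤ log (xt+1) := log_le_log (by linarith) (by linarith)
      rw [l1, l2, log_mul hs.ne' (by positivity), log_pow]
      have l4 : -log (sin φ) ≤ log (1.001*c*(1+s)) := by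
        rw [← log_inv]
        apply log_le_log (by positivity)
        rw [inv_le_comm₀ hs0 (by positivity)]
        refine le_trans ?_ hs3
        have : r ≤ c * (1+s) := by
          rw [hr]; gcongr
          rw [sqrt_le_left (by positivity)]; nlinarith only [hs]
        rw [inv_le_iff_one_le_mul₀ (by positivity)]
        have h8 : 1 ≤ φ * (c*(1+s)) := by
          calc (1:ℝ) = φ * r := hφr.symm
            _ ≤ _ := by gcongr
        nlinarith only [h8]
      push_cast
      linarith
    have := mul_le_mul_of_nonneg_left hl hw00
    nlinarith only [this, hmon, hψ0]
  have hlog : log (1.001*c*(1+s)) + 1/2 ≤ log (2*c*(1+s)) := by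
    have : (1/2:ℝ) ≤ log (2/1.001) := by
      rw [le_log_iff_exp_le (by norm_num)]
      apply le_of_sq_le_sq _ (by norm_num)
      rw [← exp_nat_mul]
      have := exp_one_lt_d9
      norm_num at this ⊢
      linarith
    have e : 2*c*(1+s) = (2/1.001) * (1.001*c*(1+s)) := by ring
    rw [e, log_mul (show (2/1.001:ℝ) ≠ 0 by norm_num) (show 1.001*c*(1+s) ≠ 0 by positivity)]
    linarith
  have hfin : s * (ψ xt * ψ' xt) ≤ w^2 * log (2*c*(1+s)) + 8/9*ψ 1^2 := by
    have e : s * (ψ xt * ψ' xt) = w * ψ xt := by rw [hw]; ring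
    rw [e]
    have := mul_le_mul_of_nonneg_left hψt hw00
    have h2 := mul_le_mul_of_nonneg_left hlog (sq_nonneg w)
    nlinarith only [sq_nonneg (w - 4/3*ψ 1), this, h2]
  have hb := mul_le_mul_of_nonneg_right hbig (sq_nonneg (ψ 1))
  have e2 : 1/16 * (s/(1+s)) * E * ψ 1^2 = 1/16 * (ψ 1^2 * (s/(1+s)) * E) := by ring
  nlinarith only [hb, e2, hfin, hK, sq_nonneg (ψ 1)]

end

section
variable {c χ s : ℝ} {ψ ψ' ψ'' : ℝ → ℝ}

theorem RODE.R_ge (h : RODE c χ ψ ψ' ψ'') (hs : 0 < s) (hχ : χ = c^2*(1+s)) {x : ℝ} (hx : √(1+s) ≤ x) :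
    (s * ψ' (√(1+s)))^2 ≤ c^2*(x^2-1)*(x^2-1-s) * ψ x^2 + ((x^2-1) * ψ' x)^2 := by
  have hxt2 : √(1+s)^2 = 1 + s := sq_sqrt (by positivity)
  have h0 : 0 ≤ √(1+s) := sqrt_nonneg _
  have := le_of_hasDerivAt_nonneg (f := fun x => (1 - x^2) * (χ - c^2*x^2) * ψ x^2 + ((1 - x^2) * ψ' x)^2) hx
    (by have := h.cont'; have := h.cont; fun_prop) (fun x _ => h.dR x) (fun y hy => by
      have hy0 : 0 ≤ y := by linarith [hy.1]
      have hy2 : 1 + s ≤ y^2 := by rw [← hxt2]; nlinarith [hy.1]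
      have h1 : χ - c^2*y^2 ≤ 0 := by rw [hχ]; nlinarith [sq_nonneg c]
      have h2 : 0 ≤ (2*y) * (-(χ - c^2*y^2)) := mul_nonneg (by linarith) (by linarith)
      have h3 : 0 ≤ (y^2-1) * (2*c^2*y) := mul_nonneg (by linarith) (by positivity)
      apply mul_nonneg _ (sq_nonneg _)
      linarith)
  simp only [hxt2] at this
  rw [hχ] at this
  calc (s * ψ' (√(1+s)))^2 = (1 - (1+s)) * (c^2*(1+s) - c^2*(1+s)) * ψ (√(1+s))^2 + ((1 - (1+s)) * ψ' (√(1+s)))^2 := by ring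
    _ ≤ _ := this
    _ = _ := by ring

theorem RODE.zero_deriv (h : RODE c χ ψ ψ' ψ'') (hs : 0 < s) (hχ : χ = c^2*(1+s)) {x : ℝ} (hx : √(1+s) ≤ x) (h0 : ψ x = 0) :
    s * |ψ' (√(1+s))| ≤ (x^2-1) * |ψ' x| := by
  have h1 := h.R_ge hs hχ hx
  rw [h0] at h1
  have hxt2 : √(1+s)^2 = 1 + s := sq_sqrt (by positivity)
  have hx1 : 0 ≤ x^2 - 1 := by nlinarith [sqrt_nonneg (1+s)]
  have h2 : (s * ψ' (√(1+s)))^2 ≤ ((x^2-1) * ψ' x)^2 := by linarith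
  have := sq_le_sq.1 h2
  rwa [abs_mul, abs_mul, abs_of_pos hs, abs_of_nonneg hx1] at this

theorem RODE.zero_sep (h : RODE c χ ψ ψ' ψ'') (hc : 0 < c) (hs : 0 < s) (hχ : χ = c^2*(1+s)) (hw : ψ' (√(1+s)) ≠ 0)
    {a b : ℝ} (ha : √(1+s) ≤ a) (hab : a < b) (ha0 : ψ a = 0) (hb0 : ψ b = 0) : 1 < c * (b - a) := by
  have hxt2 : √(1+s)^2 = 1 + s := sq_sqrt (by positivity)
  have hxt0 := sqrt_nonneg (1+s)
  obtain ⟨d, hd, hmax⟩ := isCompact_Icc.exists_isMaxOn (nonempty_Icc.2 hab.le) (h.cont.abs.continuousOn (s := Icc a b))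
  have hmax' : ∀ x ∈ Icc a b, |ψ x| ≤ |ψ d| := fun x hx => hmax hx
  have hM : 0 < |ψ d| := by
    by_contra hcon
    have hz : ∀ x ∈ Icc a b, ψ x = 0 := fun x hx => abs_eq_zero.1 (le_antisymm ((hmax' x hx).trans (not_lt.1 hcon)) (abs_nonneg _))
    set m := (a+b)/2
    have hm : m ∈ Ioo a b := ⟨by simp only [m]; linarith, by simp only [m]; linarith⟩
    have h1 : ψ =ᶠ[nhds m] fun _ => 0 := by
      filter_upwards [Ioo_mem_nhds hm.1 hm.2] with x hx using hz x (Ioo_subset_Icc_self hx)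
    have h2 : ψ' m = 0 := (h.d1 m).unique ((hasDerivAt_const m (0:ℝ)).congr_of_eventuallyEq h1)
    have h3 := h.zero_deriv hs hχ (x := m) (by linarith [hm.1]) (hz m (Ioo_subset_Icc_self hm))
    rw [h2, abs_zero, mul_zero] at h3
    have := mul_pos hs (abs_pos.2 hw)
    linarith
  have hda : a < d := by
    rcases eq_or_lt_of_le hd.1 with h1 | h1
    · rw [← h1, ha0] at hM; simp at hM
    · exact h1
  have hdb : d < b := by
    rcases eq_or_lt_of_le hd.2 with h1 | h1
    · rw [h1, hb0] at hM; simp at hM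
    · exact h1
  have hd' : ψ' d = 0 := by
    have hloc : IsLocalMax (fun x => |ψ x|) d := hmax.isLocalMax (Icc_mem_nhds hda hdb)
    have hsq : IsLocalMax (fun x => ψ x^2) d := by
      filter_upwards [hloc] with x hx using sq_le_sq.2 hx
    have := hsq.hasDerivAt_eq_zero ((h.d1 d).pow 2)
    have hne : ψ d ≠ 0 := abs_pos.1 hM
    simp at this
    rcases this with h1 | h1
    · exact absurd h1 hne
    · exact h1
  have hP : ∀ y ∈ Icc d b, s ≤ y^2 - 1 := fun y hy => by nlinarith [hy.1, hy.2]
  have hder : ∀ x ∈ Icc d b, |ψ' x| ≤ c^2 * |ψ d| * (b - d) := by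
    intro x hx
    have hPx := hP x hx
    have := Convex.norm_image_sub_le_of_norm_hasDerivWithin_le (f := fun x => (1 - x^2) * ψ' x)
      (f' := fun x => -(χ - c^2 * x^2) * ψ x) (C := c^2*(x^2-1)*|ψ d|) (s := Icc d x)
      (fun z _ => (h.dw z).hasDerivWithinAt) (fun z hz => by
        have hzb : z ∈ Icc d b := ⟨hz.1, hz.2.trans hx.2⟩
        rw [norm_mul, norm_eq_abs, norm_eq_abs]
        apply mul_le_mul _ (hmax' z ⟨by linarith [hz.1], hzb.2⟩) (abs_nonneg _) (by nlinarith [sq_nonneg c])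
        have h1 := hP z hzb
        have h2 : z^2 ≤ x^2 := by nlinarith [hz.1, hz.2]
        rw [hχ, abs_of_nonneg (by nlinarith [sq_nonneg c])]
        nlinarith [sq_nonneg c, mul_nonneg (sq_nonneg c) hs.le]) (convex_Icc d x) (left_mem_Icc.2 hx.1) (right_mem_Icc.2 hx.1)
    rw [hd', mul_zero, sub_zero, norm_mul, norm_eq_abs, norm_eq_abs, norm_eq_abs, abs_of_nonneg (show 0 ≤ x - d by linarith [hx.1]),
      abs_sub_comm, abs_of_nonneg (show 0 ≤ x^2-1 by linarith)] at this
    have hpos : 0 < x^2 - 1 := by linarith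
    have h2 : (x^2-1) * |ψ' x| ≤ (x^2-1) * (c^2 * |ψ d| * (x - d)) := by linarith
    have h3 := le_of_mul_le_mul_left h2 hpos
    refine h3.trans ?_
    apply mul_le_mul_of_nonneg_left _ (by positivity)
    linarith [hx.2]
  have := Convex.norm_image_sub_le_of_norm_hasDerivWithin_le (f := ψ)
      (f' := ψ') (C := c^2 * |ψ d| * (b-d)) (s := Icc d b)
      (fun z _ => (h.d1 z).hasDerivWithinAt) (fun z hz => hder z hz) (convex_Icc d b) (left_mem_Icc.2 hdb.le) (right_mem_Icc.2 hdb.le)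
  rw [hb0, zero_sub, norm_neg, norm_eq_abs, norm_eq_abs, abs_of_pos (show 0 < b - d by linarith)] at this
  have h4 : |ψ d| * 1 ≤ |ψ d| * (c*(b-d))^2 := by linarith
  have h5 := le_of_mul_le_mul_left h4 hM
  have h6 : 1 ≤ c*(b-d) := by
    by_contra hcon
    push Not at hcon
    have : 0 < c*(b-d) := mul_pos hc (by linarith)
    nlinarith
  nlinarith

theorem RODE.zero_card (h : RODE c χ ψ ψ' ψ'') (hc : 0 < c) (hs : 0 < s) (hχ : χ = c^2*(1+s)) (hw : ψ' (√(1+s)) ≠ 0)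
    {X : ℝ} (hX : 0 ≤ X) (Z : Finset ℝ) (hZ : ∀ z ∈ Z, √(1+s) ≤ z ∧ z ≤ X ∧ ψ z = 0) : (Z.card : ℝ) ≤ c * X + 1 := by
  have hmap : ∀ z ∈ Z, ⌊c*z⌋₊ ∈ Finset.range (⌊c*X⌋₊+1) := by
    intro z hz
    rw [Finset.mem_range, Nat.lt_succ_iff]
    exact Nat.floor_le_floor (mul_le_mul_of_nonneg_left (hZ z hz).2.1 hc.le)
  have hlt : ∀ a ∈ Z, ∀ b ∈ Z, a < b → ⌊c*a⌋₊ < ⌊c*b⌋₊ := by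
    intro a ha b hb hab
    have := h.zero_sep hc hs hχ hw (hZ a ha).1 hab (hZ a ha).2.2 (hZ b hb).2.2
    have ha0 : 0 ≤ a := (sqrt_nonneg _).trans (hZ a ha).1
    have h1 : ((⌊c*a⌋₊ + 1 : ℕ) : ℝ) ≤ c * b := by
      push_cast
      have := Nat.floor_le (mul_nonneg hc.le ha0)
      linarith
    exact Nat.le_floor h1
  have hinj : Set.InjOn (fun z => ⌊c*z⌋₊) (Z : Set ℝ) := by
    intro a ha b hb hab
    rcases lt_trichotomy a b with h1 | h1 | h1
    · exact absurd hab (hlt a ha b hb h1).ne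
    · exact h1
    · exact absurd hab (hlt b hb a ha h1).ne'
  have := Finset.card_le_card_of_injOn _ hmap hinj
  rw [Finset.card_range] at this
  have h2 : (Z.card : ℝ) ≤ ⌊c*X⌋₊ + 1 := by exact_mod_cast this
  have := Nat.floor_le (mul_nonneg hc.le hX)
  linarith

theorem RODE.exists_X (h : RODE c χ ψ ψ' ψ'') (hc : 30 ≤ c) (hs : 0 < s) (hχ : χ = c^2*(1+s)) (hw : ψ' (√(1+s)) ≠ 0)
    {X0 : ℝ} (hX0 : 50 ≤ X0) (hX0s : 100 * (1+s) ≤ X0^2) :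
    ∃ X ∈ Icc X0 (1.01*X0), (s * ψ' (√(1+s)))^2 / 2 ≤ c^2*(X^2-1)*(X^2-1-s) * ψ X^2 := by
  by_contra hcon
  push Not at hcon
  set R := (s * ψ' (√(1+s)))^2 with hR
  have hRpos : 0 < R := by positivity
  have hxt2 : √(1+s)^2 = 1 + s := sq_sqrt (by positivity)
  have hxtX : √(1+s) ≤ X0 := by
    rw [sqrt_le_left (by linarith)]; linarith
  obtain ⟨ξ, hξ, hξe⟩ := exists_hasDerivAt_eq_slope ψ ψ' (show X0 < 1.01*X0 by linarith) h.cont.continuousOn (fun x _ => h.d1 x)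
  have hξ1 := h.R_ge hs hχ (x := ξ) (by linarith [hξ.1])
  have hξ2 := hcon ξ (Ioo_subset_Icc_self hξ)
  have hd : R/2 ≤ ((ξ^2-1) * ψ' ξ)^2 := by linarith
  -- bounds for psi at the end points
  have hb : ∀ X ∈ Icc X0 (1.01*X0), (c*X0^2*0.98)^2 * ψ X^2 ≤ R/2 := by
    intro X hX
    have h1 := hcon X hX
    have h2 : X0^2 ≤ X^2 := by nlinarith [hX.1]
    have h3 : 0.98 * X0^2 ≤ X^2-1-s := by nlinarith
    have h4 : 0.98 * X0^2 ≤ X^2-1 := by nlinarith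
    have h5 : (c*X0^2*0.98)^2 ≤ c^2*(X^2-1)*(X^2-1-s) := by
      calc (c*X0^2*0.98)^2 = c^2*((0.98*X0^2)*(0.98*X0^2)) := by ring
        _ ≤ c^2*((X^2-1)*(X^2-1-s)) := by gcongr; linarith
        _ = _ := by ring
    have := mul_le_mul_of_nonneg_right h5 (sq_nonneg (ψ X))
    linarith
  set T := √(R/2) with hT
  have hT2 : T^2 = R/2 := sq_sqrt (by positivity)
  have hT0 : 0 < T := sqrt_pos.2 (by positivity)
  have hc0 : 0 < c := by linarith
  have hb' : ∀ X ∈ Icc X0 (1.01*X0), (c*X0^2*0.98) * |ψ X| ≤ T := by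
    intro X hX
    apply abs_le_of_sq_le_sq' _ hT0.le |>.2
    rw [hT2, mul_pow, sq_abs]; exact hb X hX
  have ha := hb' X0 (left_mem_Icc.2 (by linarith))
  have hbb := hb' (1.01*X0) (right_mem_Icc.2 (by linarith))
  have hd' : T ≤ 1.0201 * X0^2 * |ψ' ξ| := by
    have h1 : T ≤ |(ξ^2-1) * ψ' ξ| := by
      apply le_of_sq_le_sq _ (abs_nonneg _)
      rw [hT2, sq_abs]; exact hd
    rw [abs_mul] at h1
    have h2 : |ξ^2-1| ≤ 1.0201 * X0^2 := by
      rw [abs_of_nonneg (by nlinarith [hξ.1])]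
      nlinarith [hξ.1, hξ.2]
    exact h1.trans (mul_le_mul_of_nonneg_right h2 (abs_nonneg _))
  have hslope : |ψ' ξ| * (0.01*X0) ≤ |ψ (1.01*X0)| + |ψ X0| := by
    rw [hξe, abs_div, abs_of_pos (show 0 < 1.01*X0 - X0 by linarith)]
    rw [show 0.01*X0 = 1.01*X0 - X0 by ring, div_mul_cancel₀ _ (by linarith)]
    exact abs_sub _ _
  have k1 : (c*X0^2*0.98) * (|ψ' ξ| * (0.01*X0)) ≤ 2*T := by
    calc _ ≤ (c*X0^2*0.98) * (|ψ (1.01*X0)| + |ψ X0|) := by gcongr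
      _ ≤ _ := by linarith
  have k2 : T * (c * X0 * 0.0098) ≤ 1.0201 * X0^2 * |ψ' ξ| * (c * X0 * 0.0098) := by gcongr
  have k3 : T * (c * X0 * 0.0098) ≤ T * 2.0402 := by linarith
  have k4 := le_of_mul_le_mul_left k3 hT0
  nlinarith

end

theorem conj_mul_deriv {A B : ℝ → ℂ} {A' B' : ℂ} {y : ℝ} (hA : HasDerivAt A A' y) (hB : HasDerivAt B B' y) :
    HasDerivAt (fun y => starRingEnd ℂ (A y) * B y) (starRingEnd ℂ A' * B y + starRingEnd ℂ (A y) * B') y :=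
  (Complex.conjCLE.hasFDerivAt.comp_hasDerivAt y hA).mul hB
theorem re_deriv {A : ℝ → ℂ} {A' : ℂ} {y : ℝ} (hA : HasDerivAt A A' y) : HasDerivAt (fun y => (A y).re) A'.re y :=
  Complex.reCLM.hasFDerivAt.comp_hasDerivAt y hA
theorem im_deriv {A : ℝ → ℂ} {A' : ℂ} {y : ℝ} (hA : HasDerivAt A A' y) : HasDerivAt (fun y => (A y).im) A'.im y :=
  Complex.imCLM.hasFDerivAt.comp_hasDerivAt y hA
theorem line_deriv {F : ℂ → ℂ} {F' : ℂ} {x y : ℝ} (h : HasDerivAt F F' (x + y * Complex.I)) :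
    HasDerivAt (fun y : ℝ => F (x + y * Complex.I)) (F' * Complex.I) y := by
  have h1 : HasDerivAt (fun w : ℂ => (x:ℂ) + w * Complex.I) Complex.I (y:ℂ) := by
    simpa using ((hasDerivAt_id (y:ℂ)).mul_const Complex.I).const_add (x:ℂ)
  exact (HasDerivAt.comp (y:ℂ) h h1).comp_ofReal

theorem deriv_zero_of_mono {N N' : ℝ → ℝ} {y0 : ℝ}
    (hd : ∀ y ∈ Icc 0 y0, HasDerivAt N (N' y) y) (hn : ∀ y ∈ Ioo 0 y0, 0 ≤ N' y) (h0 : 0 ≤ N 0) (h1 : N y0 ≤ 0) :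
    ∀ y ∈ Ioo 0 y0, N y = 0 ∧ N' y = 0 := by
  have hz : ∀ y ∈ Ioo 0 y0, N y = 0 := by
    intro y hy
    have a1 := le_of_hasDerivAt_nonneg hy.1.le (f := N) (f' := N')
      (fun x hx => (hd x ⟨hx.1, hx.2.trans hy.2.le⟩).continuousAt.continuousWithinAt)
      (fun x hx => hd x ⟨hx.1.le, hx.2.le.trans hy.2.le⟩) (fun x hx => hn x ⟨hx.1, hx.2.trans hy.2⟩)
    have a2 := le_of_hasDerivAt_nonneg hy.2.le (f := N) (f' := N')
      (fun x hx => (hd x ⟨hy.1.le.trans hx.1, hx.2⟩).continuousAt.continuousWithinAt)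
      (fun x hx => hd x ⟨hy.1.le.trans hx.1.le, hx.2.le⟩) (fun x hx => hn x ⟨hy.1.trans hx.1, hx.2⟩)
    linarith
  intro y hy
  refine ⟨hz y hy, ?_⟩
  have h1 : N =ᶠ[nhds y] fun _ => 0 := by
    filter_upwards [Ioo_mem_nhds hy.1 hy.2] with x hx using hz x hx
  exact (hd y ⟨hy.1.le, hy.2.le⟩).unique ((hasDerivAt_const y (0:ℝ)).congr_of_eventuallyEq h1)

theorem entire_zero_of_vert {f : ℂ → ℂ} (hf : Differentiable ℂ f) {x y0 : ℝ} (hy : 0 < y0)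
    (h : ∀ y ∈ Ioo 0 y0, f (x + y * Complex.I) = 0) : f = 0 := by
  have h1 := entire_zero_of_real_interval (f := fun w => f (x + w * Complex.I)) (by fun_prop) hy h
  funext z
  have := congrFun h1 ((z - x) / Complex.I)
  have e : (x:ℂ) + (z - x) / Complex.I * Complex.I = z := by
    rw [div_mul_cancel₀ _ Complex.I_ne_zero]; ring
  simp only [e] at this
  exact this

section
variable {c χ s : ℝ} {ψ : ℝ → ℝ} {f : ℂ → ℂ}

/-- derivative of the flux along a vertical line -/
theorem CODE.dW (h : CODE c χ ψ f) (x y : ℝ) :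
    HasDerivAt (fun y : ℝ => starRingEnd ℂ (f (x + y * Complex.I)) *
        ((1 - ((x:ℂ) + y * Complex.I)^2) * deriv f (x + y * Complex.I)))
      (-Complex.I * ((1 - ((x:ℂ) + y * Complex.I)^2) * (Complex.normSq (deriv f (x + y * Complex.I)) : ℂ)
        + (χ - c^2 * ((x:ℂ) + y * Complex.I)^2) * (Complex.normSq (f (x + y * Complex.I)) : ℂ))) y := by
  have h1 := line_deriv (h.diff (x + y * Complex.I)).hasDerivAt
  have h2 : HasDerivAt (fun z : ℂ => (1 - z^2) * deriv f z) (-(χ - c^2 * ((x:ℂ) + y * Complex.I)^2) * f (x + y * Complex.I)) (x + y * Complex.I) := by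
    have h3 := (h.diff' (x + y * Complex.I)).hasDerivAt
    have h4 : HasDerivAt (fun z : ℂ => 1 - z^2) (-(2 * ((x:ℂ) + y * Complex.I))) (x + y * Complex.I) := by
      simpa using (hasDerivAt_pow 2 ((x:ℂ) + y * Complex.I)).const_sub 1
    refine (h4.mul h3).congr_deriv ?_
    linear_combination h.ode (x + y * Complex.I)
  refine (conj_mul_deriv h1 (line_deriv h2)).congr_deriv ?_
  rw [Complex.normSq_eq_conj_mul_self, Complex.normSq_eq_conj_mul_self, map_mul, Complex.conj_I]
  ring

theorem CODE.ne_zero_inner (h : CODE c χ ψ f) (hχ : c^2 < χ) (hf : f ≠ 0) {x y0 : ℝ} (hx : x^2 ≤ 1) (hy0 : 0 < y0) :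
    f (x + y0 * Complex.I) ≠ 0 := by
  intro hz
  apply hf
  have hre : ∀ y : ℝ, (-Complex.I * ((1 - ((x:ℂ) + y * Complex.I)^2) * (Complex.normSq (deriv f (x + y * Complex.I)) : ℂ)
        + (χ - c^2 * ((x:ℂ) + y * Complex.I)^2) * (Complex.normSq (f (x + y * Complex.I)) : ℂ))).im =
      -((1 - x^2 + y^2) * Complex.normSq (deriv f (x + y * Complex.I)) + (χ - c^2*x^2 + c^2*y^2) * Complex.normSq (f (x + y * Complex.I))) := by
    intro y
    simp [pow_two]
    ring
  have key := deriv_zero_of_mono (y0 := y0) (fun y _ => (im_deriv (h.dW x y)).neg) (fun y hy => ?_) ?_ ?_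
  · apply entire_zero_of_vert h.diff (x := x) hy0
    intro y hy
    have h1 := (key y hy).2
    rw [hre, neg_neg] at h1
    have p1 : 0 ≤ (1 - x^2 + y^2) * Complex.normSq (deriv f (x + y * Complex.I)) :=
      mul_nonneg (by nlinarith) (Complex.normSq_nonneg _)
    have p2 : 0 < χ - c^2*x^2 + c^2*y^2 := by nlinarith [sq_nonneg c, sq_nonneg (c*y)]
    have p3 := Complex.normSq_nonneg (f (x + y * Complex.I))
    have : Complex.normSq (f (x + y * Complex.I)) = 0 := by
      by_contra hne
      have := mul_pos p2 (lt_of_le_of_ne p3 (Ne.symm hne))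
      linarith
    exact Complex.normSq_eq_zero.1 this
  · rw [hre, neg_neg]
    have p2 : 0 < χ - c^2*x^2 + c^2*y^2 := by nlinarith [sq_nonneg c, sq_nonneg (c*y)]
    have p1 : 0 ≤ (1 - x^2 + y^2) * Complex.normSq (deriv f (x + y * Complex.I)) :=
      mul_nonneg (by nlinarith) (Complex.normSq_nonneg _)
    have := mul_nonneg p2.le (Complex.normSq_nonneg (f (x + y * Complex.I)))
    linarith
  · simp [h.real, h.real', pow_two]
  · simp [hz]

theorem CODE.ne_zero_mid (h : CODE c χ ψ f) (hf : f ≠ 0) {x y0 : ℝ} (hx : 1 < x)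
    (hp : 0 ≤ ψ x * deriv ψ x) (hy0 : 0 < y0) : f (x + y0 * Complex.I) ≠ 0 := by
  intro hz
  apply hf
  have hre : ∀ y : ℝ, (-Complex.I * ((1 - ((x:ℂ) + y * Complex.I)^2) * (Complex.normSq (deriv f (x + y * Complex.I)) : ℂ)
        + (χ - c^2 * ((x:ℂ) + y * Complex.I)^2) * (Complex.normSq (f (x + y * Complex.I)) : ℂ))).re =
      -(2*x*y*Complex.normSq (deriv f (x + y * Complex.I)) + (2*x*y*c^2) * Complex.normSq (f (x + y * Complex.I))) := by
    intro y
    simp [pow_two]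
    ring
  have key := deriv_zero_of_mono (y0 := y0) (fun y _ => (re_deriv (h.dW x y)).neg) (fun y hy => ?_) ?_ ?_
  · have hd : deriv f = 0 := by
      apply entire_zero_of_vert h.diff' (x := x) hy0
      intro y hy
      have h1 := (key y hy).2
      rw [hre, neg_neg] at h1
      have p1 : 0 < 2*x*y := by have := hy.1; positivity
      have p2 : 0 ≤ (2*x*y*c^2) * Complex.normSq (f (x + y * Complex.I)) := 
        mul_nonneg (by positivity) (Complex.normSq_nonneg _)
      have p3 := Complex.normSq_nonneg (deriv f (x + y * Complex.I))
      have : Complex.normSq (deriv f (x + y * Complex.I)) = 0 := by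
        by_contra hne
        have := mul_pos p1 (lt_of_le_of_ne p3 (Ne.symm hne))
        linarith
      exact Complex.normSq_eq_zero.1 this
    funext z
    rw [is_const_of_deriv_eq_zero h.diff (fun z => congrFun hd z) z (x + y0 * Complex.I), hz]
    rfl
  · rw [hre, neg_neg]
    have := hy.1
    have := Complex.normSq_nonneg (f (x + y * Complex.I))
    have := Complex.normSq_nonneg (deriv f (x + y * Complex.I))
    positivity
  · have : 0 ≤ (x^2-1) * (ψ x * deriv ψ x) := mul_nonneg (by nlinarith) hp
    simp [h.real, h.real', pow_two]
    nlinarith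
  · simp [hz]
end

/-- square root of `z^2-1` on the half plane `re z > 1` -/
noncomputable def rt (z : ℂ) : ℂ := Complex.exp ((Complex.log (z-1) + Complex.log (z+1))/2)

theorem rt_ne (z : ℂ) : rt z ≠ 0 := Complex.exp_ne_zero _

theorem rt_sq {z : ℂ} (hz : 1 < z.re) : rt z ^ 2 = z^2 - 1 := by
  have h1 : z - 1 ≠ 0 := fun h => by have := congrArg Complex.re h; simp at this; linarith
  have h2 : z + 1 ≠ 0 := fun h => by have := congrArg Complex.re h; simp at this; linarith
  unfold rt
  rw [← Complex.exp_nat_mul, show ((2:ℕ):ℂ) * ((Complex.log (z-1) + Complex.log (z+1))/2) = Complex.log (z-1) + Complex.log (z+1) by push_cast; ring,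
    Complex.exp_add, Complex.exp_log h1, Complex.exp_log h2]
  ring

theorem sq_sub_one_ne {z : ℂ} (hz : 1 < z.re) : z^2 - 1 ≠ 0 := by
  rw [← rt_sq hz]; exact pow_ne_zero _ (rt_ne z)

theorem rt_deriv {z : ℂ} (hz : 1 < z.re) : HasDerivAt rt (rt z * (z / (z^2-1))) z := by
  have h1 : z - 1 ≠ 0 := fun h => by have := congrArg Complex.re h; simp at this; linarith
  have h2 : z + 1 ≠ 0 := fun h => by have := congrArg Complex.re h; simp at this; linarith
  have a1 : HasDerivAt (fun z => Complex.log (z-1)) (1 / (z-1)) z :=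
    ((hasDerivAt_id z).sub_const 1).clog (Or.inl (by simp; linarith))
  have a2 : HasDerivAt (fun z => Complex.log (z+1)) (1 / (z+1)) z :=
    ((hasDerivAt_id z).add_const 1).clog (Or.inl (by simp; linarith))
  have a3 := ((a1.add a2).div_const 2).cexp
  refine a3.congr_deriv ?_
  have h3 := sq_sub_one_ne hz
  change rt z * _ = _
  congr 1
  field_simp
  ring

section
variable {c χ s : ℝ} {ψ : ℝ → ℝ} {f : ℂ → ℂ}

theorem CODE.dg (h : CODE c χ ψ f) {z : ℂ} (hz : 1 < z.re) :
    HasDerivAt (fun z => rt z * f z) (rt z * (deriv f z + z / (z^2-1) * f z)) z := by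
  refine ((rt_deriv hz).mul (h.diff z).hasDerivAt).congr_deriv ?_
  ring

theorem CODE.dg1 (h : CODE c χ ψ f) (hχ : χ = c^2*(1+s)) {z : ℂ} (hz : 1 < z.re) :
    HasDerivAt (fun z => rt z * (deriv f z + z / (z^2-1) * f z))
      (-(c^2 * (1 - s * (z^2-1)⁻¹) + ((z^2-1)⁻¹)^2) * (rt z * f z)) z := by
  have hD := sq_sub_one_ne hz
  have b1 : HasDerivAt (fun z : ℂ => z / (z^2-1)) ((1 * (z^2-1) - z * (2*z)) / (z^2-1)^2) z := by
    have : HasDerivAt (fun z : ℂ => z^2-1) (2*z) z := by simpa using (hasDerivAt_pow 2 z).sub_const 1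
    exact (hasDerivAt_id z).div this hD
  refine ((rt_deriv hz).mul ((h.diff' z).hasDerivAt.add (b1.mul (h.diff z).hasDerivAt))).congr_deriv ?_
  have ho := h.ode z
  rw [hχ] at ho
  push_cast at ho
  have e : deriv (deriv f) z = (-2*z*deriv f z + (c^2*(1+s) - c^2*z^2) * f z) / (z^2-1) := by
    rw [eq_div_iff hD]
    linear_combination -ho
  simp only [Pi.add_apply, Pi.mul_apply]
  rw [e]
  field_simp
  ring

/-- modulus-squared derivative, flux derivative for a Schrodinger equation on a vertical line -/
theorem flux_u {G G1 : ℝ → ℂ} {y : ℝ} (hG : HasDerivAt G (G1 y * Complex.I) y) :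
    HasDerivAt (fun y => Complex.normSq (G y)) (2 * -(starRingEnd ℂ (G y) * G1 y).im) y := by
  have := re_deriv (conj_mul_deriv hG hG)
  refine (this.congr_deriv ?_).congr_of_eventuallyEq ?_
  · simp; ring
  · refine Filter.Eventually.of_forall fun y => ?_
    simp [Complex.normSq_apply]

theorem flux_K {G G1 : ℝ → ℂ} {V : ℂ} {y : ℝ} (hG : HasDerivAt G (G1 y * Complex.I) y)
    (hG1 : HasDerivAt G1 (-V * G y * Complex.I) y) :
    HasDerivAt (fun y => -(starRingEnd ℂ (G y) * G1 y).im) (Complex.normSq (G1 y) + V.re * Complex.normSq (G y)) y := by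
  refine (im_deriv (conj_mul_deriv hG hG1)).neg.congr_deriv ?_
  simp [Complex.normSq_apply]; ring

theorem flux_le {A B : ℂ} : (-(starRingEnd ℂ A * B).im)^2 ≤ Complex.normSq A * Complex.normSq B := by
  simp [Complex.normSq_apply]
  nlinarith [sq_nonneg (A.re*B.re + A.im*B.im)]

/-- growth of a solution along a vertical line -/
theorem vert_growth {G G1 : ℝ → ℂ} {V : ℝ → ℂ} {k Y : ℝ} (hY : 0 ≤ Y) (hk : 0 < k)
    (hG : ∀ y, HasDerivAt G (G1 y * Complex.I) y)
    (hG1 : ∀ y, HasDerivAt G1 (-V y * G y * Complex.I) y) (hV : ∀ y, k^2 ≤ (V y).re)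
    (h0 : (starRingEnd ℂ (G 0) * G1 0).im = 0) : ‖G 0‖ * (exp (k*Y) / 2) ≤ ‖G Y‖ := by
  rcases eq_or_ne (G 0) 0 with hz | hz
  · simp [hz]
  set u : ℝ → ℝ := fun y => Complex.normSq (G y) with hu
  set K : ℝ → ℝ := fun y => -(starRingEnd ℂ (G y) * G1 y).im with hK
  have du : ∀ y, HasDerivAt u (2 * K y) y := fun y => flux_u (hG y)
  have dK : ∀ y, HasDerivAt K (Complex.normSq (G1 y) + (V y).re * u y) y := fun y => flux_K (hG y) (hG1 y)
  have hK00 : K 0 = 0 := by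
    change -(starRingEnd ℂ (G 0) * G1 0).im = 0
    rw [h0, neg_zero]
  have hu0 : 0 < u 0 := Complex.normSq_pos.2 hz
  have hun : ∀ y, 0 ≤ u y := fun y => Complex.normSq_nonneg _
  have hK0 : ∀ y, 0 ≤ y → 0 ≤ K y := by
    intro y hy
    have := le_of_hasDerivAt_nonneg (f := K) hy (fun x _ => (dK x).continuousAt.continuousWithinAt) (fun x _ => dK x)
      (fun x _ => add_nonneg (Complex.normSq_nonneg _) (mul_nonneg ((sq_nonneg k).trans (hV x)) (hun x)))
    rwa [hK00] at this
  have hup : ∀ y, 0 ≤ y → u 0 ≤ u y := fun y hy =>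
    le_of_hasDerivAt_nonneg (f := u) hy (fun x _ => (du x).continuousAt.continuousWithinAt) (fun x _ => du x)
      (fun x hx => by have := hK0 x hx.1.le; linarith)
  set v : ℝ → ℝ := fun y => √(u y) with hv
  have hvp : ∀ y, 0 ≤ y → 0 < v y := fun y hy => sqrt_pos.2 (hu0.trans_le (hup y hy))
  have hv2 : ∀ y, v y ^ 2 = u y := fun y => sq_sqrt (hun y)
  have dv : ∀ y, 0 ≤ y → HasDerivAt v (K y / v y) y := by
    intro y hy
    refine ((du y).sqrt (hu0.trans_le (hup y hy)).ne').congr_deriv ?_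
    change 2 * K y / (2 * v y) = _
    rw [mul_div_mul_left _ _ two_ne_zero]
  have dv1 : ∀ y, 0 ≤ y → HasDerivAt (fun y => K y / v y) (((Complex.normSq (G1 y) + (V y).re * u y) * v y - K y * (K y / v y)) / v y^2) y :=
    fun y hy => (dK y).div (dv y hy) (hvp y hy).ne'
  have hconv : ∀ y, 0 ≤ y → k^2 * v y ≤ ((Complex.normSq (G1 y) + (V y).re * u y) * v y - K y * (K y / v y)) / v y^2 := by
    intro y hy
    have hp := hvp y hy
    rw [le_div_iff₀ (by positivity)]
    have h1 : K y^2 ≤ u y * Complex.normSq (G1 y) := flux_le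
    have h2 : K y * (K y / v y) ≤ v y * Complex.normSq (G1 y) := by
      rw [← mul_div_assoc, div_le_iff₀ hp]
      calc K y * K y = K y^2 := by ring
        _ ≤ _ := h1
        _ = _ := by rw [← hv2]; ring
    have h3 := mul_le_mul_of_nonneg_right (hV y) (mul_nonneg (hun y) hp.le)
    rw [hv2]
    linarith
  have g1 : ∀ y, 0 ≤ y → k * v 0 * exp (k*y) ≤ K y / v y + k * v y := by
    intro y hy
    have := growth_of_hasDerivAt (f := fun y => K y / v y + k * v y) (θ := fun y => k*y) (θ' := fun _ => k) hy
      (fun x hx => ((dv1 x hx.1).add ((dv x hx.1).const_mul k)).continuousAt.continuousWithinAt) (by fun_prop)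
      (fun x hx => (dv1 x hx.1.le).add ((dv x hx.1.le).const_mul k)) (fun x _ => by simpa using (hasDerivAt_id x).const_mul k)
      (fun x hx => by
        have := hconv x hx.1.le
        linarith)
    simpa [hK00] using this
  have g2 := le_of_hasDerivAt_nonneg (f := fun y => v y * exp (k*y) - v 0 * exp (2*k*y) / 2)
    (f' := fun y => (K y / v y) * exp (k*y) + v y * (k * exp (k*y)) - v 0 * (2*k*exp (2*k*y))/2) hY
    (fun x hx => by
      apply ContinuousAt.continuousWithinAt
      have := (dv x hx.1).continuousAt
      fun_prop)
    (fun x hx => by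
      have e1 : HasDerivAt (fun y => exp (k*y)) (k * exp (k*x)) x := by
        have := ((hasDerivAt_id x).const_mul k).exp
        simpa [mul_comm] using this
      have e2 : HasDerivAt (fun y => exp (2*k*y)) (2*k * exp (2*k*x)) x := by
        have := ((hasDerivAt_id x).const_mul (2*k)).exp
        simpa [mul_comm] using this
      exact ((dv x hx.1.le).mul e1).sub ((e2.const_mul (v 0)).div_const 2))
    (fun x hx => by
      have h1 := mul_le_mul_of_nonneg_right (g1 x hx.1.le) (exp_pos (k*x)).le
      have h2 : exp (2*k*x) = exp (k*x) * exp (k*x) := by rw [← exp_add]; ring_nf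
      rw [h2]
      linarith)
  have hn : ∀ y, ‖G y‖ = v y := fun y => by simp [hv, hu, Complex.norm_def]
  rw [hn, hn]
  have h2 : exp (2*k*Y) = exp (k*Y) * exp (k*Y) := by rw [← exp_add]; ring_nf
  simp only [mul_zero, exp_zero, mul_one] at g2
  rw [h2] at g2
  have hv0 := hvp 0 le_rfl
  have h3 : (v 0 * (exp (k*Y)/2)) * exp (k*Y) ≤ v Y * exp (k*Y) := by linarith
  exact le_of_mul_le_mul_right h3 (exp_pos _)

theorem normSq_D (x y : ℝ) : Complex.normSq (((x:ℂ) + y * Complex.I)^2 - 1) = (x^2-y^2-1)^2 + (2*x*y)^2 := by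
  simp [Complex.normSq_apply, pow_two]; ring

theorem reV_eq (x y : ℝ) : ((c:ℂ)^2 * (1 - s * (((x:ℂ) + y * Complex.I)^2-1)⁻¹) + ((((x:ℂ) + y * Complex.I)^2-1)⁻¹)^2).re =
    c^2*(1 - s * ((x^2-y^2-1) / ((x^2-y^2-1)^2 + (2*x*y)^2))) +
      (((x^2-y^2-1) / ((x^2-y^2-1)^2 + (2*x*y)^2))^2 - ((2*x*y) / ((x^2-y^2-1)^2 + (2*x*y)^2))^2) := by
  have hre : ((((x:ℂ) + y * Complex.I)^2-1)⁻¹).re = (x^2-y^2-1) / ((x^2-y^2-1)^2 + (2*x*y)^2) := by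
    rw [Complex.inv_re, normSq_D]; congr 1; simp [pow_two]
  have him : ((((x:ℂ) + y * Complex.I)^2-1)⁻¹).im = -(2*x*y) / ((x^2-y^2-1)^2 + (2*x*y)^2) := by
    rw [Complex.inv_im, normSq_D]; congr 1; simp [pow_two]; ring
  generalize (((x:ℂ) + y * Complex.I)^2-1)⁻¹ = w at hre him
  rw [← hre, show (2*x*y) / ((x^2-y^2-1)^2 + (2*x*y)^2) = -w.im by rw [him]; ring]
  simp [pow_two]

theorem reV_nonneg (hs : 0 < s) (hcs : 2 ≤ c^2*s^2) {x : ℝ} (hx : 1 + s ≤ x^2) (y : ℝ) :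
    0 ≤ ((c:ℂ)^2 * (1 - s * (((x:ℂ) + y * Complex.I)^2-1)⁻¹) + ((((x:ℂ) + y * Complex.I)^2-1)⁻¹)^2).re := by
  rw [reV_eq]
  set a := x^2-y^2-1 with ha
  set b := 2*x*y with hb
  set N := a^2+b^2 with hN
  have hNs : s^2 ≤ N := by
    have : N = (x^2-1)^2 + y^2*(2*x^2+2) + y^4 := by rw [hN, ha, hb]; ring
    rw [this]
    have : s^2 ≤ (x^2-1)^2 := by nlinarith
    have : 0 ≤ y^2*(2*x^2+2) := by positivity
    have : 0 ≤ y^4 := by positivity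
    linarith
  have hN0 : 0 < N := lt_of_lt_of_le (by positivity) hNs
  have hcN : 2 ≤ c^2*N := hcs.trans (mul_le_mul_of_nonneg_left hNs (sq_nonneg c))
  have key : 0 ≤ c^2*(N - s*a)*N + a^2 - b^2 := by
    rcases le_total 0 a with h0 | h0
    · have h1 : b^2/2 ≤ N - s*a := by
        have : N = (x^2-1)^2 + y^2*(2*x^2+2) + y^4 := by rw [hN, ha, hb]; ring
        have h2 : s*a ≤ (x^2-1)*a := mul_le_mul_of_nonneg_right (by linarith) h0
        have h3 : 0 ≤ (x^2-1)*y^2 := mul_nonneg (by linarith) (sq_nonneg y)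
        have h4 : (x^2-1)*a = (x^2-1)^2 - (x^2-1)*y^2 := by rw [ha]; ring
        have h5 : b^2/2 = 2*x^2*y^2 := by rw [hb]; ring
        have h6 : 0 ≤ y^2 := sq_nonneg y
        have h7 : 0 ≤ y^4 := by positivity
        rw [this, h5]
        nlinarith only [h2, h3, h4, h6, h7]
      have h2 : 2*(b^2/2) ≤ (c^2*N)*(N - s*a) :=
        mul_le_mul hcN h1 (by positivity) (by linarith)
      nlinarith only [h2, sq_nonneg a]
    · have h1 : N ≤ N - s*a := by nlinarith
      have h2 : 2*N ≤ (c^2*N)*(N - s*a) := mul_le_mul hcN h1 hN0.le (by linarith)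
      nlinarith only [h2, sq_nonneg a, sq_nonneg b, hN]
  have e : c^2*(1 - s*(a/N)) + ((a/N)^2 - (b/N)^2) = (c^2*(N - s*a)*N + a^2 - b^2)/N^2 := by
    field_simp
    ring
  rw [e]
  positivity

theorem reV_ge (hs : 0 < s) {x : ℝ} (hx : 1 < x) (y : ℝ) : c^2*(1 - s/(x^2-1)) - 1/(x^2-1)^2 ≤
    ((c:ℂ)^2 * (1 - s * (((x:ℂ) + y * Complex.I)^2-1)⁻¹) + ((((x:ℂ) + y * Complex.I)^2-1)⁻¹)^2).re := by
  rw [reV_eq]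
  set a := x^2-y^2-1 with ha
  set b := 2*x*y with hb
  set N := a^2+b^2 with hN
  have hP : 0 < x^2-1 := by nlinarith
  have hNs : (x^2-1)^2 ≤ N := by
    have : N = (x^2-1)^2 + y^2*(2*x^2+2) + y^4 := by rw [hN, ha, hb]; ring
    rw [this]
    have : 0 ≤ y^2*(2*x^2+2) := by positivity
    have : 0 ≤ y^4 := by positivity
    linarith
  have hN0 : 0 < N := lt_of_lt_of_le (by positivity) hNs
  have hsq : (a/N)^2 + (b/N)^2 = 1/N := by
    rw [div_pow, div_pow, ← add_div, ← hN]; field_simp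
  have h1N : 1/N ≤ 1/(x^2-1)^2 := one_div_le_one_div_of_le (by positivity) hNs
  have h1 : a/N ≤ 1/(x^2-1) := by
    apply le_of_sq_le_sq _ (by positivity)
    rw [div_pow 1, one_pow]
    nlinarith [sq_nonneg (b/N)]
  have h2 : s*(a/N) ≤ s/(x^2-1) := by
    rw [show s/(x^2-1) = s*(1/(x^2-1)) by ring]; exact mul_le_mul_of_nonneg_left h1 hs.le
  have h3 : c^2*(1 - s/(x^2-1)) ≤ c^2*(1 - s*(a/N)) := mul_le_mul_of_nonneg_left (by linarith) (sq_nonneg c)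
  have h4 : (b/N)^2 ≤ 1/N := by linarith [sq_nonneg (a/N)]
  linarith [sq_nonneg (a/N)]

/-- `√(z²-1) f` on a vertical line -/
noncomputable def lineG (f : ℂ → ℂ) (x y : ℝ) : ℂ := rt (x + y * Complex.I) * f (x + y * Complex.I)
/-- derivative of `√(z²-1) f` on a vertical line -/
noncomputable def lineG1 (f : ℂ → ℂ) (x y : ℝ) : ℂ :=
  rt (x + y * Complex.I) * (deriv f (x + y * Complex.I) + (x + y * Complex.I) / ((x + y * Complex.I)^2-1) * f (x + y * Complex.I))

theorem CODE.line_dg (h : CODE c χ ψ f) {x : ℝ} (hx : 1 < x) (y : ℝ) :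
    HasDerivAt (lineG f x) (lineG1 f x y * Complex.I) y :=
  line_deriv (h.dg (by simpa using hx))

/-- potential -/
noncomputable def lineV (c s x y : ℝ) : ℂ := (c:ℂ)^2 * (1 - s * (((x:ℂ) + y * Complex.I)^2-1)⁻¹) + ((((x:ℂ) + y * Complex.I)^2-1)⁻¹)^2

theorem CODE.line_dg1 (h : CODE c χ ψ f) (hχ : χ = c^2*(1+s)) {x : ℝ} (hx : 1 < x) (y : ℝ) :
    HasDerivAt (lineG1 f x) (-lineV c s x y * lineG f x y * Complex.I) y :=
  line_deriv (h.dg1 hχ (by simpa using hx))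

theorem CODE.line_im0 (h : CODE c χ ψ f) (x : ℝ) : (starRingEnd ℂ (lineG f x 0) * lineG1 f x 0).im = 0 := by
  have e0 : (x:ℂ) + (0:ℝ) * Complex.I = x := by simp
  unfold lineG lineG1
  rw [e0, h.real, h.real']
  have e : starRingEnd ℂ (rt x * (ψ x:ℂ)) * (rt x * ((deriv ψ x : ℝ) + x / ((x:ℂ)^2-1) * (ψ x:ℂ))) =
     ((Complex.normSq (rt x) * (ψ x * (deriv ψ x + x/(x^2-1)*ψ x)) : ℝ) : ℂ) := by
    push_cast
    rw [Complex.normSq_eq_conj_mul_self, map_mul, Complex.conj_ofReal]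
    ring
  rw [e, Complex.ofReal_im]

theorem CODE.ne_zero_outer (h : CODE c χ ψ f) (hf : f ≠ 0) (hs : 0 < s) (hχ : χ = c^2*(1+s)) (hcs : 2 ≤ c^2*s^2)
    {x y0 : ℝ} (hx1 : 1 < x) (hx : 1 + s ≤ x^2) (hy0 : 0 < y0) : f (x + y0 * Complex.I) ≠ 0 := by
  intro hz
  apply hf
  have dK := fun y => flux_K (h.line_dg hx1 y) (h.line_dg1 hχ hx1 y)
  have du := fun y => flux_u (h.line_dg hx1 y)
  have hz' : lineG f x y0 = 0 := by simp [lineG, hz]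
  have key := deriv_zero_of_mono (y0 := y0) (fun y _ => dK y) (fun y _ => by
    have h1 := mul_nonneg (reV_nonneg hs hcs hx y) (Complex.normSq_nonneg (lineG f x y))
    exact add_nonneg (Complex.normSq_nonneg _) h1) (by rw [h.line_im0]; simp) (by simp [hz'])
  apply entire_zero_of_vert h.diff (x := x) hy0
  intro y hy
  have h1 := le_of_hasDerivAt_nonneg (f := fun y => -Complex.normSq (lineG f x y)) hy.2.le
      (fun y _ => (du y).neg.continuousAt.continuousWithinAt) (fun y _ => (du y).neg)
        (fun z hz => by rw [(key z ⟨hy.1.trans hz.1, hz.2⟩).1]; simp)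
  have h2 := le_of_hasDerivAt_nonneg (f := fun y => Complex.normSq (lineG f x y)) hy.2.le
      (fun y _ => (du y).continuousAt.continuousWithinAt) (fun y _ => du y)
        (fun z hz => by rw [(key z ⟨hy.1.trans hz.1, hz.2⟩).1]; simp)
  simp only [hz', map_zero] at h1 h2
  have h3 : Complex.normSq (lineG f x y) = 0 := le_antisymm h2 (Complex.normSq_nonneg _)
  exact (mul_eq_zero.1 (Complex.normSq_eq_zero.1 h3)).resolve_left (rt_ne _)

theorem norm_rt_sq {z : ℂ} (hz : 1 < z.re) : ‖rt z‖^2 = ‖z^2-1‖ := by rw [← norm_pow, rt_sq hz]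

/-- lower bound on the vertical line -/
theorem CODE.vert_lower (h : CODE c χ ψ f) (hs : 0 < s) (hχ : χ = c^2*(1+s)) {x k Y : ℝ} (hx1 : 1 < x) (hk : 0 < k)
    (hkV : k^2 ≤ c^2*(1 - s/(x^2-1)) - 1/(x^2-1)^2) (hY : 0 ≤ Y) :
    (x^2-1) * (ψ x * (exp (k*Y)/2))^2 ≤ ‖((x:ℂ) + Y * Complex.I)^2 - 1‖ * ‖f (x + Y * Complex.I)‖^2 := by
  have hg := vert_growth hY hk (fun y => h.line_dg hx1 y) (fun y => h.line_dg1 hχ hx1 y) (fun y => hkV.trans (reV_ge hs hx1 y)) (h.line_im0 x)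
  have h2 := pow_le_pow_left₀ (by positivity) hg 2
  have e0 : (x:ℂ) + (0:ℝ) * Complex.I = x := by simp
  unfold lineG at h2
  simp only [e0, h.real] at h2
  rw [norm_mul, norm_mul, mul_pow, mul_pow, mul_pow, norm_rt_sq (by simpa using hx1), norm_rt_sq (by simpa using hx1)] at h2
  have e1 : ‖(x:ℂ)^2-1‖ = x^2-1 := by
    rw [show (x:ℂ)^2-1 = ((x^2-1:ℝ):ℂ) by push_cast; ring, Complex.norm_real, norm_of_nonneg (by nlinarith)]
  rw [e1, Complex.norm_real, norm_eq_abs, sq_abs] at h2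
  calc _ = _ := by ring
    _ ≤ _ := h2
end

section
variable {c χ s : ℝ} {k : ℕ} {ψ : ℝ → ℝ} {lam : ℂ}

theorem ProlateDatum.ent_ne (h : ProlateDatum c k ψ lam χ) : ent c ψ lam ≠ 0 := by
  intro h0
  have h1 : ∀ x, ψ x = 0 := fun x => by
    have := h.code.real x
    rw [h0] at this
    simpa using this.symm
  have := h.normalized
  simp [h1] at this

theorem ProlateDatum.ent_ne_zero_quad (h : ProlateDatum c k ψ lam χ) (hc : 0 < c) (hs : 0 < s) (hχ : χ = c^2*(1+s))
    (hcs : 2 ≤ c^2*s^2) {x y : ℝ} (hx : 0 ≤ x) (hy : 0 < y) : ent c ψ lam (x + y * Complex.I) ≠ 0 := by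
  have hC := h.code
  have hne := h.ent_ne
  rcases le_or_gt x 1 with h1 | h1
  · exact hC.ne_zero_inner (by rw [hχ]; nlinarith [pow_pos hc 2, mul_pos (pow_pos hc 2) hs]) hne (by nlinarith) hy
  · rcases le_total (x^2) (1+s) with h2 | h2
    · refine hC.ne_zero_mid hne h1 ?_ hy
      have := h.rode.F_nonneg hχ h1.le h2
      exact nonneg_of_mul_nonneg_right this (by nlinarith)
    · exact hC.ne_zero_outer hne hs hχ hcs h1 h2 hy

theorem ProlateDatum.ent_ne_zero (h : ProlateDatum c k ψ lam χ) (hc : 0 < c) (hs : 0 < s) (hχ : χ = c^2*(1+s))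
    (hcs : 2 ≤ c^2*s^2) {z : ℂ} (hz : z.im ≠ 0) : ent c ψ lam z ≠ 0 := by
  have key : ∀ z : ℂ, 0 ≤ z.re → z.im ≠ 0 → ent c ψ lam z ≠ 0 := by
    intro z hr hi
    rcases lt_or_gt_of_ne hi with h1 | h1
    · have h2 := h.ent_ne_zero_quad hc hs hχ hcs hr (neg_pos.2 h1)
      have e : (z.re : ℂ) + ((-z.im : ℝ):ℂ) * Complex.I = starRingEnd ℂ z := by
        apply Complex.ext <;> simp
      rw [e, h.code.conj] at h2
      intro h3
      rw [h3] at h2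
      simp at h2
    · have h2 := h.ent_ne_zero_quad hc hs hχ hcs hr h1
      rwa [Complex.re_add_im] at h2
  rcases le_total 0 z.re with h1 | h1
  · exact key z h1 hz
  · obtain ⟨σ, _, hp, _⟩ := h.parity
    have h2 := key (-z) (by simpa using h1) (by simpa using hz)
    rw [hp] at h2
    exact right_ne_zero_of_mul h2

theorem norm_cexp_ict (c : ℝ) (z : ℂ) (t : ℝ) : ‖Complex.exp (Complex.I * c * z * t)‖ = exp (-(c * z.im * t)) := by
  rw [Complex.norm_exp]
  congr 1
  simp

/-- integration by parts in the integral representation -/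
theorem ProlateDatum.ibp (h : ProlateDatum c k ψ lam χ) (z : ℂ) :
    Complex.I * c * z * (lam * ent c ψ lam z) = (ψ 1 : ℂ) * Complex.exp (Complex.I * c * z) - (ψ (-1) : ℂ) * Complex.exp (-(Complex.I * c * z))
      - ∫ t in (-1:ℝ)..1, ((deriv ψ t : ℝ) : ℂ) * Complex.exp (Complex.I * c * z * t) := by
  have hE : ∀ t : ℝ, HasDerivAt (fun t : ℝ => Complex.exp (Complex.I * c * z * t)) (Complex.I * c * z * Complex.exp (Complex.I * c * z * t)) t := by
    intro t
    have h1 : HasDerivAt (fun t : ℝ => Complex.I * c * z * (t:ℂ)) (Complex.I * c * z) t := by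
      simpa using (Complex.ofRealCLM.hasDerivAt (x := t)).const_mul (Complex.I * c * z)
    refine h1.cexp.congr_deriv (by ring)
  have hcont : Continuous ψ := h.cont
  have hcont' : Continuous (deriv ψ) := h.rode.cont'
  have h1 := intervalIntegral.integral_mul_deriv_eq_deriv_mul (a := -1) (b := 1) (u := fun t => (ψ t : ℂ)) (v := fun t : ℝ => Complex.exp (Complex.I * c * z * t))
    (u' := fun t => ((deriv ψ t : ℝ) : ℂ)) (v' := fun t : ℝ => Complex.I * c * z * Complex.exp (Complex.I * c * z * t))
    (fun t _ => (h.rode.d1 t).ofReal_comp) (fun t _ => hE t)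
    (Continuous.intervalIntegrable (by fun_prop) _ _) (Continuous.intervalIntegrable (by fun_prop) _ _)
  have h2 : lam * ent c ψ lam z = ∫ t in (-1:ℝ)..1, (ψ t : ℂ) * Complex.exp (Complex.I * c * z * t) := by
    unfold ent
    rw [mul_inv_cancel_left₀ h.lam_ne_zero]
  rw [h2, ← intervalIntegral.integral_const_mul]
  have h3 : (fun t : ℝ => Complex.I * c * z * ((ψ t : ℂ) * Complex.exp (Complex.I * c * z * t))) = fun t : ℝ => (ψ t : ℂ) * (Complex.I * c * z * Complex.exp (Complex.I * c * z * t)) := by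
    funext t; ring
  rw [h3, h1]
  simp

theorem ProlateDatum.ibp_rem (h : ProlateDatum c k ψ lam χ) (hc : 0 < c) (hχ : c^2 < χ) {z : ℂ} (hz : 3*χ ≤ c * z.im) :
    ‖∫ t in (-1:ℝ)..1, ((deriv ψ t : ℝ) : ℂ) * Complex.exp (Complex.I * c * z * t)‖ ≤ |ψ 1| * exp (c * z.im) / 3 := by
  have hχ0 : 0 < χ := lt_of_le_of_lt (sq_nonneg c) hχ
  have hcont' : Continuous (deriv ψ) := h.rode.cont'
  have hb : ∀ t ∈ Ioc (-1:ℝ) 1, ‖((deriv ψ t : ℝ) : ℂ) * Complex.exp (Complex.I * c * z * t)‖ ≤ c * z.im / 3 * |ψ 1| * exp (-(c * z.im * t)) := by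
    intro t ht
    rw [norm_mul, norm_cexp_ict, Complex.norm_real, norm_eq_abs]
    exact mul_le_mul_of_nonneg_right ((h.deriv_le hχ ⟨ht.1.le, ht.2⟩).trans (mul_le_mul_of_nonneg_right (by linarith) (abs_nonneg _))) (exp_pos _).le
  have h1 := intervalIntegral.norm_integral_le_of_norm_le (μ := volume) (a := -1) (b := 1) (by norm_num) (Filter.Eventually.of_forall hb)
    (Continuous.intervalIntegrable (by fun_prop) _ _)
  refine h1.trans ?_
  have hF : ∀ t ∈ uIcc (-1:ℝ) 1, HasDerivAt (fun t => -(|ψ 1| / 3 * exp (-(c * z.im * t)))) (c * z.im / 3 * |ψ 1| * exp (-(c * z.im * t))) t := by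
    intro t _
    have h2 : HasDerivAt (fun t => -(c*z.im*t)) (-(c*z.im)) t := ((hasDerivAt_id t).const_mul (c*z.im)).neg.congr_deriv (by ring)
    refine ((h2.exp.const_mul (|ψ 1| / 3)).neg).congr_deriv ?_
    ring
  rw [intervalIntegral.integral_eq_sub_of_hasDerivAt hF (Continuous.intervalIntegrable (by fun_prop) _ _)]
  have := exp_pos (-(c * z.im * 1))
  have h0 := abs_nonneg (ψ 1)
  rw [show -(c * z.im * -1) = c * z.im by ring]
  nlinarith

theorem ProlateDatum.ibp_bounds (h : ProlateDatum c k ψ lam χ) (hc : 1 ≤ c) (hχ : c^2 < χ) {z : ℂ} (hz : 3*χ ≤ c * z.im) :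
    0.66 * (|ψ 1| * exp (c * z.im)) ≤ c * ‖z‖ * ‖lam‖ * ‖ent c ψ lam z‖ ∧
    c * ‖z‖ * ‖lam‖ * ‖ent c ψ lam z‖ ≤ 1.34 * (|ψ 1| * exp (c * z.im)) := by
  have hI := h.ibp z
  have hr := h.ibp_rem (by linarith) hχ hz
  have hn : ‖Complex.I * c * z * (lam * ent c ψ lam z)‖ = c * ‖z‖ * ‖lam‖ * ‖ent c ψ lam z‖ := by
    rw [norm_mul, norm_mul, norm_mul, norm_mul, Complex.norm_I, Complex.norm_real, norm_of_nonneg (by linarith)]; ring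
  have h1 : ‖(ψ 1 : ℂ) * Complex.exp (Complex.I * c * z)‖ = |ψ 1| * exp (-(c * z.im)) := by
    have := norm_cexp_ict c z 1
    simp only [Complex.ofReal_one, mul_one] at this
    rw [norm_mul, this, Complex.norm_real, norm_eq_abs]
  have h2 : ‖(ψ (-1) : ℂ) * Complex.exp (-(Complex.I * c * z))‖ = |ψ 1| * exp (c * z.im) := by
    have := norm_cexp_ict c z (-1)
    simp only [Complex.ofReal_neg, Complex.ofReal_one, mul_neg, mul_one, neg_neg] at this
    rw [norm_mul, this, Complex.norm_real, norm_eq_abs, h.abs_parity 1]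
  set A := (ψ 1 : ℂ) * Complex.exp (Complex.I * c * z)
  set B := (ψ (-1) : ℂ) * Complex.exp (-(Complex.I * c * z))
  set C := ∫ t in (-1:ℝ)..1, ((deriv ψ t : ℝ) : ℂ) * Complex.exp (Complex.I * c * z * t)
  rw [← hn, hI]
  have hsm : exp (-(c*z.im)) ≤ 0.005 * exp (c*z.im) := by
    have hge : 3 ≤ c * z.im := by nlinarith
    have e : exp (-(c*z.im)) = exp (-(2*(c*z.im))) * exp (c*z.im) := by rw [← exp_add]; ring_nf
    rw [e]
    apply mul_le_mul_of_nonneg_right _ (exp_pos _).le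
    have h6 : exp (-(2*(c*z.im))) ≤ exp (-6) := exp_le_exp.2 (by linarith)
    have h7 : exp (-6) ≤ (0.005:ℝ) := by
      rw [exp_neg, show (6:ℝ) = ((6:ℕ):ℝ) * 1 by norm_num, exp_nat_mul]
      have h8 : (2.7:ℝ)^6 ≤ exp 1^6 := pow_le_pow_left₀ (by norm_num) (by have := exp_one_gt_d9; linarith) 6
      calc (exp 1^6)⁻¹ ≤ ((2.7:ℝ)^6)⁻¹ := inv_anti₀ (by norm_num) h8
        _ ≤ 0.005 := by norm_num
    linarith
  have h3 := mul_le_mul_of_nonneg_left hsm (abs_nonneg (ψ 1))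
  set T := |ψ 1| * exp (c*z.im)
  have hT : 0 ≤ T := mul_nonneg (abs_nonneg _) (exp_pos _).le
  constructor
  · have a1 : ‖B‖ ≤ ‖A - B - C‖ + ‖A‖ + ‖C‖ := by
      have : B = -(A - B - C) + A + -C := by ring
      calc ‖B‖ = ‖-(A - B - C) + A + -C‖ := by rw [← this]
        _ ≤ ‖-(A - B - C)‖ + ‖A‖ + ‖-C‖ := norm_add₃_le
        _ = _ := by rw [norm_neg, norm_neg]
    linarith
  · have a1 : ‖A - B - C‖ ≤ ‖A‖ + ‖B‖ + ‖C‖ := (norm_sub_le _ _).trans (by linarith [norm_sub_le A B])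
    linarith

/-- lower bound for `ψ_n` on the whole contour -/
theorem ProlateDatum.contour_lower (h : ProlateDatum c k ψ lam χ) (hc : 1 ≤ c) (hs : 0 < s) (hχ : χ = c^2*(1+s))
    {X Y κ : ℝ} (hX : 1 < X) (hY : c*Y = 3*χ) (hκ : 0 < κ) (hκc : κ ≤ c)
    (hκV : κ^2 ≤ c^2*(1 - s/(X^2-1)) - 1/(X^2-1)^2) {z : ℂ}
    (hz : (|z.re| = X ∧ |z.im| ≤ Y) ∨ (|z.re| ≤ X ∧ |z.im| = Y)) :
    0.24 * (√((X^2-1)/(X^2+Y^2+1)) * |ψ X| * exp (-((c-κ)*Y))) * exp (c*|z.im|) ≤ ‖ent c ψ lam z‖ := by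
  have hχc : c^2 < χ := by rw [hχ]; have := mul_pos (pow_pos (by linarith : 0 < c) 2) hs; linarith
  have hc0 : 0 < c := by linarith
  have hY0 : 0 < Y := by
    have : 0 < c*Y := by rw [hY]; linarith [sq_nonneg c]
    exact pos_of_mul_pos_right this hc0.le
  have hXp : 0 < X^2-1 := by nlinarith
  have hDp : 0 < X^2+Y^2+1 := by positivity
  set q := √((X^2-1)/(X^2+Y^2+1)) with hq
  have hq2 : q^2 = (X^2-1)/(X^2+Y^2+1) := sq_sqrt (by positivity)
  have hq0 : 0 ≤ q := sqrt_nonneg _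
  set f := ent c ψ lam with hf
  -- symmetry reduction
  have hsym : ∀ z : ℂ, ‖f z‖ = ‖f (|z.re| + |z.im| * Complex.I)‖ := by
    intro z
    obtain ⟨σ, hσ, hp, _⟩ := h.parity
    have n1 : ∀ w, ‖f (-w)‖ = ‖f w‖ := fun w => by
      rw [hf, hp w, norm_mul, Complex.norm_real]
      rcases hσ with rfl | rfl <;> simp
    have n2 : ∀ w, ‖f (starRingEnd ℂ w)‖ = ‖f w‖ := fun w => by
      rw [hf, h.code.conj, Complex.norm_conj]
    rcases abs_choice z.re with a | a <;> rcases abs_choice z.im with b | b <;> rw [a, b]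
    · rw [Complex.re_add_im]
    · rw [← n2 z]; congr 2; apply Complex.ext <;> simp
    · rw [← n2 z, ← n1]; congr 2; apply Complex.ext <;> simp
    · rw [← n1 z]; congr 2; apply Complex.ext <;> simp
  have hvert : ∀ y, 0 ≤ y → y ≤ Y → (q * |ψ X| * exp (-((c-κ)*Y))) * exp (c*y) / 2 ≤ ‖f (X + y * Complex.I)‖ := by
    intro y hy hyY
    have h1 := h.code.vert_lower hs hχ hX hκ hκV hy
    have h2 : ‖((X:ℂ) + y * Complex.I)^2 - 1‖ ≤ X^2+Y^2+1 := by
      refine (norm_sub_le _ _).trans ?_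
      rw [norm_pow, norm_one, ← Complex.normSq_eq_norm_sq]
      simp [Complex.normSq_apply]
      nlinarith
    have h3 : (q * (|ψ X| * (exp (κ*y)/2)))^2 ≤ ‖f (X + y * Complex.I)‖^2 := by
      rw [mul_pow, hq2, div_mul_eq_mul_div, div_le_iff₀ hDp]
      calc _ = (X^2-1) * (ψ X * (exp (κ*y)/2))^2 := by rw [mul_pow |ψ X|, sq_abs]; ring
        _ ≤ _ := h1
        _ ≤ _ := by rw [mul_comm]; exact mul_le_mul_of_nonneg_left h2 (sq_nonneg _)
    have h4 := le_of_sq_le_sq h3 (norm_nonneg _)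
    refine le_trans ?_ h4
    have h5 : exp (-((c-κ)*Y)) * exp (c*y) ≤ exp (κ*y) := by
      rw [← exp_add]; exact exp_le_exp.2 (by nlinarith)
    have h6 := mul_le_mul_of_nonneg_left h5 (mul_nonneg hq0 (abs_nonneg (ψ X)))
    calc _ = q * |ψ X| * (exp (-((c-κ)*Y)) * exp (c*y)) / 2 := by ring
      _ ≤ q * |ψ X| * exp (κ*y) / 2 := by linarith
      _ = _ := by ring
  have hE : 0 ≤ q * |ψ X| * exp (-((c-κ)*Y)) := by positivity
  rw [hsym z]
  rcases hz with ⟨h1, h2⟩ | ⟨h1, h2⟩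
  · rw [h1]
    have := hvert _ (abs_nonneg z.im) h2
    have := mul_nonneg hE (exp_pos (c*|z.im|)).le
    linarith
  · rw [h2]
    set w : ℂ := |z.re| + Y * Complex.I with hw
    set w1 : ℂ := X + Y * Complex.I with hw1
    have b1 := (h.ibp_bounds (z := w) hc hχc (by simpa [hw] using hY.ge)).1
    have b2 := (h.ibp_bounds (z := w1) hc hχc (by simpa [hw1] using hY.ge)).2
    have i1 : w.im = Y := by simp [hw]
    have i2 : w1.im = Y := by simp [hw1]
    rw [i1] at b1
    rw [i2] at b2
    have hv := hvert Y hY0.le le_rfl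
    have hww : ‖w‖ ≤ ‖w1‖ := by
      apply le_of_sq_le_sq _ (norm_nonneg _)
      rw [← Complex.normSq_eq_norm_sq, ← Complex.normSq_eq_norm_sq]
      simp only [Complex.normSq_apply, i1, i2]
      have : w.re = |z.re| := by simp [hw]
      have : w1.re = X := by simp [hw1]
      nlinarith [abs_nonneg z.re]
    have hl : 0 < ‖lam‖ := norm_pos_iff.2 h.lam_ne_zero
    have hw1p : 0 < ‖w1‖ := norm_pos_iff.2 (fun h0 => by rw [h0] at i2; simp at i2; linarith)
    change ‖f w1‖ ≥ _ at hv
    have b3 : 0.66 * (c * ‖w1‖ * ‖lam‖ * ‖f w1‖) ≤ 1.34 * (c * ‖w1‖ * ‖lam‖ * ‖f w‖) := by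
      have : c * ‖w‖ * ‖lam‖ * ‖f w‖ ≤ c * ‖w1‖ * ‖lam‖ * ‖f w‖ := by gcongr
      linarith
    have b4 : 0.66 * ‖f w1‖ ≤ 1.34 * ‖f w‖ := by
      have hp : 0 < c * ‖w1‖ * ‖lam‖ := by positivity
      nlinarith
    have := mul_nonneg hE (exp_pos (c*Y)).le
    linarith
end

/-- boundary integral over the rectangle `[-X,X] × [-Y,Y]` -/
noncomputable def rectInt (X Y : ℝ) (F : ℂ → ℂ) : ℂ :=
  (∫ x in (-X)..X, F (x + ((-Y:ℝ):ℂ) * Complex.I)) - (∫ x in (-X)..X, F (x + (Y:ℂ) * Complex.I)) +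
    Complex.I * (∫ y in (-Y)..Y, F ((X:ℂ) + y * Complex.I)) - Complex.I * (∫ y in (-Y)..Y, F (((-X:ℝ):ℂ) + y * Complex.I))

/-- boundary of the rectangle -/
def rectBd (X Y : ℝ) : Set ℂ := {z | (|z.re| = X ∧ |z.im| ≤ Y) ∨ (|z.re| ≤ X ∧ |z.im| = Y)}

section
variable {X Y : ℝ}

theorem rectBd_h (hY : 0 < Y) {x y : ℝ} (hx : x ∈ Icc (-X) X) (hy : |y| = Y) : (x:ℂ) + (y:ℂ) * Complex.I ∈ rectBd X Y := by
  right; simp [abs_le.2 hx, hy]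

theorem rectBd_v (hX : 0 < X) {x y : ℝ} (hy : y ∈ Icc (-Y) Y) (hx : |x| = X) : (x:ℂ) + (y:ℂ) * Complex.I ∈ rectBd X Y := by
  left; simp [abs_le.2 hy, hx]

theorem bd_int_h (hX : 0 < X) (hY : 0 < Y) {F : ℂ → ℂ} (hF : ContinuousOn F (rectBd X Y)) {y : ℝ} (hy : |y| = Y) :
    ContinuousOn (fun x : ℝ => F (x + (y:ℂ) * Complex.I)) (uIcc (-X) X) := by
  refine hF.comp (by fun_prop) (fun x hx => ?_)
  rw [uIcc_of_le (by linarith)] at hx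
  exact rectBd_h hY hx hy

theorem bd_int_v (hX : 0 < X) (hY : 0 < Y) {F : ℂ → ℂ} (hF : ContinuousOn F (rectBd X Y)) {x : ℝ} (hx : |x| = X) :
    ContinuousOn (fun y : ℝ => F ((x:ℂ) + y * Complex.I)) (uIcc (-Y) Y) := by
  refine hF.comp (by fun_prop) (fun y hy => ?_)
  rw [uIcc_of_le (by linarith)] at hy
  exact rectBd_v hX hy hx

theorem rectInt_add (hX : 0 < X) (hY : 0 < Y) {F G : ℂ → ℂ} (hF : ContinuousOn F (rectBd X Y)) (hG : ContinuousOn G (rectBd X Y)) :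
    rectInt X Y (fun z => F z + G z) = rectInt X Y F + rectInt X Y G := by
  have a1 : |-Y| = Y := by rw [abs_neg, abs_of_pos hY]
  have a2 : |Y| = Y := abs_of_pos hY
  have a3 : |-X| = X := by rw [abs_neg, abs_of_pos hX]
  have a4 : |X| = X := abs_of_pos hX
  unfold rectInt
  rw [intervalIntegral.integral_add (bd_int_h hX hY hF a1).intervalIntegrable (bd_int_h hX hY hG a1).intervalIntegrable,
    intervalIntegral.integral_add (bd_int_h hX hY hF a2).intervalIntegrable (bd_int_h hX hY hG a2).intervalIntegrable,
    intervalIntegral.integral_add (bd_int_v hX hY hF a3).intervalIntegrable (bd_int_v hX hY hG a3).intervalIntegrable,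
    intervalIntegral.integral_add (bd_int_v hX hY hF a4).intervalIntegrable (bd_int_v hX hY hG a4).intervalIntegrable]
  ring

theorem rectInt_const_mul (a : ℂ) (F : ℂ → ℂ) : rectInt X Y (fun z => a * F z) = a * rectInt X Y F := by
  unfold rectInt
  simp only [intervalIntegral.integral_const_mul]
  ring

theorem rectInt_congr (hX : 0 < X) (hY : 0 < Y) {F G : ℂ → ℂ} (h : ∀ z ∈ rectBd X Y, F z = G z) : rectInt X Y F = rectInt X Y G := by
  have a1 : |-Y| = Y := by rw [abs_neg, abs_of_pos hY]
  have a2 : |Y| = Y := abs_of_pos hY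
  have a3 : |-X| = X := by rw [abs_neg, abs_of_pos hX]
  have a4 : |X| = X := abs_of_pos hX
  have uX : uIcc (-X) X = Icc (-X) X := uIcc_of_le (by linarith)
  have uY : uIcc (-Y) Y = Icc (-Y) Y := uIcc_of_le (by linarith)
  unfold rectInt
  congr 1
  · congr 1
    · congr 1
      · exact intervalIntegral.integral_congr fun x hx => h _ (rectBd_h hY (uX ▸ hx) a1)
      · exact intervalIntegral.integral_congr fun x hx => h _ (rectBd_h hY (uX ▸ hx) a2)
    · congr 1
      exact intervalIntegral.integral_congr fun x hx => h _ (rectBd_v hX (uY ▸ hx) a4)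
  · congr 1
    exact intervalIntegral.integral_congr fun x hx => h _ (rectBd_v hX (uY ▸ hx) a3)

theorem rectInt_zero (hX : 0 < X) (hY : 0 < Y) {F : ℂ → ℂ} (hF : ∀ z : ℂ, |z.re| ≤ X → |z.im| ≤ Y → DifferentiableAt ℂ F z) : rectInt X Y F = 0 := by
  have := Complex.integral_boundary_rect_eq_zero_of_differentiableOn F (⟨-X, -Y⟩ : ℂ) ⟨X, Y⟩ (fun z hz => by
    rw [Complex.mem_reProdIm] at hz
    simp only [uIcc_of_le (by linarith : -X ≤ X), uIcc_of_le (by linarith : -Y ≤ Y)] at hz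
    exact (hF z (abs_le.2 hz.1) (abs_le.2 hz.2)).differentiableWithinAt)
  simp only [smul_eq_mul] at this
  exact this

theorem norm_rectInt_le (hX : 0 < X) (hY : 0 < Y) {F : ℂ → ℂ} {C : ℝ} (hF : ∀ z ∈ rectBd X Y, ‖F z‖ ≤ C) :
    ‖rectInt X Y F‖ ≤ C * (4*X + 4*Y) := by
  have a1 : |-Y| = Y := by rw [abs_neg, abs_of_pos hY]
  have a2 : |Y| = Y := abs_of_pos hY
  have a3 : |-X| = X := by rw [abs_neg, abs_of_pos hX]
  have a4 : |X| = X := abs_of_pos hX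
  have uX : uIoc (-X) X = Ioc (-X) X := uIoc_of_le (by linarith)
  have uY : uIoc (-Y) Y = Ioc (-Y) Y := uIoc_of_le (by linarith)
  have hh : ∀ y : ℝ, |y| = Y → ‖∫ x in (-X)..X, F (x + (y:ℂ) * Complex.I)‖ ≤ C * (2*X) := by
    intro y hy
    have := intervalIntegral.norm_integral_le_of_norm_le_const (a := -X) (b := X) (C := C) (f := fun x : ℝ => F (x + (y:ℂ) * Complex.I))
      (fun x hx => hF _ (rectBd_h hY (Ioc_subset_Icc_self (uX ▸ hx)) hy))
    rwa [show X - -X = 2*X by ring, abs_of_pos (by linarith)] at this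
  have hv : ∀ x : ℝ, |x| = X → ‖Complex.I * ∫ y in (-Y)..Y, F ((x:ℂ) + y * Complex.I)‖ ≤ C * (2*Y) := by
    intro x hx
    have := intervalIntegral.norm_integral_le_of_norm_le_const (a := -Y) (b := Y) (C := C) (f := fun y : ℝ => F ((x:ℂ) + y * Complex.I))
      (fun y hy => hF _ (rectBd_v hX (Ioc_subset_Icc_self (uY ▸ hy)) hx))
    rw [show Y - -Y = 2*Y by ring, abs_of_pos (by linarith)] at this
    rwa [norm_mul, Complex.norm_I, one_mul]
  unfold rectInt
  have e1 := hh _ a1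
  have e2 := hh _ a2
  have e3 := hv _ a3
  have e4 := hv _ a4
  refine (norm_sub_le _ _).trans ?_
  refine (add_le_add_left ((norm_add_le _ _).trans (add_le_add_left (norm_sub_le _ _) _)) _).trans ?_
  linarith

theorem rectInt_inv (hX : 0 < X) (hY : 0 < Y) {t : ℝ} (ht : t ∈ Ioo (-X) X) :
    rectInt X Y (fun z => (z - t)⁻¹) = 2 * π * Complex.I := by
  have h1 : ∀ a b : ℝ, (((a:ℂ) + b * Complex.I))⁻¹ = ((a/(a^2+b^2) : ℝ) : ℂ) - ((b/(a^2+b^2) : ℝ):ℂ) * Complex.I := by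
    intro a b
    generalize hp : a/(a^2+b^2) = p
    generalize hq : b/(a^2+b^2) = q
    apply Complex.ext
    · simp [Complex.inv_re, Complex.normSq_apply]
      rw [← hp, pow_two, pow_two]
    · simp [Complex.inv_im, Complex.normSq_apply, neg_div]
      rw [← hq, pow_two, pow_two]
  have hne : ∀ x : ℝ, (x - t)^2 + Y^2 ≠ 0 := fun x => by positivity
  -- horizontal
  have H : (∫ x in (-X)..X, ((x:ℂ) + ((-Y:ℝ):ℂ) * Complex.I - t)⁻¹) - (∫ x in (-X)..X, ((x:ℂ) + (Y:ℂ) * Complex.I - t)⁻¹) =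
      ((2 * (arctan ((X-t)/Y) + arctan ((X+t)/Y)) : ℝ) : ℂ) * Complex.I := by
    have c1 : ∀ y : ℝ, y^2 = Y^2 → IntervalIntegrable (fun x : ℝ => ((x:ℂ) + (y:ℂ) * Complex.I - t)⁻¹) volume (-X) X := by
      intro y hy
      apply Continuous.intervalIntegrable
      apply Continuous.inv₀ (by fun_prop)
      intro x h0
      have := congrArg Complex.im h0
      simp at this
      rw [this] at hy
      nlinarith
    rw [← intervalIntegral.integral_sub (c1 (-Y) (by ring)) (c1 Y rfl)]
    have e : ∀ x : ℝ, ((x:ℂ) + ((-Y:ℝ):ℂ) * Complex.I - t)⁻¹ - ((x:ℂ) + (Y:ℂ) * Complex.I - t)⁻¹ = ((2*Y/((x-t)^2+Y^2) : ℝ):ℂ) * Complex.I := by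
      intro x
      rw [show (x:ℂ) + ((-Y:ℝ):ℂ) * Complex.I - t = ((x-t:ℝ):ℂ) + ((-Y:ℝ):ℂ)*Complex.I by push_cast; ring,
        show (x:ℂ) + (Y:ℂ) * Complex.I - t = ((x-t:ℝ):ℂ) + (Y:ℂ)*Complex.I by push_cast; ring, h1, h1]
      rw [show (-Y)^2 = Y^2 by ring]
      push_cast
      ring
    simp_rw [e]
    rw [intervalIntegral.integral_mul_const, intervalIntegral.integral_ofReal]
    congr 2
    have hd : ∀ x ∈ uIcc (-X) X, HasDerivAt (fun x => 2 * arctan ((x-t)/Y)) (2*Y/((x-t)^2+Y^2)) x := by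
      intro x _
      have := ((((hasDerivAt_id x).sub_const t).div_const Y).arctan).const_mul 2
      refine this.congr_deriv ?_
      have := hne x
      simp only [id]
      field_simp
      ring
    rw [intervalIntegral.integral_eq_sub_of_hasDerivAt hd (Continuous.intervalIntegrable (by
      apply Continuous.div (by fun_prop) (by fun_prop) hne) _ _)]
    rw [show (-X-t)/Y = -((X+t)/Y) by ring, arctan_neg]
    ring
  -- vertical
  have Vv : ∀ a : ℝ, a ≠ 0 → (∫ y in (-Y)..Y, ((a:ℂ) + (y:ℂ) * Complex.I)⁻¹) = ((2 * arctan (Y/a) : ℝ) : ℂ) := by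
    intro a ha
    have hne : ∀ y : ℝ, a^2 + y^2 ≠ 0 := fun x => by positivity
    simp_rw [h1]
    have i1 : Continuous (fun y : ℝ => a/(a^2+y^2)) := Continuous.div (by fun_prop) (by fun_prop) hne
    have i2 : Continuous (fun y : ℝ => y/(a^2+y^2)) := Continuous.div (by fun_prop) (by fun_prop) hne
    rw [intervalIntegral.integral_sub (Continuous.intervalIntegrable (by fun_prop) _ _) (Continuous.intervalIntegrable (by fun_prop) _ _),
      intervalIntegral.integral_mul_const, intervalIntegral.integral_ofReal, intervalIntegral.integral_ofReal]
    have hodd : (∫ y in (-Y)..Y, y/(a^2+y^2)) = 0 := by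
      have := intervalIntegral.integral_comp_neg (a := -Y) (b := Y) (fun y => y/(a^2+y^2))
      simp only [neg_neg] at this
      have e : (fun y => -y/(a^2+(-y)^2)) = fun y => -(y/(a^2+y^2)) := by funext y; rw [neg_sq, neg_div]
      rw [e, intervalIntegral.integral_neg] at this
      linarith
    rw [hodd]
    have hd : ∀ x ∈ uIcc (-Y) Y, HasDerivAt (fun y => arctan (y/a)) (a/(a^2+x^2)) x := by
      intro x _
      have := ((hasDerivAt_id x).div_const a).arctan
      refine this.congr_deriv ?_
      have := hne x
      simp only [id]
      field_simp
    rw [intervalIntegral.integral_eq_sub_of_hasDerivAt hd (i1.intervalIntegrable _ _), neg_div, arctan_neg]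
    push_cast
    ring
  have hr : (∫ y in (-Y)..Y, ((X:ℂ) + (y:ℂ) * Complex.I - t)⁻¹) = ((2 * arctan (Y/(X-t)) : ℝ) : ℂ) := by
    rw [← Vv (X-t) (by linarith [ht.2])]
    apply intervalIntegral.integral_congr
    intro y _
    simp only
    congr 1; push_cast; ring
  have hl : (∫ y in (-Y)..Y, (((-X:ℝ):ℂ) + (y:ℂ) * Complex.I - t)⁻¹) = ((2 * arctan (Y/(-X-t)) : ℝ) : ℂ) := by
    rw [← Vv (-X-t) (by linarith [ht.1])]
    apply intervalIntegral.integral_congr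
    intro y _
    simp only
    congr 1; push_cast; ring
  unfold rectInt
  rw [H, hr, hl, show Y/(-X-t) = -(Y/(X+t)) by rw [← div_neg]; congr 1; ring, arctan_neg]
  have p1 : arctan (Y/(X-t)) = π/2 - arctan ((X-t)/Y) := by
    rw [← arctan_inv_of_pos (div_pos (by linarith [ht.2]) hY), inv_div]
  have p2 : arctan (Y/(X+t)) = π/2 - arctan ((X+t)/Y) := by
    rw [← arctan_inv_of_pos (div_pos (by linarith [ht.1]) hY), inv_div]
  rw [p1, p2]
  push_cast
  ring

theorem real_not_bd (hY : 0 < Y) {w : ℝ} (hw : w ∈ Ioo (-X) X) {z : ℂ} (hz : z ∈ rectBd X Y) : z - w ≠ 0 := by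
  intro h0
  have : z = w := sub_eq_zero.1 h0
  rw [this] at hz
  rcases hz with ⟨h1, _⟩ | ⟨_, h2⟩
  · simp only [Complex.ofReal_re] at h1
    have := abs_lt.2 hw
    linarith
  · simp at h2; linarith

/-- residue theorem for simple real poles -/
theorem rect_residue (hX : 0 < X) (hY : 0 < Y) (Z : Finset ℝ) : ∀ (f g : ℂ → ℂ), Differentiable ℂ f → Differentiable ℂ g →
    (∀ w ∈ Z, w ∈ Ioo (-X) X) → (∀ w ∈ Z, f w = 0 ∧ deriv f w ≠ 0) →
    (∀ z : ℂ, |z.re| ≤ X → |z.im| ≤ Y → f z = 0 → ∃ w ∈ Z, z = (w:ℝ)) →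
    rectInt X Y (fun z => g z / f z) = 2 * π * Complex.I * ∑ w ∈ Z, g w / deriv f w := by
  induction Z using Finset.induction_on with
  | empty =>
    intro f g hf hg _ _ hz
    rw [Finset.sum_empty, mul_zero]
    apply rectInt_zero hX hY
    intro z h1 h2
    exact (hg z).div (hf z) (fun h0 => by obtain ⟨w, hw, _⟩ := hz z h1 h2 h0; simp at hw)
  | insert w Z hwZ ih =>
    intro f g hf hg hin hsimp hz
    have hw := hin w (Finset.mem_insert_self _ _)
    obtain ⟨hfw, hfw'⟩ := hsimp w (Finset.mem_insert_self _ _)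
    set f1 := dslope f (w:ℂ) with hf1
    have hf1d : Differentiable ℂ f1 := by
      rw [← differentiableOn_univ, hf1, Complex.differentiableOn_dslope Filter.univ_mem, differentiableOn_univ]; exact hf
    have hff : ∀ z, f z = (z - w) * f1 z := by
      intro z
      have := sub_smul_dslope f (w:ℂ) z
      rw [smul_eq_mul, hfw, sub_zero] at this
      exact this.symm
    have hf1w : f1 w = deriv f w := dslope_same _ _
    have hf1w0 : f1 w ≠ 0 := by rw [hf1w]; exact hfw'
    set a := g w / f1 w with ha
    set gg : ℂ → ℂ := fun z => g z - a * f1 z with hgg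
    have hggd : Differentiable ℂ gg := hg.sub (hf1d.const_mul a)
    set g1 := dslope gg (w:ℂ) with hg1
    have hg1d : Differentiable ℂ g1 := by
      rw [← differentiableOn_univ, hg1, Complex.differentiableOn_dslope Filter.univ_mem, differentiableOn_univ]; exact hggd
    have hggw : gg w = 0 := by simp only [hgg, ha]; rw [div_mul_cancel₀ _ hf1w0, sub_self]
    have hgg1 : ∀ z, g z = a * f1 z + (z - w) * g1 z := by
      intro z
      have := sub_smul_dslope gg (w:ℂ) z
      rw [smul_eq_mul, hggw, sub_zero] at this
      simp only [hgg] at this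
      linear_combination -this
    have hderiv : ∀ z, deriv f z = f1 z + (z - w) * deriv f1 z := by
      intro z
      have h1 : HasDerivAt (fun z => (z - w) * f1 z) (1 * f1 z + (z - w) * deriv f1 z) z :=
        ((hasDerivAt_id z).sub_const (w:ℂ)).mul (hf1d z).hasDerivAt
      have h2 : f = fun z => (z - w) * f1 z := funext hff
      rw [h2, h1.deriv, one_mul]
    have hZw : ∀ v ∈ Z, (v:ℂ) - w ≠ 0 := by
      intro v hv h0
      have : v = w := by exact_mod_cast sub_eq_zero.1 h0
      exact hwZ (this ▸ hv)
    have hZ0 : ∀ v ∈ Z, f1 v = 0 := by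
      intro v hv
      have h1 := (hsimp v (Finset.mem_insert_of_mem hv)).1
      rw [hff] at h1
      exact (mul_eq_zero.1 h1).resolve_left (hZw v hv)
    have hih := ih f1 g1 hf1d hg1d (fun v hv => hin v (Finset.mem_insert_of_mem hv)) (fun v hv => ⟨hZ0 v hv, fun h0 => by
        have h1 := (hsimp v (Finset.mem_insert_of_mem hv)).2
        rw [hderiv, hZ0 v hv, h0] at h1
        simp at h1⟩) (fun z h1 h2 h3 => by
        obtain ⟨v, hv, hzv⟩ := hz z h1 h2 (by rw [hff, h3, mul_zero])
        rcases Finset.mem_insert.1 hv with h4 | h4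
        · rw [hzv, h4] at h3; exact absurd h3 hf1w0
        · exact ⟨v, h4, hzv⟩)
    have hbd1 : ∀ z ∈ rectBd X Y, f1 z ≠ 0 := by
      intro z hzb h0
      have h12 : |z.re| ≤ X ∧ |z.im| ≤ Y := by
        rcases hzb with ⟨h1, h2⟩ | ⟨h1, h2⟩
        · exact ⟨h1.le, h2⟩
        · exact ⟨h1, h2.le⟩
      obtain ⟨v, hv, hzv⟩ := hz z h12.1 h12.2 (by rw [hff, h0, mul_zero])
      exact real_not_bd hY (hin v hv) hzb (by rw [hzv, sub_self])
    rw [rectInt_congr hX hY (G := fun z => a * (z - w)⁻¹ + g1 z / f1 z) (fun z hzb => by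
      have h1 := hbd1 z hzb
      have h2 := real_not_bd hY hw hzb
      rw [hff, hgg1 z]
      field_simp)]
    rw [rectInt_add hX hY (F := fun z => a * (z - w)⁻¹) (G := fun z => g1 z / f1 z)
      (fun z hzb => ContinuousAt.continuousWithinAt (ContinuousAt.mul continuousAt_const (ContinuousAt.inv₀ (f := fun z : ℂ => z - (w:ℂ)) (by fun_prop) (real_not_bd hY hw hzb))))
      (fun z hzb => ((hg1d z).continuousAt.div (hf1d z).continuousAt (hbd1 z hzb)).continuousWithinAt),
      rectInt_const_mul, rectInt_inv hX hY hw, hih, Finset.sum_insert hwZ, ha, hf1w]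
    have hs : ∑ v ∈ Z, g1 v / deriv f1 v = ∑ v ∈ Z, g v / deriv f v := by
      apply Finset.sum_congr rfl
      intro v hv
      rw [hgg1 v, hderiv v, hZ0 v hv, mul_zero, zero_add, zero_add, mul_div_mul_left _ _ (hZw v hv)]
    rw [hs]
    ring
end

theorem swap_cont {a b a' b' : ℝ} (hab : a ≤ b) (hab' : a' ≤ b') {f : ℝ → ℝ → ℂ}
    (hf : ContinuousOn (Function.uncurry f) (Icc a b ×ˢ Icc a' b')) :
    ∫ x in a..b, ∫ y in a'..b', f x y = ∫ y in a'..b', ∫ x in a..b, f x y := by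
  simp only [intervalIntegral.integral_of_le hab, intervalIntegral.integral_of_le hab']
  apply integral_integral_swap
  rw [Measure.prod_restrict]
  have h1 : IntegrableOn (Function.uncurry f) (Icc a b ×ˢ Icc a' b') (volume.prod volume) :=
    hf.integrableOn_compact (isCompact_Icc.prod isCompact_Icc)
  exact h1.mono_set (prod_mono Ioc_subset_Icc_self Ioc_subset_Icc_self)

section
variable {X Y : ℝ}

/-- Fubini for the contour -/
theorem rectInt_swap (hX : 0 < X) (hY : 0 < Y) {K : ℝ → ℂ → ℂ} (hK : ContinuousOn (Function.uncurry K) (Icc (-1:ℝ) 1 ×ˢ rectBd X Y)) :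
    IntervalIntegrable (fun t => rectInt X Y (K t)) volume (-1) 1 ∧ ∫ t in (-1:ℝ)..1, rectInt X Y (K t) = rectInt X Y (fun z => ∫ t in (-1:ℝ)..1, K t z) := by
  have a1 : |-Y| = Y := by rw [abs_neg, abs_of_pos hY]
  have a2 : |Y| = Y := abs_of_pos hY
  have a3 : |-X| = X := by rw [abs_neg, abs_of_pos hX]
  have a4 : |X| = X := abs_of_pos hX
  have ch : ∀ y : ℝ, |y| = Y → ContinuousOn (Function.uncurry fun (t x : ℝ) => K t (x + (y:ℂ) * Complex.I)) (Icc (-1:ℝ) 1 ×ˢ Icc (-X) X) := by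
    intro y hy
    exact hK.comp (f := fun p : ℝ × ℝ => (p.1, (p.2:ℂ) + (y:ℂ) * Complex.I)) (by fun_prop) (fun p hp => ⟨hp.1, rectBd_h hY hp.2 hy⟩)
  have cv : ∀ x : ℝ, |x| = X → ContinuousOn (Function.uncurry fun (t y : ℝ) => K t ((x:ℂ) + (y:ℂ) * Complex.I)) (Icc (-1:ℝ) 1 ×ˢ Icc (-Y) Y) := by
    intro x hx
    exact hK.comp (f := fun p : ℝ × ℝ => (p.1, (x:ℂ) + (p.2:ℂ) * Complex.I)) (by fun_prop) (fun p hp => ⟨hp.1, rectBd_v hX hp.2 hx⟩)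
  have ii : ∀ {a b : ℝ} (_ : a ≤ b) {f : ℝ → ℝ → ℂ}, ContinuousOn (Function.uncurry f) (Icc (-1:ℝ) 1 ×ˢ Icc a b) →
      IntervalIntegrable (fun t => ∫ x in a..b, f t x) volume (-1) 1 := by
    intro a b hab f hf
    have h1 : IntegrableOn (Function.uncurry f) (Icc (-1:ℝ) 1 ×ˢ Icc a b) (volume.prod volume) :=
      hf.integrableOn_compact (isCompact_Icc.prod isCompact_Icc)
    have h2 := h1.mono_set (prod_mono (Ioc_subset_Icc_self (a := (-1:ℝ)) (b := 1)) (Ioc_subset_Icc_self (a := a) (b := b)))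
    rw [IntegrableOn, ← Measure.prod_restrict] at h2
    have h3 := h2.integral_prod_left
    rw [intervalIntegrable_iff_integrableOn_Ioc_of_le (by norm_num)]
    simp only [intervalIntegral.integral_of_le hab]
    exact h3
  have hXX : -X ≤ X := by linarith
  have hYY : -Y ≤ Y := by linarith
  unfold rectInt
  refine ⟨((((ii hXX (ch _ a1)).sub (ii hXX (ch _ a2))).add ((ii hYY (cv _ a4)).const_mul _)).sub ((ii hYY (cv _ a3)).const_mul _)), ?_⟩
  rw [intervalIntegral.integral_sub, intervalIntegral.integral_add, intervalIntegral.integral_sub,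
    intervalIntegral.integral_const_mul, intervalIntegral.integral_const_mul,
    swap_cont (by norm_num) hXX (ch _ a1), swap_cont (by norm_num) hXX (ch _ a2),
    swap_cont (by norm_num) hYY (cv _ a3), swap_cont (by norm_num) hYY (cv _ a4)]
  · exact ii hXX (ch _ a1)
  · exact ii hXX (ch _ a2)
  · exact (ii hXX (ch _ a1)).sub (ii hXX (ch _ a2))
  · exact (ii hYY (cv _ a4)).const_mul _
  · exact ((ii hXX (ch _ a1)).sub (ii hXX (ch _ a2))).add ((ii hYY (cv _ a4)).const_mul _)
  · exact (ii hYY (cv _ a3)).const_mul _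

/-- pointwise interpolation formula -/
theorem interp (hX : 0 < X) (hY : 0 < Y) {f g : ℂ → ℂ} (hf : Differentiable ℂ f) (hg : Differentiable ℂ g) (Z : Finset ℝ)
    (hZ1 : ∀ w ∈ Z, w ∈ Ioo (-X) X) (hZ2 : ∀ w ∈ Z, f w = 0 ∧ deriv f w ≠ 0)
    (hZ3 : ∀ z : ℂ, |z.re| ≤ X → |z.im| ≤ Y → f z = 0 → ∃ w ∈ Z, z = (w:ℝ)) {t : ℝ} (ht : t ∈ Ioo (-X) X) (hft : f t ≠ 0) :
    g t = (2 * π * Complex.I)⁻¹ * rectInt X Y (fun z => f t * (g z / (f z * (z - t)))) + ∑ w ∈ Z, g w / deriv f w * (f t / (t - w)) := by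
  have htZ : t ∉ Z := fun h => hft (hZ2 t h).1
  have hd : ∀ z, HasDerivAt (fun z => f z * (z - t)) (deriv f z * (z - t) + f z * 1) z := fun z =>
    (hf z).hasDerivAt.mul ((hasDerivAt_id z).sub_const (t:ℂ))
  have hne : ∀ w ∈ Z, (w:ℂ) - t ≠ 0 := by
    intro w hw h0
    have : w = t := by exact_mod_cast sub_eq_zero.1 h0
    exact htZ (this ▸ hw)
  have := rect_residue hX hY (insert t Z) (fun z => f z * (z - t)) g (fun z => (hd z).differentiableAt) hg
    (fun w hw => by
      rcases Finset.mem_insert.1 hw with h | h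
      · rw [h]; exact ht
      · exact hZ1 w h)
    (fun w hw => by
      rw [(hd w).deriv]
      rcases Finset.mem_insert.1 hw with h | h
      · rw [h]; simpa using hft
      · rw [(hZ2 w h).1]
        simpa using ⟨(hZ2 w h).2, hne w h⟩)
    (fun z h1 h2 h3 => by
      rcases mul_eq_zero.1 h3 with h | h
      · obtain ⟨w, hw, e⟩ := hZ3 z h1 h2 h
        exact ⟨w, Finset.mem_insert_of_mem hw, e⟩
      · exact ⟨t, Finset.mem_insert_self _ _, sub_eq_zero.1 h⟩)
  rw [rectInt_const_mul, this, Finset.sum_insert htZ, (hd t).deriv]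
  have hs : ∑ w ∈ Z, g w / deriv (fun z => f z * (z - t)) w = - ∑ w ∈ Z, g w / deriv f w * (1 / (t - w)) := by
    rw [← Finset.sum_neg_distrib]
    apply Finset.sum_congr rfl
    intro w hw
    rw [(hd w).deriv, (hZ2 w hw).1]
    have h1 := hne w hw
    have h2 := (hZ2 w hw).2
    have h3 : (t:ℂ) - w ≠ 0 := fun h => h1 (by linear_combination -h)
    field_simp
    ring
  have hs2 : ∑ w ∈ Z, g w / deriv f w * (f t / (t - w)) = f t * ∑ w ∈ Z, g w / deriv f w * (1 / (t - w)) := by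
    rw [Finset.mul_sum]
    apply Finset.sum_congr rfl
    intro w _
    ring
  rw [hs, hs2]
  simp only [sub_self, mul_zero, mul_one, zero_add]
  have hpi : (2 * π * Complex.I : ℂ) ≠ 0 := Complex.two_pi_I_ne_zero
  field_simp
  ring

end

/-- Cauchy transform -/
noncomputable def Hc (ψ : ℝ → ℝ) (z : ℂ) : ℂ := ∫ t in (-1:ℝ)..1, (ψ t : ℂ) / (z - t)

theorem quot_integrable {ψ : ℝ → ℝ} (hd : Differentiable ℝ ψ) {w : ℝ} (h0 : ψ w = 0) (a b : ℝ) :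
    IntervalIntegrable (fun t => ψ t / (t - w)) volume a b := by
  have hc : Continuous (dslope ψ w) := by
    rw [← continuousOn_univ, continuousOn_dslope Filter.univ_mem, continuousOn_univ]
    exact ⟨hd.continuous, hd w⟩
  refine (hc.intervalIntegrable a b).congr_ae ?_
  have : ∀ᵐ t : ℝ, t ≠ w := by simp [ae_iff]
  filter_upwards [ae_restrict_of_ae this] with t ht
  rw [dslope_of_ne _ ht, slope_def_field, h0, sub_zero]

theorem error_formula {c : ℝ} {m n : ℕ} {ψm ψn : ℝ → ℝ} {lm ln : ℂ} {χm χn X Y : ℝ}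
    (hm : ProlateDatum c m ψm lm χm) (hn : ProlateDatum c n ψn ln χn) (hX : 1 < X) (hY : 0 < Y)
    (Zi Zo : Finset ℝ) (hZi : ∀ w ∈ Zi, w ∈ Ioo (-1:ℝ) 1 ∧ ψn w = 0) (hZo : ∀ w ∈ Zo, w ∈ Ioo (-X) X ∧ ψn w = 0 ∧ 1 < |w|)
    (hsimp : ∀ w ∈ Zi ∪ Zo, deriv ψn w ≠ 0)
    (hall : ∀ z : ℂ, |z.re| ≤ X → |z.im| ≤ Y → ent c ψn ln z = 0 → ∃ w ∈ Zi ∪ Zo, z = (w:ℝ)) :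
    (((∫ s in (-1:ℝ)..1, ψm s) - ∑ w ∈ Zi, quadWeight ψn w * ψm w : ℝ) : ℂ) =
      (2 * π * Complex.I)⁻¹ * rectInt X Y (fun z => ent c ψm lm z * Hc ψn z / ent c ψn ln z)
        - ∑ w ∈ Zo, (ψm w : ℂ) / (deriv ψn w : ℝ) * Hc ψn w := by
  have hX0 : 0 < X := by linarith
  have Cm := hm.code
  have Cn := hn.code
  have hdisj : Disjoint Zi Zo := by
    rw [Finset.disjoint_left]
    intro w h1 h2
    have := (hZo w h2).2.2
    have := abs_lt.2 (hZi w h1).1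
    linarith
  have hz0 : ∀ w ∈ Zi ∪ Zo, ψn w = 0 := fun w hw => by
    rcases Finset.mem_union.1 hw with h | h
    · exact (hZi w h).2
    · exact (hZo w h).2.1
  have hin : ∀ w ∈ Zi ∪ Zo, w ∈ Ioo (-X) X := fun w hw => by
    rcases Finset.mem_union.1 hw with h | h
    · exact ⟨by linarith [(hZi w h).1.1], by linarith [(hZi w h).1.2]⟩
    · exact (hZo w h).1
  have hbd : ∀ z ∈ rectBd X Y, ent c ψn ln z ≠ 0 := by
    intro z hzb h0
    have h12 : |z.re| ≤ X ∧ |z.im| ≤ Y := by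
      rcases hzb with ⟨h1, h2⟩ | ⟨h1, h2⟩
      · exact ⟨h1.le, h2⟩
      · exact ⟨h1, h2.le⟩
    obtain ⟨v, hv, hzv⟩ := hall z h12.1 h12.2 h0
    exact real_not_bd hY (hin v hv) hzb (by rw [hzv, sub_self])
  have hpt : ∀ t ∈ Ioc (-1:ℝ) 1, ψn t ≠ 0 → (ψm t : ℂ) =
      (2 * π * Complex.I)⁻¹ * rectInt X Y (fun z => (ψn t : ℂ) * (ent c ψm lm z / (ent c ψn ln z * (z - t)))) +
        ∑ w ∈ Zi ∪ Zo, (ψm w : ℂ) / (deriv ψn w : ℝ) * ((ψn t / (t - w) : ℝ) : ℂ) := by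
    intro t ht htn
    have := interp hX0 hY Cn.diff Cm.diff (Zi ∪ Zo) hin (fun w hw => ⟨by rw [Cn.real, hz0 w hw, Complex.ofReal_zero], by
      rw [Cn.real']; exact_mod_cast hsimp w hw⟩) hall (t := t) ⟨by linarith [ht.1], by linarith [ht.2]⟩ (by rw [Cn.real]; exact_mod_cast htn)
    rw [Cm.real, Cn.real] at this
    rw [this]
    congr 1
    apply Finset.sum_congr rfl
    intro w _
    rw [Cm.real, Cn.real']
    push_cast
    ring
  have hK : ContinuousOn (Function.uncurry fun (t : ℝ) (z : ℂ) => (ψn t : ℂ) * (ent c ψm lm z / (ent c ψn ln z * (z - t))))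
      (Icc (-1:ℝ) 1 ×ˢ rectBd X Y) := by
    have c1 : Continuous fun p : ℝ × ℂ => (ψn p.1 : ℂ) := Complex.continuous_ofReal.comp (hn.cont.comp continuous_fst)
    have c2 : Continuous fun p : ℝ × ℂ => ent c ψm lm p.2 := Cm.diff.continuous.comp continuous_snd
    have c3 : Continuous fun p : ℝ × ℂ => ent c ψn ln p.2 * (p.2 - p.1) := (Cn.diff.continuous.comp continuous_snd).mul (by fun_prop)
    refine c1.continuousOn.mul (c2.continuousOn.div c3.continuousOn ?_)
    rintro ⟨t, z⟩ ⟨h1, h2⟩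
    exact mul_ne_zero (hbd z h2) (real_not_bd hY ⟨by linarith [h1.1], by linarith [h1.2]⟩ h2)
  obtain ⟨hi1, hi2⟩ := rectInt_swap hX0 hY hK
  have hdn : Differentiable ℝ ψn := fun x => (hn.analytic x).differentiableAt
  have hq : ∀ w ∈ Zi ∪ Zo, IntervalIntegrable (fun t : ℝ => (ψm w : ℂ) / (deriv ψn w : ℝ) * ((ψn t / (t - w) : ℝ) : ℂ)) volume (-1) 1 :=
    fun w hw => by
      have h := quot_integrable hdn (hz0 w hw) (-1) 1
      have h' : IntervalIntegrable (fun t : ℝ => ((ψn t / (t - w) : ℝ) : ℂ)) volume (-1) 1 := ⟨h.1.ofReal, h.2.ofReal⟩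
      exact h'.const_mul _
  have hqs : IntervalIntegrable (fun t : ℝ => ∑ w ∈ Zi ∪ Zo, (ψm w : ℂ) / (deriv ψn w : ℝ) * ((ψn t / (t - w) : ℝ) : ℂ)) volume (-1) 1 := by
    have h := IntervalIntegrable.sum _ hq
    rwa [Finset.sum_fn] at h
  have hmain : ((∫ s in (-1:ℝ)..1, ψm s : ℝ) : ℂ) = (2 * π * Complex.I)⁻¹ * rectInt X Y (fun z => ent c ψm lm z * Hc ψn z / ent c ψn ln z) +
      ∑ w ∈ Zi ∪ Zo, (ψm w : ℂ) / (deriv ψn w : ℝ) * ((∫ t in (-1:ℝ)..1, ψn t / (t - w) : ℝ) : ℂ) := by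
    rw [← intervalIntegral.integral_ofReal]
    rw [intervalIntegral.integral_congr_ae (g := fun t => (2 * π * Complex.I)⁻¹ * rectInt X Y (fun z => (ψn t : ℂ) * (ent c ψm lm z / (ent c ψn ln z * (z - t)))) +
        ∑ w ∈ Zi ∪ Zo, (ψm w : ℂ) / (deriv ψn w : ℝ) * ((ψn t / (t - w) : ℝ) : ℂ))]
    · rw [intervalIntegral.integral_add (hi1.const_mul _) hqs, intervalIntegral.integral_const_mul, hi2,
        intervalIntegral.integral_finset_sum hq]
      congr 1
      · congr 1
        apply rectInt_congr hX0 hY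
        intro z hz
        unfold Hc
        rw [mul_div_right_comm, ← intervalIntegral.integral_const_mul]
        apply intervalIntegral.integral_congr
        intro t ht
        rw [uIcc_of_le (by norm_num)] at ht
        have h1 := hbd z hz
        have h2 := real_not_bd (X := X) hY (w := t) ⟨by linarith [ht.1], by linarith [ht.2]⟩ hz
        simp only
        field_simp
      · apply Finset.sum_congr rfl
        intro w _
        rw [intervalIntegral.integral_const_mul, intervalIntegral.integral_ofReal]
    · have : ∀ᵐ t : ℝ, t ∉ ((Zi : Set ℝ) ∪ {1}) := by
        rw [ae_iff]
        simp only [not_not]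
        exact ((Zi.finite_toSet.union (Set.finite_singleton (1:ℝ))).measure_zero volume)
      filter_upwards [this] with t ht htI
      rw [uIoc_of_le (by norm_num)] at htI
      apply hpt t htI
      intro h0
      apply ht
      obtain ⟨w, hw, e⟩ := hall t (by simp; exact (abs_le.2 ⟨by linarith [htI.1], htI.2⟩).trans hX.le) (by simp [hY.le]) (by rw [Cn.real, h0, Complex.ofReal_zero])
      have e' : t = w := by exact_mod_cast e
      rcases Finset.mem_union.1 hw with h | h
      · left; rw [e']; exact h
      · right
        have h3 := (hZo w h).2.2
        rw [← e'] at h3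
        have := abs_le.2 ⟨htI.1.le, htI.2⟩
        linarith
  rw [Finset.sum_union hdisj] at hmain
  have e1 : ∑ w ∈ Zi, (ψm w : ℂ) / (deriv ψn w : ℝ) * ((∫ t in (-1:ℝ)..1, ψn t / (t - w) : ℝ) : ℂ) = ((∑ w ∈ Zi, quadWeight ψn w * ψm w : ℝ) : ℂ) := by
    rw [Complex.ofReal_sum]
    apply Finset.sum_congr rfl
    intro w _
    unfold quadWeight
    push_cast
    ring
  have e2 : ∑ w ∈ Zo, (ψm w : ℂ) / (deriv ψn w : ℝ) * ((∫ t in (-1:ℝ)..1, ψn t / (t - w) : ℝ) : ℂ) = - ∑ w ∈ Zo, (ψm w : ℂ) / (deriv ψn w : ℝ) * Hc ψn w := by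
    rw [← Finset.sum_neg_distrib]
    apply Finset.sum_congr rfl
    intro w _
    rw [← mul_neg]
    congr 1
    unfold Hc
    rw [← intervalIntegral.integral_ofReal, ← intervalIntegral.integral_neg]
    apply intervalIntegral.integral_congr
    intro t _
    simp only
    push_cast
    rw [← div_neg, neg_sub]
  rw [e1, e2] at hmain
  rw [Complex.ofReal_sub, hmain]
  ring

theorem RODE.psi_sq_ge {c χ s : ℝ} {ψ ψ' ψ'' : ℝ → ℝ} (h : RODE c χ ψ ψ' ψ'') (hχ : χ = c^2*(1+s)) {x : ℝ} (hx : 1 ≤ x) (hxt : x^2 ≤ 1 + s) :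
    ψ 1^2 ≤ ψ x^2 := by
  refine le_of_hasDerivAt_nonneg (f := fun x => ψ x^2) (f' := fun x => 2 * (ψ x * ψ' x)) hx (h.cont.pow 2).continuousOn
      (fun z _ => ((h.d1 z).pow 2).congr_deriv (by norm_num; ring)) ?_
  intro y hy
  have h1 : y^2 ≤ 1 + s := by nlinarith [hy.1, hy.2]
  have h2 := h.F_nonneg hχ hy.1.le h1
  have h3 : 0 < y^2 - 1 := by nlinarith [hy.1]
  have := nonneg_of_mul_nonneg_right h2 h3
  linarith

theorem error_bound {c s : ℝ} {m n : ℕ} {ψm ψn : ℝ → ℝ} {lm ln : ℂ} {χm χn X Y A L : ℝ}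
    (hm : ProlateDatum c m ψm lm χm) (hn : ProlateDatum c n ψn ln χn) (hc : 1 ≤ c) (hs : 0 < s) (hχ : χn = c^2*(1+s))
    (hcs : 2 ≤ c^2*s^2) (hw : deriv ψn (√(1+s)) ≠ 0) (hX : √(1+s) < X) (hY : 0 < Y) (hL0 : 0 < L)
    (hL : ∀ z ∈ rectBd X Y, L * exp (c * |z.im|) ≤ ‖ent c ψn ln z‖)
    (hA : ∀ z : ℂ, (z ∈ rectBd X Y ∨ ∃ w : ℝ, √(1+s) ≤ |w| ∧ z = w) → ‖ent c ψm lm z * Hc ψn z‖ ≤ A * exp (c * |z.im|))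
    (Zi : Finset ℝ) (hZi : ∀ w, w ∈ Zi ↔ w ∈ Ioo (-1:ℝ) 1 ∧ ψn w = 0) :
    |(∫ s in (-1:ℝ)..1, ψm s) - ∑ w ∈ Zi, quadWeight ψn w * ψm w| ≤
      2*(c*X+1) * (A * X^2 / (s * |deriv ψn (√(1+s))|)) + (4*X+4*Y) * (A/L) / (2*π) := by
  have R := hn.rode
  have hxt1 : 1 < √(1+s) := by rw [lt_sqrt (by norm_num)]; linarith
  have hxt2 : √(1+s)^2 = 1 + s := sq_sqrt (by linarith)
  have hX1 : 1 < X := by linarith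
  have hX0 : 0 < X := by linarith
  have hc0 : 0 < c := by linarith
  set D := s * |deriv ψn (√(1+s))| with hD
  have hD0 : 0 < D := mul_pos hs (abs_pos.2 hw)
  have hχc : c^2 < χn := by rw [hχ]; nlinarith [mul_pos (pow_pos hc0 2) hs]
  obtain ⟨σ, hσ, -, hpar, hpar'⟩ := hn.parity
  have habs : ∀ x, |ψn (-x)| = |ψn x| := hn.abs_parity
  have habs' : ∀ x, |deriv ψn (-x)| = |deriv ψn x| := hn.abs_parity'
  have hA0 : 0 ≤ A := by
    have := (norm_nonneg _).trans (hA (√(1+s) : ℝ) (Or.inr ⟨_, le_abs_self _, rfl⟩))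
    by_contra h
    push Not at h
    have h2 := mul_neg_of_neg_of_pos h (exp_pos (c * |((√(1+s) : ℝ):ℂ).im|))
    linarith
  -- no zeros in the middle
  have hmid : ∀ x : ℝ, 1 ≤ x → x ≤ √(1+s) → ψn x ≠ 0 := by
    intro x h1 h2 h0
    have h3 := R.psi_sq_ge hχ h1 (by nlinarith)
    have h4 := hn.psi_one_sq hχc
    rw [h0] at h3
    linarith
  -- outer positive zeros
  have hfin : {x : ℝ | √(1+s) ≤ x ∧ x ≤ X ∧ ψn x = 0}.Finite := by
    by_contra hinf
    obtain ⟨Z, hZ, hcard⟩ := Set.Infinite.exists_subset_card_eq hinf (⌈c*X+1⌉₊ + 1)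
    have := R.zero_card hc0 hs hχ hw hX0.le Z (fun z hz => hZ hz)
    rw [hcard] at this
    push_cast at this
    linarith [Nat.le_ceil (c*X+1)]
  set Zp := hfin.toFinset with hZp
  have hmemp : ∀ x, x ∈ Zp ↔ √(1+s) ≤ x ∧ x ≤ X ∧ ψn x = 0 := fun x => by rw [hZp, Set.Finite.mem_toFinset]; rfl
  have hcard : (Zp.card : ℝ) ≤ c*X+1 := R.zero_card hc0 hs hχ hw hX0.le Zp (fun z hz => (hmemp z).1 hz)
  set Zo := Zp ∪ Zp.image (fun x => -x) with hZo
  have hψX : ψn X ≠ 0 := by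
    intro h0
    have := hL (X:ℂ) (Or.inl (by simp [abs_of_pos hX0, hY.le]))
    rw [hn.code.real, h0] at this
    simp at this
    linarith
  have hmemo : ∀ w ∈ Zo, √(1+s) ≤ |w| ∧ |w| < X ∧ ψn |w| = 0 ∧ ψn w = 0 := by
    have key : ∀ x ∈ Zp, √(1+s) ≤ |x| ∧ |x| < X ∧ ψn |x| = 0 ∧ ψn x = 0 := by
      intro x hx
      obtain ⟨h1, h2, h3⟩ := (hmemp x).1 hx
      rw [abs_of_pos (by linarith)]
      refine ⟨h1, lt_of_le_of_ne h2 ?_, h3, h3⟩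
      rintro rfl
      exact hψX h3
    intro w hw
    rcases Finset.mem_union.1 hw with h | h
    · exact key w h
    · obtain ⟨x, hx, rfl⟩ := Finset.mem_image.1 h
      obtain ⟨h1, h2, h3, h4⟩ := key x hx
      rw [abs_neg]
      refine ⟨h1, h2, h3, ?_⟩
      have := habs x
      rw [h4, abs_zero] at this
      exact abs_eq_zero.1 this
  have hdo : ∀ w ∈ Zo, D / X^2 ≤ |deriv ψn w| := by
    intro w hw
    obtain ⟨h1, h2, h3, _⟩ := hmemo w hw
    have h4 := R.zero_deriv hs hχ h1 h3
    have h5 : |deriv ψn (|w|)| = |deriv ψn w| := by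
      rcases abs_choice w with h | h
      · rw [h]
      · rw [h, habs']
    rw [h5] at h4
    rw [div_le_iff₀ (by positivity)]
    have h6 : |w|^2 - 1 ≤ X^2 := by nlinarith [abs_nonneg w]
    have := mul_le_mul_of_nonneg_right h6 (abs_nonneg (deriv ψn w))
    linarith
  have hallz : ∀ z : ℂ, |z.re| ≤ X → |z.im| ≤ Y → ent c ψn ln z = 0 → ∃ w ∈ Zi ∪ Zo, z = (w:ℝ) := by
    intro z hz1 hz2 hz0
    have him : z.im = 0 := by
      by_contra h
      exact hn.ent_ne_zero hc0 hs hχ hcs h hz0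
    have hzr : z = (z.re : ℝ) := Complex.ext (by simp) (by simp [him])
    refine ⟨z.re, ?_, hzr⟩
    have h0 : ψn z.re = 0 := by
      rw [hzr, hn.code.real] at hz0
      exact_mod_cast hz0
    have h0' : ψn |z.re| = 0 := by
      rcases abs_choice z.re with h | h
      · rw [h, h0]
      · rw [h]
        have := habs z.re
        rw [h0, abs_zero] at this
        exact abs_eq_zero.1 this
    rw [Finset.mem_union]
    by_cases h1 : |z.re| < 1
    · left; exact (hZi _).2 ⟨abs_lt.1 h1, h0⟩
    · right
      push Not at h1
      have h2 : √(1+s) ≤ |z.re| := by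
        by_contra h
        push Not at h
        exact hmid _ h1 h.le h0'
      have h3 : |z.re| ∈ Zp := (hmemp _).2 ⟨h2, hz1, h0'⟩
      rw [hZo, Finset.mem_union]
      rcases abs_choice z.re with h | h
      · left; rwa [h] at h3
      · right
        rw [h] at h3
        exact Finset.mem_image.2 ⟨_, h3, by ring⟩
  have hform := error_formula hm hn hX1 hY Zi Zo (fun w hw => (hZi w).1 hw)
    (fun w hw => by
      obtain ⟨h1, h2, _, h4⟩ := hmemo w hw
      exact ⟨abs_lt.1 h2, h4, by linarith⟩)
    (fun w hw => by
      rcases Finset.mem_union.1 hw with h | h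
      · obtain ⟨h1, h2⟩ := (hZi w).1 h
        exact R.not_both_zero hn.normalized h1 h2
      · intro h0
        have := hdo w h
        rw [h0, abs_zero] at this
        have : 0 < D / X^2 := by positivity
        linarith) hallz
  have hnorm := congrArg norm hform
  rw [Complex.norm_real, norm_eq_abs] at hnorm
  rw [hnorm]
  refine (norm_sub_le _ _).trans ?_
  rw [add_comm]
  apply add_le_add
  · refine (norm_sum_le _ _).trans ?_
    have hb : ∀ w ∈ Zo, ‖(ψm w : ℂ) / (deriv ψn w : ℝ) * Hc ψn w‖ ≤ A * X^2 / D := by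
      intro w hw
      have h1 := hA (w:ℂ) (Or.inr ⟨w, (hmemo w hw).1, rfl⟩)
      simp only [Complex.ofReal_im, abs_zero, mul_zero, exp_zero, mul_one] at h1
      rw [hm.code.real] at h1
      rw [div_mul_eq_mul_div, norm_div, Complex.norm_real, norm_eq_abs]
      have h2 := hdo w hw
      have h3 : 0 < D / X^2 := by positivity
      calc _ ≤ A / (D/X^2) := div_le_div₀ hA0 h1 h3 h2
        _ = _ := by field_simp
    refine (Finset.sum_le_card_nsmul _ _ _ hb).trans ?_
    rw [nsmul_eq_mul]
    apply mul_le_mul_of_nonneg_right _ (by positivity)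
    have h1 : (Zo.card : ℝ) ≤ Zp.card + (Zp.image (fun x => -x)).card := by exact_mod_cast Finset.card_union_le _ _
    have h2 : ((Zp.image (fun x => -x)).card : ℝ) ≤ Zp.card := by exact_mod_cast Finset.card_image_le
    linarith
  · rw [norm_mul, norm_inv]
    have h2pi : ‖(2 * π * Complex.I : ℂ)‖ = 2*π := by
      rw [norm_mul, Complex.norm_I, mul_one, norm_mul, Complex.norm_real, norm_of_nonneg pi_pos.le]; simp
    rw [h2pi]
    have hb := norm_rectInt_le hX0 hY (F := fun z => ent c ψm lm z * Hc ψn z / ent c ψn ln z) (C := A/L) (fun z hz => by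
      rw [norm_div]
      have h1 := hA z (Or.inl hz)
      have h2 := hL z hz
      have h3 : 0 < L * exp (c * |z.im|) := by positivity
      calc _ ≤ A * exp (c * |z.im|) / (L * exp (c * |z.im|)) := div_le_div₀ (by positivity) h1 h3 h2
        _ = A / L := mul_div_mul_right _ _ (exp_pos _).ne')
    rw [inv_mul_eq_div]
    apply div_le_div_of_nonneg_right _ (by positivity)
    linarith

section
variable {c χ : ℝ} {k : ℕ} {ψ : ℝ → ℝ} {lam : ℂ}

theorem ProlateDatum.int_abs (h : ProlateDatum c k ψ lam χ) : ∫ t in (-1:ℝ)..1, |ψ t| ≤ 3/2 := by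
  have hcont := h.cont
  have h1 : ∫ t in (-1:ℝ)..1, |ψ t| ≤ ∫ t in (-1:ℝ)..1, (1/2 + 1/2 * ψ t^2) := by
    apply intervalIntegral.integral_mono_on (by norm_num) (hcont.abs.intervalIntegrable _ _)
      (Continuous.intervalIntegrable (by fun_prop) _ _)
    intro x _
    have h2 := sq_nonneg (|ψ x| - 1)
    have h3 := sq_abs (ψ x)
    nlinarith only [h2, h3]
  rw [intervalIntegral.integral_add (by simp) (Continuous.intervalIntegrable (by fun_prop) _ _),
    intervalIntegral.integral_const_mul, h.normalized] at h1
  norm_num at h1 ⊢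
  linarith

theorem ProlateDatum.Hc_le (h : ProlateDatum c k ψ lam χ) {z : ℂ} {d : ℝ} (hd : 0 < d) (hz : ∀ t ∈ Icc (-1:ℝ) 1, d ≤ ‖z - t‖) :
    ‖Hc ψ z‖ ≤ 3/2/d := by
  unfold Hc
  have hcont := h.cont
  calc _ ≤ ∫ t in (-1:ℝ)..1, |ψ t| / d := by
        apply intervalIntegral.norm_integral_le_of_norm_le (by norm_num) _ ((hcont.abs.div_const d).intervalIntegrable _ _)
        refine Filter.Eventually.of_forall fun t ht => ?_
        rw [norm_div, Complex.norm_real, norm_eq_abs]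
        exact div_le_div_of_nonneg_left (abs_nonneg _) hd (hz t (Ioc_subset_Icc_self ht))
    _ = (∫ t in (-1:ℝ)..1, |ψ t|) / d := by rw [intervalIntegral.integral_div]
    _ ≤ _ := div_le_div_of_nonneg_right h.int_abs hd.le

theorem ProlateDatum.ent_le (h : ProlateDatum c k ψ lam χ) (hc : 0 < c) (z : ℂ) :
    ‖ent c ψ lam z‖ ≤ ‖lam‖⁻¹ * (3/2 * exp (c * |z.im|)) := by
  unfold ent
  rw [norm_mul, norm_inv]
  apply mul_le_mul_of_nonneg_left _ (by positivity)
  have hcont := h.cont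
  calc _ ≤ ∫ t in (-1:ℝ)..1, |ψ t| * exp (c * |z.im|) := by
        apply intervalIntegral.norm_integral_le_of_norm_le (by norm_num) _ ((hcont.abs.mul_const _).intervalIntegrable _ _)
        refine Filter.Eventually.of_forall fun t ht => ?_
        rw [norm_mul, Complex.norm_real, norm_eq_abs, norm_cexp_ict]
        apply mul_le_mul_of_nonneg_left _ (abs_nonneg _)
        apply exp_le_exp.2
        have h1 : |t| ≤ 1 := _root_.abs_le.2 ⟨ht.1.le, ht.2⟩
        have h2 : -(z.im * t) ≤ |z.im| := by
          calc _ ≤ |z.im * t| := neg_le_abs _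
            _ = |z.im| * |t| := abs_mul _ _
            _ ≤ |z.im| * 1 := by gcongr
            _ = _ := mul_one _
        nlinarith
    _ = (∫ t in (-1:ℝ)..1, |ψ t|) * exp (c * |z.im|) := by rw [intervalIntegral.integral_mul_const]
    _ ≤ _ := mul_le_mul_of_nonneg_right h.int_abs (exp_pos _).le

/-- Phragmen-Lindelof -/
theorem ProlateDatum.ent_PL (h : ProlateDatum c k ψ lam χ) (hc : 0 < c) {M : ℝ} (hM : ∀ x : ℝ, |ψ x| ≤ M) (z : ℂ) :
    ‖ent c ψ lam z‖ ≤ M * exp (c * |z.im|) := by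
  have C := h.code
  have key : ∀ z : ℂ, 0 ≤ z.im → ‖ent c ψ lam z‖ ≤ M * exp (c * |z.im|) := by
    intro z hz
    set g : ℂ → ℂ := fun w => ent c ψ lam (Complex.I * w) * Complex.exp (-(c * w)) with hg
    have hgd : Differentiable ℂ g := by
      have h1 : Differentiable ℂ (fun w : ℂ => ent c ψ lam (Complex.I * w)) := C.diff.comp (by fun_prop)
      exact h1.mul (by fun_prop)
    have hnorm : ∀ w, ‖g w‖ = ‖ent c ψ lam (Complex.I * w)‖ * exp (-(c * w.re)) := by
      intro w
      simp [hg, Complex.norm_exp]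
    have hbd : ∀ w : ℂ, 0 ≤ w.re → ‖g w‖ ≤ ‖lam‖⁻¹ * (3/2) := by
      intro w hw
      have h1 := h.ent_le hc (Complex.I * w)
      have h2 : (Complex.I * w).im = w.re := by simp
      rw [h2, abs_of_nonneg hw] at h1
      rw [hnorm]
      calc _ ≤ ‖lam‖⁻¹ * (3/2 * exp (c * w.re)) * exp (-(c*w.re)) := mul_le_mul_of_nonneg_right h1 (exp_pos _).le
        _ = ‖lam‖⁻¹ * (3/2) * (exp (c * w.re) * exp (-(c*w.re))) := by ring
        _ = _ := by rw [← exp_add, add_neg_cancel, exp_zero, mul_one]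
    have hpl := PhragmenLindelof.right_half_plane_of_bounded_on_real (f := g) (C := M) (z := -Complex.I * z)
      hgd.diffContOnCl ⟨0, by norm_num, 0, by
        refine Asymptotics.IsBigO.of_bound (‖lam‖⁻¹ * (3/2)) ?_
        rw [Filter.eventually_inf_principal]
        refine Filter.Eventually.of_forall fun w hw => ?_
        simpa using hbd w (le_of_lt hw)⟩
      ⟨‖lam‖⁻¹ * (3/2), by
        rw [Filter.eventually_map]
        filter_upwards [Filter.eventually_ge_atTop 0] with x hx
        exact hbd x (by simpa using hx)⟩
      (fun x => by
        rw [hnorm]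
        have h1 : Complex.I * (x * Complex.I) = ((-x : ℝ) : ℂ) := by
          push_cast; linear_combination (x:ℂ) * Complex.I_mul_I
        rw [h1, C.real, Complex.norm_real]
        simpa using hM (-x)) (by simpa using hz)
    rw [hnorm] at hpl
    have h1 : Complex.I * (-Complex.I * z) = z := by linear_combination -z * Complex.I_mul_I
    have h2 : (-Complex.I * z).re = z.im := by simp
    rw [h1, h2] at hpl
    rw [abs_of_nonneg hz]
    calc _ = ‖ent c ψ lam z‖ * exp (-(c*z.im)) * exp (c*z.im) := by rw [mul_assoc, ← exp_add, neg_add_cancel, exp_zero, mul_one]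
      _ ≤ _ := mul_le_mul_of_nonneg_right hpl (exp_pos _).le
  rcases le_total 0 z.im with h0 | h0
  · exact key z h0
  · have := key (starRingEnd ℂ z) (by simpa using h0)
    rw [C.conj] at this
    simpa using this

theorem ProlateDatum.chi_nonneg (h : ProlateDatum c k ψ lam χ) (hc : 0 < c) : 0 ≤ χ := by
  by_contra hneg
  push Not at hneg
  have R := h.rode
  have hF : ∀ x, HasDerivAt (fun x => ((1 - x^2) * deriv ψ x) * ψ x) ((1-x^2) * deriv ψ x^2 + (c^2*x^2 - χ) * ψ x^2) x := fun x =>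
    ((R.dw x).mul (R.d1 x)).congr_deriv (by ring)
  have hpos : ∀ x ∈ Icc (-1:ℝ) 1, 0 ≤ (1-x^2) * deriv ψ x^2 + (c^2*x^2 - χ) * ψ x^2 := by
    intro x hx
    have : 0 ≤ 1 - x^2 := by nlinarith [hx.1, hx.2]
    have : 0 ≤ c^2*x^2 - χ := by nlinarith [sq_nonneg (c*x)]
    positivity
  have hcF : Continuous (fun x => ((1 - x^2) * deriv ψ x) * ψ x) := continuous_iff_continuousAt.2 fun x => (hF x).continuousAt
  have hz : ∀ x ∈ Icc (-1:ℝ) 1, ((1 - x^2) * deriv ψ x) * ψ x = 0 := by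
    intro x hx
    have h1 := le_of_hasDerivAt_nonneg (f := fun x => ((1 - x^2) * deriv ψ x) * ψ x) hx.1 hcF.continuousOn (fun y _ => hF y)
      (fun y hy => hpos y ⟨hy.1.le, by linarith [hy.2, hx.2]⟩)
    have h2 := le_of_hasDerivAt_nonneg (f := fun x => ((1 - x^2) * deriv ψ x) * ψ x) hx.2 hcF.continuousOn (fun y _ => hF y)
      (fun y hy => hpos y ⟨by linarith [hy.1, hx.1], hy.2.le⟩)
    norm_num at h1 h2
    linarith
  have hψ : ∀ x ∈ Ioo (-1:ℝ) 1, ψ x = 0 := by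
    intro x hx
    have h1 : HasDerivAt (fun x => ((1 - x^2) * deriv ψ x) * ψ x) 0 x := by
      refine (hasDerivAt_const x (0:ℝ)).congr_of_eventuallyEq ?_
      filter_upwards [Icc_mem_nhds hx.1 hx.2] with y hy
      exact hz y hy
    have h2 := h1.unique (hF x)
    have h3 : 0 ≤ 1 - x^2 := by nlinarith [hx.1, hx.2]
    have h4 : 0 < c^2*x^2 - χ := by nlinarith [sq_nonneg (c*x)]
    have h5 : 0 ≤ (1 - x^2) * deriv ψ x^2 := by positivity
    have h6 : (c^2*x^2 - χ) * ψ x^2 ≤ 0 := by linarith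
    have h7 : ψ x^2 ≤ 0 := by
      by_contra h8
      push Not at h8
      have := mul_pos h4 h8
      linarith
    exact pow_eq_zero_iff (two_ne_zero) |>.1 (le_antisymm h7 (sq_nonneg _))
  have hn := h.normalized
  rw [intervalIntegral.integral_of_le (by norm_num), integral_Ioc_eq_integral_Ioo, setIntegral_congr_fun measurableSet_Ioo (g := fun _ => (0:ℝ)) (fun x hx => by simp [hψ x hx])] at hn
  simp at hn

theorem ProlateDatum.sup_real (h : ProlateDatum c k ψ lam χ) (hc : 1 ≤ c) (hχ : χ ≤ c^2) (x : ℝ) : |ψ x| ≤ 3*c := by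
  have hχ0 := h.chi_nonneg (by linarith)
  have R := h.rode
  obtain ⟨x0, hx0, hmax⟩ := isCompact_Icc.exists_isMaxOn (s := Icc (-1:ℝ) 1) ⟨0, by norm_num⟩ (h.cont.abs.continuousOn)
  have hmax' : ∀ y ∈ Icc (-1:ℝ) 1, |ψ y| ≤ |ψ x0| := fun y hy => hmax hy
  have hder0 : ∀ y ∈ Icc (0:ℝ) 1, |deriv ψ y| ≤ c^2 * |ψ x0| := by
    intro y hy
    have := R.deriv_bound (a := 0) (L := c^2 * |ψ x0|) le_rfl (fun w hw => by
      rw [abs_mul]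
      apply mul_le_mul _ (hmax' w ⟨by linarith [hw.1], hw.2⟩) (abs_nonneg _) (by positivity)
      have : c^2*w^2 ≤ c^2 := by nlinarith [sq_nonneg c, hw.1, hw.2, mul_nonneg (sq_nonneg c) (show 0 ≤ 1 - w^2 by nlinarith [hw.1, hw.2])]
      rw [_root_.abs_le]; constructor <;> nlinarith [sq_nonneg (c*w)]) hy
    nlinarith [abs_nonneg (deriv ψ y), hy.1]
  have hder : ∀ y ∈ Icc (-1:ℝ) 1, |deriv ψ y| ≤ c^2 * |ψ x0| := by
    intro y hy
    rcases le_total 0 y with h0 | h0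
    · exact hder0 y ⟨h0, hy.2⟩
    · have := hder0 (-y) ⟨by linarith, by linarith [hy.1]⟩
      rwa [h.abs_parity'] at this
  have hM := sup_sq_le (K := c^2) (by nlinarith) R.d1 h.cont h.normalized hder hx0 rfl
  have hM2 : |ψ x0| ≤ 3*c := by
    apply abs_le_of_sq_le_sq' _ (by linarith) |>.2
    nlinarith
  have hin : ∀ y ∈ Icc (-1:ℝ) 1, |ψ y| ≤ 3*c := fun y hy => (hmax' y hy).trans hM2
  have hout : ∀ y : ℝ, 1 ≤ y → |ψ y| ≤ 3*c := by
    intro y hy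
    have h1 : ψ y^2 ≤ ψ 1^2 := by
      rcases eq_or_lt_of_le hχ with he | hlt
      · have := le_of_hasDerivAt_nonneg (f := fun x => -(ψ x^2 + deriv ψ x^2 / c^2)) (f' := fun x => -(2 * ψ x * deriv ψ x + 2 * deriv ψ x * deriv (deriv ψ) x / c^2)) hy
          (by have := R.cont; have := R.cont'; fun_prop) (fun z _ => (((R.d1 z).pow 2).add (((R.d2 z).pow 2).div_const _)).neg.congr_deriv (by norm_num)) (fun z hz => by
            have ho := R.ode z
            rw [he] at ho
            have hz1 : 0 < z^2 - 1 := by nlinarith [hz.1]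
            have hz0 : 0 < z := by linarith [hz.1]
            have e : deriv (deriv ψ) z = - c^2 * ψ z - 2*z*deriv ψ z/(z^2-1) := by
              field_simp
              linarith
            rw [e]
            have e2 : -(2 * ψ z * deriv ψ z + 2 * deriv ψ z * (- c^2 * ψ z - 2*z*deriv ψ z/(z^2-1)) / c^2) = 4*z*deriv ψ z^2/(z^2-1)/c^2 := by
              field_simp; ring
            rw [e2]
            positivity)
        have h0 : deriv ψ 1 = 0 := by have ho := R.ode 1; rw [he] at ho; linarith
        simp only [h0] at this
        have : 0 ≤ deriv ψ y^2/c^2 := by positivity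
        norm_num at *
        linarith
      · have hq : ∀ z, 1 ≤ z → χ - c^2*z^2 < 0 := fun z hz => by nlinarith [mul_nonneg (sq_nonneg c) (show 0 ≤ z^2 - 1 by nlinarith)]
        have := le_of_hasDerivAt_nonneg (f := fun x => -(ψ x^2 + (1 - x^2) * deriv ψ x^2 / (χ - c^2*x^2))) hy
          (fun z hz => (R.dE (hq z hz.1).ne).neg.continuousAt.continuousWithinAt) (fun z hz => (R.dE (hq z hz.1.le).ne).neg) (fun z hz => by
            have h1 := hq z hz.1.le
            have hz1 : 0 < z^2 - 1 := by nlinarith [hz.1]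
            have hz0 : 0 < z := by linarith [hz.1]
            have a1 : 2*z*deriv ψ z^2/(χ - c^2*z^2) ≤ 0 := div_nonpos_of_nonneg_of_nonpos (by positivity) h1.le
            have a2 : (1-z^2) * deriv ψ z^2 * (2*c^2*z)/(χ - c^2*z^2)^2 ≤ 0 := by
              apply div_nonpos_of_nonpos_of_nonneg _ (sq_nonneg _)
              have : 0 ≤ (z^2-1) * deriv ψ z^2 * (2*c^2*z) := by positivity
              linarith
            linarith)
        have a3 : 0 ≤ (1 - y^2) * deriv ψ y^2 / (χ - c^2*y^2) := by
          apply div_nonneg_of_nonpos _ (hq y hy).le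
          nlinarith [mul_nonneg (show 0 ≤ y^2-1 by nlinarith) (sq_nonneg (deriv ψ y))]
        norm_num at this
        linarith
    exact (sq_le_sq.1 h1).trans (hin 1 (by norm_num))
  rcases le_total 0 x with h0 | h0
  · rcases le_total x 1 with h1 | h1
    · exact hin x ⟨by linarith, h1⟩
    · exact hout x h1
  · rw [← h.abs_parity]
    rcases le_total (-x) 1 with h1 | h1
    · exact hin (-x) ⟨by linarith, h1⟩
    · exact hout (-x) h1
end

/-- case A -/
theorem fmH_caseA {c : ℝ} {m n : ℕ} {ψm ψn : ℝ → ℝ} {lm ln : ℂ} {χm χn : ℝ}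
    (hm : ProlateDatum c m ψm lm χm) (hn : ProlateDatum c n ψn ln χn) (hc : 1 ≤ c) (hχ : χm ≤ c^2) {z : ℂ} {d : ℝ} (hd : 0 < d)
    (hz : ∀ t ∈ Icc (-1:ℝ) 1, d ≤ ‖z - t‖) : ‖ent c ψm lm z * Hc ψn z‖ ≤ 9/2*c/d * exp (c * |z.im|) := by
  rw [norm_mul]
  have h1 := hm.ent_PL (by linarith) (hm.sup_real hc hχ) z
  have h2 := hn.Hc_le hd hz
  calc _ ≤ (3*c*exp (c * |z.im|)) * (3/2/d) := mul_le_mul h1 h2 (norm_nonneg _) (by positivity)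
    _ = _ := by ring

theorem ProlateDatum.int_abs_half {c χ : ℝ} {k : ℕ} {ψ : ℝ → ℝ} {lam : ℂ} (h : ProlateDatum c k ψ lam χ) : ∫ t in (0:ℝ)..1, |ψ t| ≤ 3/4 := by
  have hcont := h.cont.abs
  have h1 := intervalIntegral.integral_add_adjacent_intervals (hcont.intervalIntegrable (μ := volume) (-1) 0) (hcont.intervalIntegrable 0 1)
  have h2 := intervalIntegral.integral_comp_neg (a := (0:ℝ)) (b := 1) (fun x => |ψ x|)
  simp only [h.abs_parity, neg_zero] at h2
  have := h.int_abs
  linarith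

theorem exp_diff (c x t : ℝ) (z : ℂ) : Complex.exp (Complex.I * c * z * x) - Complex.exp (Complex.I * c * t * x) =
    (z - t) * ∫ v in (0:ℝ)..1, Complex.I * c * x * Complex.exp (Complex.I * c * ((1 - v) * z + v * t) * x) := by
  have hd : ∀ v ∈ uIcc (0:ℝ) 1, HasDerivAt (fun v : ℝ => -Complex.exp (Complex.I * c * ((1 - v) * z + v * t) * x))
      ((z - t) * (Complex.I * c * x * Complex.exp (Complex.I * c * ((1 - v) * z + v * t) * x))) v := by
    intro v _
    have h0 : HasDerivAt (fun v : ℝ => (v:ℂ)) 1 v := Complex.ofRealCLM.hasDerivAt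
    have h1 : HasDerivAt (fun v : ℝ => Complex.I * c * ((1 - (v:ℂ)) * z + v * t) * x) (Complex.I * c * (-1 * z + 1 * t) * x) v :=
      ((((h0.const_sub 1).mul_const z).add (h0.mul_const (t:ℂ))).const_mul (Complex.I * c)).mul_const (x:ℂ)
    exact h1.cexp.neg.congr_deriv (by ring)
  rw [← intervalIntegral.integral_const_mul, intervalIntegral.integral_eq_sub_of_hasDerivAt hd (Continuous.intervalIntegrable (by fun_prop) _ _)]
  simp
  ring

theorem fmH_caseB {c : ℝ} {m n : ℕ} {ψm ψn : ℝ → ℝ} {lm ln : ℂ} {χm χn : ℝ}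
    (hm : ProlateDatum c m ψm lm χm) (hn : ProlateDatum c n ψn ln χn) (hc : 1 ≤ c) {z : ℂ} {d : ℝ} (hd : 0 < d)
    (hz : ∀ t ∈ Icc (-1:ℝ) 1, d ≤ ‖z - t‖) : ‖ent c ψm lm z * Hc ψn z‖ ≤ 1/d + 9/8*c*(‖ln‖/‖lm‖) * exp (c * |z.im|) := by
  have hc0 : 0 < c := by linarith
  have cm : Continuous fun t => (ψm t : ℂ) := Complex.continuous_ofReal.comp hm.cont
  have cn : Continuous fun t => (ψn t : ℂ) := Complex.continuous_ofReal.comp hn.cont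
  have hcm := hm.cont
  have hcn := hn.cont
  have hz0 : ∀ t ∈ Icc (-1:ℝ) 1, z - t ≠ 0 := fun t ht h0 => by
    have := hz t ht
    rw [h0, norm_zero] at this
    linarith
  -- the kernel
  set q : ℝ → ℝ → ℂ := fun t x => (Complex.exp (Complex.I * c * z * x) - Complex.exp (Complex.I * c * t * x)) / (z - t) with hq
  have hqv : ∀ t ∈ Icc (-1:ℝ) 1, ∀ x, q t x = ∫ v in (0:ℝ)..1, Complex.I * c * x * Complex.exp (Complex.I * c * ((1 - v) * z + v * t) * x) := by
    intro t ht x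
    simp only [hq]
    rw [exp_diff, mul_div_cancel_left₀ _ (hz0 t ht)]
  have hqc : ContinuousOn (Function.uncurry q) (Icc (-1:ℝ) 1 ×ˢ Icc (-1:ℝ) 1) := by
    apply ContinuousOn.div (by fun_prop) (by fun_prop)
    rintro ⟨t, x⟩ ⟨ht, _⟩
    exact hz0 t ht
  have hentz : ∀ t ∈ Icc (-1:ℝ) 1, (ent c ψm lm z - ψm t) / (z - t) = lm⁻¹ * ∫ x in (-1:ℝ)..1, (ψm x : ℂ) * q t x := by
    intro t ht
    have e1 : (ψm t : ℂ) = lm⁻¹ * ∫ x in (-1:ℝ)..1, (ψm x : ℂ) * Complex.exp (Complex.I * c * t * x) := by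
      rw [← hm.integral_eig, inv_mul_cancel_left₀ hm.lam_ne_zero]
    rw [e1]
    unfold ent
    rw [← mul_sub, ← intervalIntegral.integral_sub (Continuous.intervalIntegrable (by fun_prop) _ _) (Continuous.intervalIntegrable (by fun_prop) _ _),
      mul_div_assoc, ← intervalIntegral.integral_div]
    congr 1
    apply intervalIntegral.integral_congr
    intro x _
    simp only [hq]
    ring
  have hF : ContinuousOn (Function.uncurry fun t x => (ψn t : ℂ) * ((ψm x : ℂ) * q t x)) (Icc (-1:ℝ) 1 ×ˢ Icc (-1:ℝ) 1) := by
    have c1 : Continuous fun p : ℝ × ℝ => (ψn p.1 : ℂ) := cn.comp continuous_fst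
    have c2 : Continuous fun p : ℝ × ℝ => (ψm p.2 : ℂ) := cm.comp continuous_snd
    exact c1.continuousOn.mul (c2.continuousOn.mul hqc)
  have hsplit : ent c ψm lm z * Hc ψn z = (∫ t in (-1:ℝ)..1, (ψn t : ℂ) * ψm t / (z - t)) +
      lm⁻¹ * ∫ x in (-1:ℝ)..1, (ψm x : ℂ) * ∫ t in (-1:ℝ)..1, (ψn t : ℂ) * q t x := by
    have i1 : IntervalIntegrable (fun t : ℝ => (ψn t : ℂ) * ψm t / (z - t)) volume (-1) 1 := by
      apply ContinuousOn.intervalIntegrable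
      rw [uIcc_of_le (by norm_num)]
      exact ContinuousOn.div (by fun_prop) (by fun_prop) hz0
    have i2 : IntervalIntegrable (fun t : ℝ => (ψn t : ℂ) * ((ent c ψm lm z - ψm t) / (z - t))) volume (-1) 1 := by
      apply ContinuousOn.intervalIntegrable
      rw [uIcc_of_le (by norm_num)]
      exact ContinuousOn.mul (by fun_prop) (ContinuousOn.div (by fun_prop) (by fun_prop) hz0)
    have e1 : ent c ψm lm z * Hc ψn z = (∫ t in (-1:ℝ)..1, (ψn t : ℂ) * ψm t / (z - t)) +
        ∫ t in (-1:ℝ)..1, (ψn t : ℂ) * ((ent c ψm lm z - ψm t) / (z - t)) := by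
      unfold Hc
      rw [← intervalIntegral.integral_add i1 i2, ← intervalIntegral.integral_const_mul]
      apply intervalIntegral.integral_congr
      intro t _
      simp only
      ring
    rw [e1]
    congr 1
    have e2 : ∫ t in (-1:ℝ)..1, (ψn t : ℂ) * ((ent c ψm lm z - ψm t) / (z - t)) =
        ∫ t in (-1:ℝ)..1, lm⁻¹ * ∫ x in (-1:ℝ)..1, (ψn t : ℂ) * ((ψm x : ℂ) * q t x) := by
      apply intervalIntegral.integral_congr
      intro t ht
      rw [uIcc_of_le (by norm_num)] at ht
      simp only
      rw [hentz t ht, intervalIntegral.integral_const_mul]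
      ring
    rw [e2, intervalIntegral.integral_const_mul, swap_cont (by norm_num) (by norm_num) hF]
    congr 1
    apply intervalIntegral.integral_congr
    intro x _
    simp only
    rw [← intervalIntegral.integral_const_mul]
    apply intervalIntegral.integral_congr
    intro t _
    simp only
    ring
  have hPhi : ∀ x ∈ Icc (-1:ℝ) 1, ∫ t in (-1:ℝ)..1, (ψn t : ℂ) * q t x =
      ∫ v in (0:ℝ)..1, Complex.I * c * x * Complex.exp (Complex.I * c * ((1 - v) * z) * x) * (ln * ψn (v * x)) := by
    intro x _
    have e1 : ∫ t in (-1:ℝ)..1, (ψn t : ℂ) * q t x = ∫ t in (-1:ℝ)..1, ∫ v in (0:ℝ)..1,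
        (ψn t : ℂ) * (Complex.I * c * x * Complex.exp (Complex.I * c * ((1 - v) * z + v * t) * x)) := by
      apply intervalIntegral.integral_congr
      intro t ht
      rw [uIcc_of_le (by norm_num)] at ht
      simp only
      rw [hqv t ht, ← intervalIntegral.integral_const_mul]
    rw [e1, swap_cont (by norm_num) (by norm_num) (Continuous.continuousOn (by
      have c1 : Continuous fun p : ℝ × ℝ => (ψn p.1 : ℂ) := cn.comp continuous_fst
      exact c1.mul (by fun_prop)))]
    apply intervalIntegral.integral_congr
    intro v _
    simp only
    rw [hn.integral_eig, ← intervalIntegral.integral_const_mul]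
    apply intervalIntegral.integral_congr
    intro t _
    simp only
    rw [show Complex.I * c * ((1 - v) * z + v * t) * x = Complex.I * c * ((1 - v) * z) * x + Complex.I * c * ((v * x : ℝ) : ℂ) * t by push_cast; ring,
      Complex.exp_add]
    ring
  have hPhib : ∀ x ∈ Icc (-1:ℝ) 1, ‖∫ t in (-1:ℝ)..1, (ψn t : ℂ) * q t x‖ ≤ c * ‖ln‖ * exp (c * |z.im|) * (3/4) := by
    intro x hx
    rw [hPhi x hx]
    have hx1 : |x| ≤ 1 := abs_le.2 hx
    have hnx : ∀ v, |ψn (v * x)| = |ψn (|x| * v)| := by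
      intro v
      rcases abs_choice x with h | h
      · rw [h, mul_comm]
      · rw [h, ← hn.abs_parity]; congr 2; ring
    calc _ ≤ ∫ v in (0:ℝ)..1, c * ‖ln‖ * exp (c * |z.im|) * (|x| * |ψn (|x| * v)|) := by
          apply intervalIntegral.norm_integral_le_of_norm_le (by norm_num) _ (Continuous.intervalIntegrable (by fun_prop) _ _)
          refine Filter.Eventually.of_forall fun v hv => ?_
          have hE : ‖Complex.exp (Complex.I * c * ((1 - v) * z) * x)‖ ≤ exp (c * |z.im|) := by
            rw [norm_cexp_ict]
            apply exp_le_exp.2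
            have e : ((1 - (v:ℂ)) * z).im = (1 - v) * z.im := by
              rw [← Complex.ofReal_one, ← Complex.ofReal_sub, Complex.im_ofReal_mul]
            rw [e]
            have h2 : -((1-v) * z.im * x) ≤ |z.im| := by
              calc _ ≤ |(1-v) * z.im * x| := neg_le_abs _
                _ = (1-v) * |z.im| * |x| := by rw [abs_mul, abs_mul, abs_of_nonneg (by linarith [hv.2])]
                _ ≤ 1 * |z.im| * 1 := by
                  have : 1 - v ≤ 1 := by linarith [hv.1]
                  have : 0 ≤ 1 - v := by linarith [hv.2]
                  gcongr
                _ = _ := by ring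
            nlinarith
          rw [norm_mul, norm_mul, norm_mul, norm_mul, norm_mul, Complex.norm_I, Complex.norm_real, Complex.norm_real, Complex.norm_real,
            norm_of_nonneg hc0.le, norm_eq_abs, norm_eq_abs, hnx]
          calc _ = c * ‖ln‖ * (|x| * |ψn (|x| * v)|) * ‖Complex.exp (Complex.I * c * ((1 - v) * z) * x)‖ := by ring
            _ ≤ c * ‖ln‖ * (|x| * |ψn (|x| * v)|) * exp (c * |z.im|) := by gcongr
            _ = _ := by ring
      _ = c * ‖ln‖ * exp (c * |z.im|) * ∫ u in (0:ℝ)..|x|, |ψn u| := by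
          rw [intervalIntegral.integral_const_mul, intervalIntegral.integral_const_mul, intervalIntegral.mul_integral_comp_mul_left (f := fun u => |ψn u|), mul_zero, mul_one]
      _ ≤ _ := by
          apply mul_le_mul_of_nonneg_left _ (by positivity)
          refine le_trans ?_ hn.int_abs_half
          apply intervalIntegral.integral_mono_interval le_rfl (abs_nonneg x) hx1 (Filter.Eventually.of_forall fun u => abs_nonneg _)
            (hcn.abs.intervalIntegrable _ _)
  rw [hsplit]
  refine (norm_add_le _ _).trans (add_le_add ?_ ?_)
  · calc _ ≤ ∫ t in (-1:ℝ)..1, (1/2 * ψn t^2 + 1/2 * ψm t^2) / d := by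
          apply intervalIntegral.norm_integral_le_of_norm_le (by norm_num) _ (Continuous.intervalIntegrable (by fun_prop) _ _)
          refine Filter.Eventually.of_forall fun t ht => ?_
          rw [norm_div, norm_mul, Complex.norm_real, Complex.norm_real, norm_eq_abs, norm_eq_abs]
          apply div_le_div₀ (by positivity) _ hd (hz t (Ioc_subset_Icc_self ht))
          nlinarith only [sq_nonneg (|ψn t| - |ψm t|), sq_abs (ψn t), sq_abs (ψm t)]
      _ = 1/d := by
          rw [intervalIntegral.integral_div, intervalIntegral.integral_add (Continuous.intervalIntegrable (by fun_prop) _ _) (Continuous.intervalIntegrable (by fun_prop) _ _),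
            intervalIntegral.integral_const_mul, intervalIntegral.integral_const_mul, hn.normalized, hm.normalized]
          norm_num
  · rw [norm_mul, norm_inv]
    have : ‖∫ x in (-1:ℝ)..1, (ψm x : ℂ) * ∫ t in (-1:ℝ)..1, (ψn t : ℂ) * q t x‖ ≤ 3/2 * (c * ‖ln‖ * exp (c * |z.im|) * (3/4)) := by
      calc _ ≤ ∫ x in (-1:ℝ)..1, |ψm x| * (c * ‖ln‖ * exp (c * |z.im|) * (3/4)) := by
            apply intervalIntegral.norm_integral_le_of_norm_le (by norm_num) _ (Continuous.intervalIntegrable (by fun_prop) _ _)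
            refine Filter.Eventually.of_forall fun x hx => ?_
            rw [norm_mul, Complex.norm_real, norm_eq_abs]
            exact mul_le_mul_of_nonneg_left (hPhib x (Ioc_subset_Icc_self hx)) (abs_nonneg _)
        _ = (∫ x in (-1:ℝ)..1, |ψm x|) * (c * ‖ln‖ * exp (c * |z.im|) * (3/4)) := by rw [intervalIntegral.integral_mul_const]
        _ ≤ _ := mul_le_mul_of_nonneg_right hm.int_abs (by positivity)
    calc _ ≤ ‖lm‖⁻¹ * (3/2 * (c * ‖ln‖ * exp (c * |z.im|) * (3/4))) := by gcongr
      _ = _ := by rw [div_eq_mul_inv]; ring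

theorem sign_const {f : ℝ → ℝ} (hf : Continuous f) {a b : ℝ} (h : ∀ x ∈ Ioo a b, f x ≠ 0) :
    (∀ x ∈ Ioo a b, 0 < f x) ∨ (∀ x ∈ Ioo a b, f x < 0) := by
  by_contra hcon
  push Not at hcon
  obtain ⟨⟨x, hx, hx1⟩, y, hy, hy1⟩ := hcon
  have := isPreconnected_Ioo.intermediate_value hx hy hf.continuousOn ⟨hx1, hy1⟩
  obtain ⟨z, hz, hz0⟩ := this
  exact h z hz hz0

/-- derivative at a left-end zero of a positive function is nonnegative -/
theorem deriv_nonneg_left {f : ℝ → ℝ} {f' a b : ℝ} (hab : a < b) (hd : HasDerivAt f f' a) (h0 : f a = 0)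
    (hp : ∀ x ∈ Ioo a b, 0 < f x) : 0 ≤ f' := by
  have h1 := hd.hasDerivWithinAt (s := Ioi a)
  have h2 := (hasDerivWithinAt_iff_tendsto_slope' (by simp : a ∉ Ioi a)).1 h1
  refine ge_of_tendsto h2 ?_
  filter_upwards [Ioo_mem_nhdsGT hab] with x hx
  rw [slope_def_field, h0, sub_zero]
  exact div_nonneg (hp x hx).le (by linarith [hx.1])

theorem deriv_nonpos_right {f : ℝ → ℝ} {f' a b : ℝ} (hab : a < b) (hd : HasDerivAt f f' b) (h0 : f b = 0)
    (hp : ∀ x ∈ Ioo a b, 0 < f x) : f' ≤ 0 := by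
  have h1 : HasDerivAt (fun x => f (-x)) (-f') (-b) := by
    have := HasDerivAt.comp (-b) (h₂ := f) (by rwa [neg_neg]) (hasDerivAt_neg (-b))
    exact this.congr_deriv (by ring)
  have := deriv_nonneg_left (a := -b) (b := -a) (by linarith) h1 (by simpa using h0) (by
    intro x hx
    exact hp (-x) ⟨by linarith [hx.2], by linarith [hx.1]⟩)
  linarith

section
variable {c χ χ₂ : ℝ} {ψ ψ' ψ'' g g' g'' : ℝ → ℝ}

theorem sturm_pos (h : RODE c χ ψ ψ' ψ'') (hg : RODE c χ₂ g g' g'') (hχ : χ < χ₂) {a b : ℝ} (hab : a < b)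
    (ha : a ∈ Icc (-1:ℝ) 1) (hb : b ∈ Icc (-1:ℝ) 1) (ha0 : a = -1 ∨ ψ a = 0) (hb0 : b = 1 ∨ ψ b = 0)
    (hp : ∀ x ∈ Ioo a b, 0 < ψ x) (hgp : ∀ x ∈ Ioo a b, 0 < g x) : False := by
  have hga : 0 ≤ g a ∧ 0 ≤ g b := by
    have : ∀ x ∈ Icc a b, 0 ≤ g x := by
      rw [← closure_Ioo hab.ne]
      intro x hx
      exact closure_minimal (fun y hy => (hgp y hy).le) (isClosed_le continuous_const hg.cont) hx
    exact ⟨this a (left_mem_Icc.2 hab.le), this b (right_mem_Icc.2 hab.le)⟩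
  have hd : ∀ x, HasDerivAt (fun x => ψ x * ((1 - x^2) * g' x) - g x * ((1-x^2) * ψ' x)) ((χ - χ₂) * (ψ x * g x)) x := by
    intro x
    refine (((h.d1 x).mul (hg.dw x)).sub ((hg.d1 x).mul (h.dw x))).congr_deriv ?_
    ring
  have hcont : Continuous (fun x => ψ x * ((1 - x^2) * g' x) - g x * ((1-x^2) * ψ' x)) :=
    continuous_iff_continuousAt.2 fun x => (hd x).continuousAt
  have hanti := strictAntiOn_of_deriv_neg (convex_Icc a b) hcont.continuousOn (by
    intro x hx
    rw [interior_Icc] at hx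
    rw [(hd x).deriv]
    exact mul_neg_of_neg_of_pos (by linarith) (mul_pos (hp x hx) (hgp x hx)))
  have := hanti (left_mem_Icc.2 hab.le) (right_mem_Icc.2 hab.le) hab
  simp only at this
  have h1 : ψ a * ((1 - a^2) * g' a) - g a * ((1-a^2) * ψ' a) ≤ 0 := by
    rcases ha0 with h0 | h0
    · rw [h0]; norm_num
    · have h2 := deriv_nonneg_left hab (h.d1 a) h0 hp
      have h3 : 0 ≤ 1 - a^2 := by nlinarith only [ha.1, ha.2]
      rw [h0]
      have := mul_nonneg hga.1 (mul_nonneg h3 h2)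
      linarith
  have h2 : 0 ≤ ψ b * ((1 - b^2) * g' b) - g b * ((1-b^2) * ψ' b) := by
    rcases hb0 with h0 | h0
    · rw [h0]; norm_num
    · have h2 := deriv_nonpos_right hab (h.d1 b) h0 hp
      have h3 : 0 ≤ 1 - b^2 := by nlinarith only [hb.1, hb.2]
      rw [h0]
      have := mul_nonneg hga.2 (mul_nonneg h3 (by linarith : 0 ≤ - ψ' b))
      linarith
  linarith

theorem sturm_zero (h : RODE c χ ψ ψ' ψ'') (hg : RODE c χ₂ g g' g'') (hχ : χ < χ₂) {a b : ℝ} (hab : a < b)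
    (ha : a ∈ Icc (-1:ℝ) 1) (hb : b ∈ Icc (-1:ℝ) 1) (ha0 : a = -1 ∨ ψ a = 0) (hb0 : b = 1 ∨ ψ b = 0)
    (hp : ∀ x ∈ Ioo a b, ψ x ≠ 0) : ∃ x ∈ Ioo a b, g x = 0 := by
  by_contra hcon
  push Not at hcon
  have ha1 : a = -1 ∨ -ψ a = 0 := ha0.imp_right fun h => by rw [h, neg_zero]
  have hb1 : b = 1 ∨ -ψ b = 0 := hb0.imp_right fun h => by rw [h, neg_zero]
  rcases sign_const h.cont hp with h1 | h1 <;> rcases sign_const hg.cont hcon with h2 | h2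
  · exact sturm_pos h hg hχ hab ha hb ha0 hb0 h1 h2
  · exact sturm_pos h hg.neg hχ hab ha hb ha0 hb0 h1 (fun x hx => by linarith [h2 x hx])
  · exact sturm_pos h.neg hg hχ hab ha hb ha1 hb1 (fun x hx => by linarith [h1 x hx]) h2
  · exact sturm_pos h.neg hg.neg hχ hab ha hb ha1 hb1 (fun x hx => by linarith [h1 x hx]) (fun x hx => by linarith [h2 x hx])

end

theorem sturm_chi {c : ℝ} {m n : ℕ} {ψm ψn : ℝ → ℝ} {lm ln : ℂ} {χm χn : ℝ}
    (hm : ProlateDatum c m ψm lm χm) (hn : ProlateDatum c n ψn ln χn) (hmn : m < n) : χm ≤ χn := by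
  by_contra hcon
  push Not at hcon
  have fin : ∀ {k : ℕ} {ψ : ℝ → ℝ} {l : ℂ} {χ : ℝ}, ProlateDatum c k ψ l χ →
      ∃ A : Finset ℝ, A.card = k ∧ ∀ x, x ∈ A ↔ x ∈ Ioo (-1:ℝ) 1 ∧ ψ x = 0 := by
    intro k ψ l χ h
    have hf : {x : ℝ | x ∈ Set.Ioo (-1:ℝ) 1 ∧ ψ x = 0}.Finite := Set.finite_of_encard_eq_coe h.zeros_card
    refine ⟨hf.toFinset, ?_, ?_⟩
    · have := h.zeros_card
      rw [hf.encard_eq_coe_toFinset_card] at this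
      exact_mod_cast this
    · intro x; simp
  obtain ⟨A, hA, hA'⟩ := fin hn
  obtain ⟨B, hB, hB'⟩ := fin hm
  have key : ∀ a ∈ insert (-1:ℝ) A, ∃ b ∈ B, a < b ∧ ∀ a' ∈ A, a < a' → b < a' := by
    intro a ha
    have ha1 : a < 1 ∧ -1 ≤ a := by
      rcases Finset.mem_insert.1 ha with h | h
      · rw [h]; norm_num
      · have := ((hA' a).1 h).1; exact ⟨this.2, this.1.le⟩
    have hne : ((insert (1:ℝ) A).filter (a < ·)).Nonempty := ⟨1, by simp [ha1.1]⟩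
    set b := ((insert (1:ℝ) A).filter (a < ·)).min' hne with hb
    have hbm := Finset.min'_mem _ hne
    rw [← hb, Finset.mem_filter] at hbm
    have hbl : ∀ a' ∈ A, a < a' → b ≤ a' := fun a' h1 h2 =>
      Finset.min'_le _ _ (by rw [Finset.mem_filter]; exact ⟨Finset.mem_insert_of_mem h1, h2⟩)
    have hb1 : b ≤ 1 := Finset.min'_le _ _ (by simp [ha1.1])
    obtain ⟨x, hx, hx0⟩ := sturm_zero hn.rode hm.rode hcon hbm.2 ⟨ha1.2, ha1.1.le⟩ ⟨by linarith [hbm.2], hb1⟩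
      ((Finset.mem_insert.1 ha).imp_right fun h => ((hA' a).1 h).2)
      ((Finset.mem_insert.1 hbm.1).imp_right fun h => ((hA' b).1 h).2) (by
        intro x hx h0
        have : x ∈ A := (hA' x).2 ⟨⟨by linarith [hx.1], by linarith [hx.2]⟩, h0⟩
        linarith [hbl x this hx.1, hx.2])
    refine ⟨x, (hB' x).2 ⟨⟨by linarith [hx.1], by linarith [hx.2]⟩, hx0⟩, hx.1, fun a' h1 h2 => ?_⟩
    linarith [hbl a' h1 h2, hx.2]
  choose! f hf1 hf2 hf3 using key
  have hcard := Finset.card_le_card_of_injOn f hf1 (by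
    intro a ha a' ha' he
    have hlt : ∀ a ∈ insert (-1:ℝ) A, ∀ a' ∈ insert (-1:ℝ) A, a < a' → f a ≠ f a' := by
      intro a ha a' ha' h
      have h1 : a' ∈ A := by
        rcases Finset.mem_insert.1 ha' with h2 | h2
        · rcases Finset.mem_insert.1 ha with h3 | h3
          · linarith
          · linarith [((hA' a).1 h3).1.1]
        · exact h2
      have := hf3 a ha a' h1 h
      have := hf2 a' ha'
      linarith
    rcases lt_trichotomy a a' with h | h | h
    · exact absurd he (hlt a ha a' ha' h)
    · exact h
    · exact absurd he.symm (hlt a' ha' a ha h))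
  rw [Finset.card_insert_of_notMem (by intro h; linarith [((hA' _).1 h).1.1]), hA, hB] at hcard
  omega

/-- ODE on the imaginary axis -/
structure IODE (c χ : ℝ) (a a' : ℝ → ℝ) : Prop where
  d1 : ∀ y, HasDerivAt a (a' y) y
  dw : ∀ y, HasDerivAt (fun y => (1 + y^2) * a' y) ((χ + c^2*y^2) * a y) y

section
variable {c χ χ₂ : ℝ} {a a' b b' : ℝ → ℝ}

theorem IODE.neg (h : IODE c χ a a') : IODE c χ (fun y => -a y) (fun y => -a' y) :=
  ⟨fun y => (h.d1 y).neg, fun y => by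
    have := (h.dw y).neg
    refine (this.congr_of_eventuallyEq (Filter.Eventually.of_forall fun x => ?_)).congr_deriv (by ring)
    simp⟩

theorem IODE.mul_nonneg' (h : IODE c χ a a') (hχ : 0 ≤ χ) (h0 : a 0 * a' 0 = 0) {y : ℝ} (hy : 0 ≤ y) :
    0 ≤ a y * a' y := by
  have hd : ∀ y, HasDerivAt (fun y => a y * ((1+y^2) * a' y)) (a' y * ((1+y^2)*a' y) + a y * ((χ + c^2*y^2) * a y)) y :=
    fun y => (h.d1 y).mul (h.dw y)
  have hcont : Continuous (fun y => a y * ((1+y^2) * a' y)) := continuous_iff_continuousAt.2 fun x => (hd x).continuousAt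
  have := le_of_hasDerivAt_nonneg hy hcont.continuousOn (fun x _ => hd x) (fun x _ => by
    have e : a' x * ((1+x^2)*a' x) + a x * ((χ + c^2*x^2) * a x) = (1+x^2) * a' x^2 + (χ + c^2*x^2)*a x^2 := by ring
    rw [e]; positivity)
  have h1 : 0 ≤ (1+y^2) * (a y * a' y) := by
    have e : a 0 * ((1+0^2)*a' 0) = a 0 * a' 0 := by ring
    rw [e, h0] at this
    linarith
  exact nonneg_of_mul_nonneg_right h1 (by positivity)

theorem IODE.sq_mono (h : IODE c χ a a') (hχ : 0 ≤ χ) (h0 : a 0 * a' 0 = 0) {y : ℝ} (hy : 0 ≤ y) :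
    a 0^2 ≤ a y^2 := by
  have hc : Continuous a := continuous_iff_continuousAt.2 fun x => (h.d1 x).continuousAt
  refine le_of_hasDerivAt_nonneg (f := fun y => a y^2) hy (hc.pow 2).continuousOn (fun x _ => (h.d1 x).pow 2) (fun x hx => ?_)
  have := h.mul_nonneg' hχ h0 hx.1.le
  simp only [Nat.cast_ofNat, Nat.add_one_sub_one, pow_one]
  linarith

theorem IODE.pos_even (h : IODE c χ a a') (hχ : 0 ≤ χ) (h0 : 0 < a 0) (h1 : a' 0 = 0) {y : ℝ} (hy : 0 ≤ y) :
    0 < a y ∧ 0 ≤ a' y := by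
  have hc : Continuous a := continuous_iff_continuousAt.2 fun x => (h.d1 x).continuousAt
  have h00 : a 0 * a' 0 = 0 := by rw [h1, mul_zero]
  have hpos : 0 < a y := by
    by_contra hcon
    push Not at hcon
    obtain ⟨x, hx, hx0⟩ := intermediate_value_Icc' hy hc.continuousOn ⟨hcon, h0.le⟩
    have := h.sq_mono hχ h00 hx.1
    rw [hx0] at this
    nlinarith
  exact ⟨hpos, nonneg_of_mul_nonneg_right (h.mul_nonneg' hχ h00 hy) hpos⟩

theorem IODE.odd_ge (h : IODE c χ a a') (hχ : 0 ≤ χ) (h0 : a 0 = 0) (h1 : 0 < a' 0) {y : ℝ} (hy : 0 ≤ y) :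
    a' 0 * y / (1+y^2) ≤ a y := by
  have hc : Continuous a := continuous_iff_continuousAt.2 fun x => (h.d1 x).continuousAt
  have hcw : Continuous (fun y => (1+y^2) * a' y) := continuous_iff_continuousAt.2 fun x => (h.dw x).continuousAt
  have h00 : a 0 * a' 0 = 0 := by rw [h0, zero_mul]
  have hwsq : ∀ y, 0 ≤ y → a' 0^2 ≤ ((1+y^2)*a' y)^2 := by
    intro y hy
    have := le_of_hasDerivAt_nonneg (f := fun y => ((1+y^2)*a' y)^2) hy (hcw.pow 2).continuousOn (fun x _ => (h.dw x).pow 2) (fun x hx => by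
      have := h.mul_nonneg' hχ h00 hx.1.le
      simp only [Nat.cast_ofNat, Nat.add_one_sub_one, pow_one]
      have e : 2 * ((1+x^2)*a' x) * ((χ + c^2*x^2) * a x) = 2 * (1+x^2) * (χ + c^2*x^2) * (a x * a' x) := by ring
      rw [e]; positivity)
    simpa using this
  have hw : ∀ y, 0 ≤ y → a' 0 ≤ (1+y^2)*a' y := by
    intro y hy
    have hpos : 0 < (1+y^2)*a' y := by
      by_contra hcon
      push Not at hcon
      obtain ⟨x, hx, hx0⟩ := intermediate_value_Icc' hy hcw.continuousOn ⟨hcon, by simpa using h1.le⟩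
      have := hwsq x hx.1
      simp only at hx0
      rw [hx0] at this
      nlinarith
    exact abs_le_of_sq_le_sq' (hwsq y hy) hpos.le |>.2
  have := le_of_hasDerivAt_nonneg (f := fun x => a x - a' 0 / (1+y^2) * x) hy (by fun_prop)
    (fun x _ => (h.d1 x).sub ((hasDerivAt_id x).const_mul (a' 0 / (1+y^2)))) (fun x hx => by
      have h2 := hw x hx.1.le
      have h3 : 0 ≤ a' x := by
        have : 0 ≤ (1+x^2) * a' x := by linarith
        exact nonneg_of_mul_nonneg_right this (by positivity)
      have : a' 0 / (1+y^2) ≤ a' x := by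
        rw [div_le_iff₀ (by positivity)]
        have : x^2 ≤ y^2 := by nlinarith only [hx.1, hx.2]
        nlinarith only [this, h2, h3]
      linarith)
  rw [h0] at this
  have e : a' 0 * y / (1+y^2) = a' 0 / (1+y^2) * y := by ring
  rw [e]
  linarith

theorem IODE.even_le (h : IODE c χ a a') (hχ : 0 ≤ χ) (h0 : 0 < a 0) (h1 : a' 0 = 0) {y : ℝ} (hy : 0 ≤ y) :
    a y ≤ a 0 * exp ((χ + c^2*y^2) * y^2/2) := by
  have hc : Continuous a := continuous_iff_continuousAt.2 fun x => (h.d1 x).continuousAt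
  set Q := χ + c^2*y^2 with hQ
  have hQ0 : 0 ≤ Q := by positivity
  have hle : ∀ x ∈ Icc 0 y, a' x ≤ Q * x * a x := by
    intro x hx
    have hd : ∀ u, HasDerivAt (fun u => Q * u * a u - (1+u^2) * a' u) (Q * 1 * a u + Q * u * a' u - (χ + c^2*u^2)* a u) u :=
      fun u => ((((hasDerivAt_id u).const_mul Q).mul (h.d1 u)).sub (h.dw u))
    have hcont : Continuous (fun u => Q * u * a u - (1+u^2) * a' u) := continuous_iff_continuousAt.2 fun x => (hd x).continuousAt
    have := le_of_hasDerivAt_nonneg hx.1 hcont.continuousOn (fun x _ => hd x) (fun u hu => by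
      obtain ⟨h2, h3⟩ := h.pos_even hχ h0 h1 hu.1.le
      have h4 : χ + c^2*u^2 ≤ Q := by
        have : u^2 ≤ y^2 := by nlinarith only [hu.1, hu.2, hx.2]
        have := mul_le_mul_of_nonneg_left this (sq_nonneg c)
        linarith
      have h5 : 0 ≤ Q * u * a' u := mul_nonneg (mul_nonneg hQ0 hu.1.le) h3
      nlinarith only [h2, h4, h5])
    simp only [h1, mul_zero, zero_mul, sub_zero] at this
    have h3 := (h.pos_even hχ h0 h1 hx.1).2
    nlinarith only [this, h3, mul_nonneg (sq_nonneg x) h3]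
  have := growth_of_hasDerivAt (f := fun x => - a x) (θ := fun x => Q * x^2/2) (θ' := fun x => Q * x) hy
    hc.neg.continuousOn (by fun_prop) (fun x _ => (h.d1 x).neg) (fun x _ => by
      refine (((hasDerivAt_pow 2 x).const_mul Q).div_const 2).congr_deriv (by simp; ring)) (fun x hx => by
      have := hle x ⟨hx.1.le, hx.2.le⟩
      linarith)
  rw [show Q * y^2/2 - Q * 0^2/2 = Q * y^2/2 by ring] at this
  linarith

theorem IODE.ratio (h : IODE c χ a a') (hb : IODE c χ₂ b b') (hχ : χ ≤ χ₂) (ha0 : ∀ y, 0 ≤ y → 0 ≤ a y)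
    (hW0 : b 0 * a' 0 - a 0 * b' 0 ≤ 0) {y0 Y : ℝ} (hy0 : 0 ≤ y0) (hY : y0 ≤ Y) (hb0 : ∀ y, 0 ≤ y → 0 ≤ b y)
    (hb1 : ∀ y, y0 ≤ y → 0 < b y) : a Y / b Y ≤ a y0 / b y0 := by
  have hca : Continuous a := continuous_iff_continuousAt.2 fun x => (h.d1 x).continuousAt
  have hcb : Continuous b := continuous_iff_continuousAt.2 fun x => (hb.d1 x).continuousAt
  have hW : ∀ y, 0 ≤ y → b y * ((1+y^2) * a' y) - a y * ((1+y^2) * b' y) ≤ 0 := by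
    intro y hy
    have hd : ∀ y, HasDerivAt (fun y => -(b y * ((1+y^2) * a' y) - a y * ((1+y^2) * b' y))) ((χ₂ - χ) * (a y * b y)) y := by
      intro y
      refine (((hb.d1 y).mul (h.dw y)).sub ((h.d1 y).mul (hb.dw y))).neg.congr_deriv (by ring)
    have hcont : Continuous (fun y => -(b y * ((1+y^2) * a' y) - a y * ((1+y^2) * b' y))) := continuous_iff_continuousAt.2 fun x => (hd x).continuousAt
    have := le_of_hasDerivAt_nonneg hy hcont.continuousOn (fun x _ => hd x) (fun u hu =>
      mul_nonneg (by linarith) (mul_nonneg (ha0 u hu.1.le) (hb0 u hu.1.le)))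
    nlinarith only [this, hW0]
  have hq : ∀ x ∈ Icc y0 Y, HasDerivAt (fun x => - (a x / b x)) (-((a' x * b x - a x * b' x)/b x^2)) x := fun x hx =>
    ((h.d1 x).div (hb.d1 x) (hb1 x hx.1).ne').neg
  have := le_of_hasDerivAt_nonneg hY (fun x hx => (hq x hx).continuousAt.continuousWithinAt) (fun x hx => hq x ⟨hx.1.le, hx.2.le⟩) (fun x hx => by
    have h1 := hW x (by linarith [hx.1])
    have h2 : 0 ≤ (1+x^2) * (-(a' x * b x - a x * b' x)) := by linarith
    have h3 := nonneg_of_mul_nonneg_right h2 (by positivity)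
    rw [← neg_div]
    exact div_nonneg h3 (sq_nonneg _))
  linarith
end

section
variable {c χ : ℝ} {ψ : ℝ → ℝ} {f : ℂ → ℂ}

theorem CODE.im_d1 (h : CODE c χ ψ f) (y : ℝ) :
    HasDerivAt (fun y : ℝ => f (y * Complex.I)) (deriv f (y * Complex.I) * Complex.I) y := by
  have h1 : HasDerivAt (fun y : ℝ => (y:ℂ) * Complex.I) Complex.I y := by
    simpa using (Complex.ofRealCLM.hasDerivAt (x := y)).mul_const Complex.I
  exact (h.diff (y * Complex.I)).hasDerivAt.comp_of_eq y h1 rfl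

theorem CODE.im_dw (h : CODE c χ ψ f) (y : ℝ) :
    HasDerivAt (fun y : ℝ => (1 + (y:ℂ)^2) * (deriv f (y * Complex.I) * Complex.I)) ((χ + c^2*y^2) * f (y * Complex.I)) y := by
  have h0 : HasDerivAt (fun y : ℝ => (y:ℂ)) 1 y := by
    simpa using (hasDerivAt_id y).ofReal_comp
  have h1 : HasDerivAt (fun y : ℝ => (y:ℂ) * Complex.I) Complex.I y := by
    simpa using h0.mul_const Complex.I
  have h2 : HasDerivAt (fun y : ℝ => deriv f (y * Complex.I)) (deriv (deriv f) (y * Complex.I) * Complex.I) y :=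
    (h.diff' (y * Complex.I)).hasDerivAt.comp_of_eq y h1 rfl
  refine ((((h0.fun_pow 2).const_add 1)).mul (h2.mul_const Complex.I)).congr_deriv ?_
  have h3 := h.ode (y * Complex.I)
  simp only [mul_pow, Complex.I_sq] at h3
  simp only [Nat.cast_ofNat, Nat.add_one_sub_one, pow_one, mul_one]
  linear_combination -h3 + (1 + (y:ℂ)^2) * deriv (deriv f) (y * Complex.I) * Complex.I_sq

theorem CODE.iode_re (h : CODE c χ ψ f) :
    IODE c χ (fun y => (f (y * Complex.I)).re) (fun y => (deriv f (y * Complex.I) * Complex.I).re) := by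
  refine ⟨fun y => ?_, fun y => ?_⟩
  · exact Complex.reCLM.hasFDerivAt.comp_hasDerivAt y (h.im_d1 y)
  · have := Complex.reCLM.hasFDerivAt.comp_hasDerivAt y (h.im_dw y)
    refine (this.congr_of_eventuallyEq (Filter.Eventually.of_forall fun x => ?_)).congr_deriv ?_
    · simp only [Function.comp, Complex.reCLM_apply]
      rw [show (1 + (x:ℂ)^2) = ((1 + x^2 : ℝ) : ℂ) by push_cast; ring, Complex.re_ofReal_mul]
    · simp only [Complex.reCLM_apply]
      rw [show ((χ:ℂ) + c^2 * y^2) = ((χ + c^2*y^2 : ℝ) : ℂ) by push_cast; ring, Complex.re_ofReal_mul]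

theorem CODE.iode_im (h : CODE c χ ψ f) :
    IODE c χ (fun y => (f (y * Complex.I)).im) (fun y => (deriv f (y * Complex.I) * Complex.I).im) := by
  refine ⟨fun y => ?_, fun y => ?_⟩
  · exact Complex.imCLM.hasFDerivAt.comp_hasDerivAt y (h.im_d1 y)
  · have := Complex.imCLM.hasFDerivAt.comp_hasDerivAt y (h.im_dw y)
    refine (this.congr_of_eventuallyEq (Filter.Eventually.of_forall fun x => ?_)).congr_deriv ?_
    · simp only [Function.comp, Complex.imCLM_apply]
      rw [show (1 + (x:ℂ)^2) = ((1 + x^2 : ℝ) : ℂ) by push_cast; ring, Complex.im_ofReal_mul]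
    · simp only [Complex.imCLM_apply]
      rw [show ((χ:ℂ) + c^2 * y^2) = ((χ + c^2*y^2 : ℝ) : ℂ) by push_cast; ring, Complex.im_ofReal_mul]

theorem CODE.im_conj (h : CODE c χ ψ f) {σ : ℝ} (hσ : ∀ z, f (-z) = σ * f z) (y : ℝ) :
    starRingEnd ℂ (f (y * Complex.I)) = σ * f (y * Complex.I) := by
  rw [← hσ, ← h.conj]
  congr 1
  simp
end

theorem abs_re_of_conj {z : ℂ} (h : starRingEnd ℂ z = (1:ℝ) * z) : |z.re| = ‖z‖ := by
  have h1 := congrArg Complex.im h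
  simp only [Complex.conj_im, Complex.ofReal_one, one_mul] at h1
  have h2 : z.im = 0 := by linarith
  rw [← Complex.re_add_im z, h2]
  simp

theorem abs_im_of_conj {z : ℂ} (h : starRingEnd ℂ z = (-1:ℝ) * z) : |z.im| = ‖z‖ := by
  have h1 := congrArg Complex.re h
  simp only [Complex.conj_re, Complex.ofReal_neg, Complex.ofReal_one, neg_mul, one_mul, Complex.neg_re] at h1
  have h2 : z.re = 0 := by linarith
  rw [← Complex.re_add_im z, h2]
  simp

/-- even datum on the imaginary axis, normalised to be positive -/
theorem ProlateDatum.axis_even {c χ : ℝ} {k : ℕ} {ψ : ℝ → ℝ} {lam : ℂ} (h : ProlateDatum c k ψ lam χ)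
    (hev : ∀ z, ent c ψ lam (-z) = (1:ℝ) * ent c ψ lam z) (hd : deriv ψ 0 = 0) :
    ∃ a a' : ℝ → ℝ, IODE c χ a a' ∧ 0 < a 0 ∧ a 0 = |ψ 0| ∧ a' 0 = 0 ∧ ∀ y : ℝ, |a y| = ‖ent c ψ lam (y * Complex.I)‖ := by
  have hne : ψ 0 ≠ 0 := fun h0 => h.rode.not_both_zero h.normalized (by norm_num) h0 hd
  have hI := h.code.iode_re
  have e0 : (ent c ψ lam (((0:ℝ):ℂ) * Complex.I)).re = ψ 0 := by
    rw [Complex.ofReal_zero, zero_mul, ← Complex.ofReal_zero, h.code.real, Complex.ofReal_re]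
  have e1 : (deriv (ent c ψ lam) (((0:ℝ):ℂ) * Complex.I) * Complex.I).re = 0 := by
    rw [Complex.ofReal_zero, zero_mul, ← Complex.ofReal_zero, h.code.real', hd]; simp
  have e2 : ∀ y : ℝ, |(ent c ψ lam (y * Complex.I)).re| = ‖ent c ψ lam (y * Complex.I)‖ := fun y =>
    abs_re_of_conj (h.code.im_conj hev y)
  rcases lt_or_gt_of_ne hne with h1 | h1
  · exact ⟨_, _, hI.neg, by rw [e0]; linarith, by rw [e0, abs_of_neg h1], by rw [e1, neg_zero], fun y => by rw [abs_neg, e2]⟩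
  · exact ⟨_, _, hI, by rw [e0]; linarith, by rw [e0, abs_of_pos h1], by rw [e1], fun y => by rw [e2]⟩

theorem ProlateDatum.axis_odd {c χ : ℝ} {k : ℕ} {ψ : ℝ → ℝ} {lam : ℂ} (h : ProlateDatum c k ψ lam χ)
    (hev : ∀ z, ent c ψ lam (-z) = (-1:ℝ) * ent c ψ lam z) (h0 : ψ 0 = 0) :
    ∃ a a' : ℝ → ℝ, IODE c χ a a' ∧ a 0 = 0 ∧ 0 < a' 0 ∧ a' 0 = |deriv ψ 0| ∧ ∀ y : ℝ, |a y| = ‖ent c ψ lam (y * Complex.I)‖ := by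
  have hne : deriv ψ 0 ≠ 0 := h.rode.not_both_zero h.normalized (by norm_num) h0
  have hI := h.code.iode_im
  have e0 : (ent c ψ lam (((0:ℝ):ℂ) * Complex.I)).im = 0 := by
    rw [Complex.ofReal_zero, zero_mul, ← Complex.ofReal_zero, h.code.real, Complex.ofReal_im]
  have e1 : (deriv (ent c ψ lam) (((0:ℝ):ℂ) * Complex.I) * Complex.I).im = deriv ψ 0 := by
    rw [Complex.ofReal_zero, zero_mul, ← Complex.ofReal_zero, h.code.real']; simp
  have e2 : ∀ y : ℝ, |(ent c ψ lam (y * Complex.I)).im| = ‖ent c ψ lam (y * Complex.I)‖ := fun y =>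
    abs_im_of_conj (h.code.im_conj hev y)
  rcases lt_or_gt_of_ne hne with h1 | h1
  · exact ⟨_, _, hI.neg, by rw [e0, neg_zero], by rw [e1]; linarith, by rw [e1, abs_of_neg h1], fun y => by rw [abs_neg, e2]⟩
  · exact ⟨_, _, hI, by rw [e0], by rw [e1]; linarith, by rw [e1, abs_of_pos h1], fun y => by rw [e2]⟩

/-- ratio of the eigenvalues -/
theorem kappa_bound {c s : ℝ} {m n : ℕ} {ψm ψn : ℝ → ℝ} {lm ln : ℂ} {χm χn : ℝ}
    (hm : ProlateDatum c m ψm lm χm) (hn : ProlateDatum c n ψn ln χn) (hc : 30 ≤ c) (hs : 0 < s) (hcs : 1 ≤ c*s)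
    (hχ : χn = c^2*(1+s)) (hχm : c^2 < χm) (hmn : χm ≤ χn)
    (hev : ∀ z, ent c ψm lm (-z) = (1:ℝ) * ent c ψm lm z) (hd : deriv ψm 0 = 0) :
    ‖ln‖/‖lm‖ ≤ 28 * √χn := by
  have hc0 : 0 < c := by linarith
  have hχn : c^2 < χn := by linarith
  have h900 : 900 ≤ χn := by nlinarith only [hc, hχn]
  have hn0 : 0 < χn := by linarith
  set r := √χn with hr
  have hr2 : r^2 = χn := Real.sq_sqrt hn0.le
  have hr0 : 0 < r := Real.sqrt_pos.2 hn0
  have hr30 : 30 ≤ r := by nlinarith only [hr2, hr0, h900]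
  obtain ⟨a, a', ha, ha0, ha1, ha2, han⟩ := hm.axis_even hev hd
  have hR := hn.rode.R0_ge hc0 hχ hcs hs (by linarith)
  have hm0 := hm.abs_le hχm (x := 0) (by norm_num)
  have hχm0 : 0 ≤ χm := by nlinarith only [hχm, sq_nonneg c]
  set Y := 3*χn/c with hY
  have hcY : c * Y = 3*χn := by rw [hY]; field_simp
  have hY0 : 1 ≤ Y := by
    have : c ≤ c * Y := by rw [hcY]; nlinarith only [hc, hχn]
    nlinarith only [this, hc0]
  have hYp : 0 ≤ Y := by linarith
  have him : ((Y:ℂ) * Complex.I).im = Y := by simp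
  have hbm := hm.ibp_bounds (by linarith) hχm (z := Y * Complex.I) (by rw [him, hcY]; linarith)
  have hbn := hn.ibp_bounds (by linarith) hχn (z := Y * Complex.I) (by rw [him, hcY])
  rw [him] at hbm hbn
  -- ratio estimate
  have key : ‖ent c ψm lm (Y * Complex.I)‖ * |ψn 1| ≤ 13.7 * r * |ψm 1| * ‖ent c ψn ln (Y * Complex.I)‖ := by
    have hapos : ∀ y, 0 ≤ y → 0 ≤ a y := fun y hy => (ha.pos_even hχm0 ha0 ha2 hy).1.le
    obtain ⟨σ, hσ, hz, hx, hx'⟩ := hn.parity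
    rw [← han, abs_of_nonneg (hapos Y hYp)]
    rcases hσ with hσ | hσ
    · rw [hσ] at hz
      have hd0 : deriv ψn 0 = 0 := by have := hx' 0; rw [hσ, neg_zero] at this; linarith
      obtain ⟨b, b', hb, hb0, hb1, hb2, hbnn⟩ := hn.axis_even hz hd0
      have hbp : ∀ y, 0 ≤ y → 0 < b y := fun y hy => (hb.pos_even hn0.le hb0 hb2 hy).1
      have := ha.ratio hb hmn hapos (by rw [ha2, hb2]; simp) le_rfl hYp (fun y hy => (hbp y hy).le) hbp
      rw [← hbnn, abs_of_pos (hbp Y hYp)]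
      rw [div_le_div_iff₀ (hbp Y hYp) hb0, ha1, hb1] at this
      rw [hd0, ← hr2] at hR
      have h8 : |ψn 1| ≤ 8 * r * |ψn 0| := by
        apply abs_le_of_sq_le_sq' _ (by positivity) |>.2
        rw [mul_pow, sq_abs, sq_abs]; nlinarith only [hR]
      have hbY := hbp Y hYp
      calc a Y * |ψn 1| ≤ a Y * (8 * r * |ψn 0|) := mul_le_mul_of_nonneg_left h8 (hapos Y hYp)
        _ = 8 * r * (a Y * |ψn 0|) := by ring
        _ ≤ 8 * r * (|ψm 0| * b Y) := by gcongr
        _ ≤ 13.7 * r * (|ψm 1| * b Y) := by gcongr; norm_num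
        _ = _ := by ring
    · rw [hσ] at hz
      have hd0 : ψn 0 = 0 := by have := hx 0; rw [hσ, neg_zero] at this; linarith
      obtain ⟨b, b', hb, hb0, hb1, hb2, hbnn⟩ := hn.axis_odd hz hd0
      have hbge : ∀ y, 0 ≤ y → b' 0 * y / (1+y^2) ≤ b y := fun y hy => hb.odd_ge hn0.le hb0 hb1 hy
      have hbp : ∀ y, 0 ≤ y → 0 ≤ b y := fun y hy => le_trans (by positivity) (hbge y hy)
      have hr1 : r⁻¹ ≤ 1/30 := by rw [inv_eq_one_div]; exact one_div_le_one_div_of_le (by norm_num) hr30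
      have hri : 0 < r⁻¹ := by positivity
      have hbpp : ∀ y, r⁻¹ ≤ y → 0 < b y := fun y hy => by
        have : 0 < y := by linarith
        exact lt_of_lt_of_le (by positivity) (hbge y this.le)
      have := ha.ratio hb hmn hapos (by rw [hb0]; nlinarith only [mul_pos ha0 hb1]) hri.le (by linarith : r⁻¹ ≤ Y) hbp hbpp
      have hbY := hbpp Y (by linarith)
      rw [← hbnn, abs_of_pos hbY]
      have hbr := hbpp r⁻¹ le_rfl
      rw [div_le_div_iff₀ hbY hbr] at this
      have hg := hbge r⁻¹ hri.le
      have hal := ha.even_le hχm0 ha0 ha2 hri.le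
      have hQ : (χm + c^2*(r⁻¹)^2) * (r⁻¹)^2/2 ≤ 0.51 := by
        have h1 : χn * (r⁻¹)^2 = 1 := by rw [← hr2]; field_simp
        have h2 : (χm + c^2*(r⁻¹)^2) * (r⁻¹)^2 ≤ (χn + χn * (r⁻¹)^2) * (r⁻¹)^2 := by gcongr
        have h3 : (χn + χn * (r⁻¹)^2) * (r⁻¹)^2 = 1 + (r⁻¹)^2 := by rw [h1, add_mul, h1, one_mul]
        nlinarith only [h2, h3, hr1, hri]
      have hE : exp 0.51 ≤ 1.67 := by
        have h1 := Real.exp_one_lt_d9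
        have h2 : exp 0.51 ^ 100 ≤ 1.67 ^ 100 := by
          rw [← Real.exp_nat_mul]
          rw [show ((100:ℕ):ℝ) * 0.51 = ((51:ℕ):ℝ) * 1 by norm_num, Real.exp_nat_mul]
          calc exp 1 ^ 51 ≤ 2.7183 ^ 51 := by gcongr; linarith
            _ ≤ _ := by norm_num
        exact le_of_pow_le_pow_left₀ (by norm_num) (by norm_num) h2
      have hal2 : a r⁻¹ ≤ 1.67 * |ψm 0| := by
        rw [ha1] at hal
        calc _ ≤ _ := hal
          _ ≤ |ψm 0| * 1.67 := by gcongr; exact (exp_le_exp.2 hQ).trans hE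
          _ = _ := by ring
      have hg2 : |deriv ψn 0| ≤ b r⁻¹ * r * 1.002 := by
        rw [hb2, div_le_iff₀ (by positivity)] at hg
        have : |deriv ψn 0| ≤ b r⁻¹ * (1 + (r⁻¹)^2) * r := by
          calc |deriv ψn 0| = |deriv ψn 0| * r⁻¹ * r := by field_simp
            _ ≤ _ := by gcongr
        calc _ ≤ _ := this
          _ = b r⁻¹ * r * (1 + (r⁻¹)^2) := by ring
          _ ≤ _ := by gcongr; nlinarith only [hr1, hri]
      rw [hd0] at hR
      have h8 : |ψn 1| ≤ 8 * |deriv ψn 0| := by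
        apply abs_le_of_sq_le_sq' _ (by positivity) |>.2
        rw [mul_pow, sq_abs, sq_abs]; nlinarith only [hR]
      have haY := hapos Y hYp
      calc a Y * |ψn 1| ≤ a Y * (8 * (b r⁻¹ * r * 1.002)) := by gcongr; linarith
        _ = 8 * 1.002 * r * (a Y * b r⁻¹) := by ring
        _ ≤ 8 * 1.002 * r * (a r⁻¹ * b Y) := by gcongr
        _ ≤ 8 * 1.002 * r * (1.67 * |ψm 1| * b Y) := by
          gcongr
          linarith
        _ = (8 * 1.002 * 1.67) * (r * |ψm 1| * b Y) := by ring
        _ ≤ 13.7 * (r * |ψm 1| * b Y) := by gcongr; norm_num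
        _ = _ := by ring
  have hlm : 0 < ‖lm‖ := norm_pos_iff.2 hm.lam_ne_zero
  rw [div_le_iff₀ hlm]
  set fm := ‖ent c ψm lm (Y * Complex.I)‖
  set fn := ‖ent c ψn ln (Y * Complex.I)‖
  have hp1 := hm.psi_one_sq hχm
  have hm1 : 0 < |ψm 1| := by
    rw [abs_pos]; intro h0; rw [h0] at hp1; norm_num at hp1
  have hn1 : 0 < |ψn 1| := by
    have hp1 := hn.psi_one_sq hχn
    rw [abs_pos]; intro h0; rw [h0] at hp1; norm_num at hp1
  set D := c * ‖(Y:ℂ) * Complex.I‖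
  have hD : 0 < D := by
    have : ‖(Y:ℂ) * Complex.I‖ = |Y| := by simp
    have h2 : D = c * |Y| := by simp only [D, this]
    rw [h2, abs_of_nonneg hYp]; positivity
  set E := exp (c*Y)
  have hE : 0 < E := exp_pos _
  have h1 := hbm.1
  have h2 := hbn.2
  have hfn : 0 ≤ fn := norm_nonneg _
  have hfm : 0 < fm := by
    have : 0 < D * ‖lm‖ * fm := lt_of_lt_of_le (by positivity) h1
    exact pos_of_mul_pos_right this (by positivity)
  have hfnpos : 0 < fn := by
    have h3 : 0 < 13.7 * r * |ψm 1| * fn := lt_of_lt_of_le (by positivity) key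
    exact pos_of_mul_pos_right h3 (by positivity)
  have h4 : (D * ‖ln‖ * fn) * (0.66 * (|ψm 1| * E)) ≤ 1.34 * (|ψn 1| * E) * (D * ‖lm‖ * fm) :=
    mul_le_mul h2 h1 (by positivity) (by positivity)
  have h5 : (D * E * fn * |ψm 1|) * ‖ln‖ ≤ (D * E * fn * |ψm 1|) * (28 * r * ‖lm‖) := by
    calc (D * E * fn * |ψm 1|) * ‖ln‖ = (1/0.66) * ((D * ‖ln‖ * fn) * (0.66 * (|ψm 1| * E))) := by ring
      _ ≤ (1/0.66) * (1.34 * (|ψn 1| * E) * (D * ‖lm‖ * fm)) := by gcongr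
      _ = (1/0.66*1.34) * E * D * ‖lm‖ * (fm * |ψn 1|) := by ring
      _ ≤ (1/0.66*1.34) * E * D * ‖lm‖ * (13.7 * r * |ψm 1| * fn) := by gcongr
      _ = (1/0.66*1.34*13.7) * (E * D * ‖lm‖ * r * |ψm 1| * fn) := by ring
      _ ≤ 28 * (E * D * ‖lm‖ * r * |ψm 1| * fn) := by gcongr; norm_num
      _ = _ := by ring
  exact le_of_mul_le_mul_left h5 (by positivity)

theorem fmH_all {c s : ℝ} {m n : ℕ} {ψm ψn : ℝ → ℝ} {lm ln : ℂ} {χm χn : ℝ}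
    (hm : ProlateDatum c m ψm lm χm) (hn : ProlateDatum c n ψn ln χn) (hc : 30 ≤ c) (hs : 0 < s) (hcs : 60 ≤ c*s)
    (hχ : χn = c^2*(1+s)) (hmn : χm ≤ χn)
    (hev : ∀ z, ent c ψm lm (-z) = (1:ℝ) * ent c ψm lm z) (hd : deriv ψm 0 = 0) {z : ℂ}
    (hz : ∀ t ∈ Icc (-1:ℝ) 1, √(1+s) - 1 ≤ ‖z - t‖) :
    ‖ent c ψm lm z * Hc ψn z‖ ≤ 32*c^2*√(1+s)*exp (c * |z.im|) := by
  have hc0 : 0 < c := by linarith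
  set r := √(1+s) with hr
  have hr2 : r^2 = 1+s := Real.sq_sqrt (by linarith)
  have hr0 : 0 ≤ r := Real.sqrt_nonneg _
  have hr1 : 1 < r := by nlinarith only [hr2, hr0, hs]
  have hd0 : 0 < r - 1 := by linarith
  have h1d : 1/(r-1) ≤ c*r/30 := by
    rw [div_le_iff₀ hd0]
    have e : (r-1)*(r+1) = s := by nlinarith only [hr2]
    have h2 : s ≤ (r-1)*(2*r) := by nlinarith only [e, hr1, hd0]
    have h3 : 60 ≤ c * ((r-1)*(2*r)) := hcs.trans (by gcongr)
    linarith
  have hE1 : 1 ≤ exp (c * |z.im|) := one_le_exp (by positivity)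
  set E := exp (c * |z.im|)
  rcases le_or_gt χm (c^2) with h | h
  · refine (fmH_caseA hm hn (by linarith) h hd0 hz).trans ?_
    have h1 : 9/2*c/(r-1) ≤ 32*c^2*r := by
      calc 9/2*c/(r-1) = 9/2*c*(1/(r-1)) := by ring
        _ ≤ 9/2*c*(c*r/30) := by gcongr
        _ ≤ _ := by nlinarith only [mul_pos (pow_pos hc0 2) (by linarith : 0 < r)]
    gcongr
  · refine (fmH_caseB hm hn (by linarith) hd0 hz).trans ?_
    have hk := kappa_bound hm hn hc hs (by linarith) hχ h hmn hev hd
    have e : √χn = c * r := by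
      rw [hχ, Real.sqrt_mul (by positivity), Real.sqrt_sq hc0.le]
    rw [e] at hk
    have h2 : 1/(r-1) ≤ 0.5 * c^2 * r * E := by
      calc 1/(r-1) ≤ c*r/30 := h1d
        _ ≤ 0.5 * c^2 * r := by nlinarith only [mul_pos hc0 (by linarith : 0 < r), hc]
        _ ≤ 0.5 * c^2 * r * E := le_mul_of_one_le_right (by positivity) hE1
    have h3 : 9/8*c*(‖ln‖/‖lm‖)*E ≤ 9/8*c*(28 * (c*r))*E := by gcongr
    nlinarith only [h2, h3]

theorem odd_error {c : ℝ} {m n : ℕ} {ψm ψn : ℝ → ℝ} {lm ln : ℂ} {χm χn : ℝ}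
    (hm : ProlateDatum c m ψm lm χm) (hn : ProlateDatum c n ψn ln χn) (hodd : ∀ x, ψm (-x) = - ψm x)
    (Zi : Finset ℝ) (hZi : ∀ w, w ∈ Zi ↔ w ∈ Ioo (-1:ℝ) 1 ∧ ψn w = 0) :
    (∫ s in (-1:ℝ)..1, ψm s) - ∑ w ∈ Zi, quadWeight ψn w * ψm w = 0 := by
  obtain ⟨σ, hσ, hz, hx, hx'⟩ := hn.parity
  have h1 : (∫ s in (-1:ℝ)..1, ψm s) = 0 := by
    have := intervalIntegral.integral_comp_neg (a := -1) (b := 1) ψm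
    simp only [hodd, intervalIntegral.integral_neg, neg_neg] at this
    linarith
  have hσ2 : σ * σ = 1 := by rcases hσ with h | h <;> rw [h] <;> norm_num
  have hσ0 : σ ≠ 0 := by intro h; rw [h] at hσ2; norm_num at hσ2
  have hq : ∀ w, quadWeight ψn (-w) = quadWeight ψn w := by
    intro w
    unfold quadWeight
    have := intervalIntegral.integral_comp_neg (a := -1) (b := 1) (fun s => ψn s / (s - -w))
    simp only [neg_neg] at this
    rw [← this, hx']
    have e : ∀ s, ψn (-s) / (-s - -w) = -σ * (ψn s / (s - w)) := by
      intro s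
      rw [hx, show -s - -w = -(s-w) by ring, div_neg]; ring
    simp only [e, intervalIntegral.integral_const_mul]
    by_cases h0 : deriv ψn w = 0
    · rw [h0]; simp
    · field_simp
  have h2 : ∑ w ∈ Zi, quadWeight ψn w * ψm w = ∑ w ∈ Zi, quadWeight ψn (-w) * ψm (-w) := by
    refine Finset.sum_nbij' (fun w => -w) (fun w => -w) ?_ ?_ ?_ ?_ ?_
    · intro w hw
      rw [hZi] at hw ⊢
      exact ⟨⟨by linarith [hw.1.2], by linarith [hw.1.1]⟩, by rw [hx, hw.2, mul_zero]⟩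
    · intro w hw
      rw [hZi] at hw ⊢
      exact ⟨⟨by linarith [hw.1.2], by linarith [hw.1.1]⟩, by rw [hx, hw.2, mul_zero]⟩
    · intro w _; simp
    · intro w _; simp
    · intro w _; simp
  have h3 : ∑ w ∈ Zi, quadWeight ψn (-w) * ψm (-w) = - ∑ w ∈ Zi, quadWeight ψn w * ψm w := by
    rw [← Finset.sum_neg_distrib]
    refine Finset.sum_congr rfl fun w _ => ?_
    rw [hq, hodd]; ring
  linarith

theorem exp_neg_102 : 0.36 ≤ exp (-1.02) := by
  have h1 := Real.exp_one_lt_d9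
  have h2 : exp 1.02 ^ 50 ≤ 2.777 ^ 50 := by
    rw [← Real.exp_nat_mul]
    rw [show ((50:ℕ):ℝ) * 1.02 = ((51:ℕ):ℝ) * 1 by norm_num, Real.exp_nat_mul]
    calc exp 1 ^ 51 ≤ 2.7183 ^ 51 := by gcongr; linarith
      _ ≤ _ := by norm_num
  have h3 : exp 1.02 ≤ 2.777 := le_of_pow_le_pow_left₀ (by norm_num) (by norm_num) h2
  rw [Real.exp_neg, inv_eq_one_div, le_div_iff₀ (exp_pos _)]
  linarith

theorem kappa_V {c s u P Y : ℝ} (hc : 30 ≤ c) (hs : 0 < s) (hu : u = 1+s) (hP : 1.499*(c^2*s*u) ≤ P)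
    (hP2 : 2600*u ≤ P) (hY : Y = 3*c*u) : (c - 1.02/Y)^2 ≤ c^2*(1 - s/P) - 1/P^2 := by
  have hc0 : 0 < c := by linarith
  have hu1 : 1 ≤ u := by linarith
  have hu0 : 0 < u := by linarith
  have hP0 : 0 < P := by linarith
  have hY0 : 0 < Y := by rw [hY]; positivity
  have h1 : c^2*s/P ≤ 0.6672/u := by
    rw [div_le_div_iff₀ hP0 hu0]; linarith
  have h2 : 1/P^2 ≤ 0.001/u := by
    rw [div_le_div_iff₀ (by positivity) hu0]
    nlinarith only [hP2, hu1]
  have h3 : (1.02/Y)^2 ≤ 0.001/u := by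
    rw [div_pow, div_le_div_iff₀ (by positivity) hu0, hY]
    nlinarith only [hu1, mul_pos hc0 hc0, hc, mul_pos (mul_pos hc0 hc0) hu0, mul_le_mul hu1 hu1 (by norm_num) hu0.le, mul_nonneg (sub_nonneg.2 hu1) (by nlinarith only [hc] : 0 ≤ c*c-900)]
  have h4 : c * (1.02/Y) = 0.34/u := by rw [hY]; field_simp; norm_num
  have e : c^2*(1 - s/P) = c^2 - c^2*s/P := by ring
  have h5 : 0.6672/u = 0.6672*(1/u) := by ring
  have h6 : 0.001/u = 0.001*(1/u) := by ring
  have h7 : 0.34/u = 0.34*(1/u) := by ring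
  have h8 : 0 < 1/u := by positivity
  rw [e]
  rw [h5] at h1; rw [h6] at h2 h3; rw [h7] at h4
  nlinarith only [h1, h2, h3, h4, h8]

theorem core_bound {c s : ℝ} {m n : ℕ} {ψm ψn : ℝ → ℝ} {lm ln : ℂ} {χm χn : ℝ}
    (hm : ProlateDatum c m ψm lm χm) (hn : ProlateDatum c n ψn ln χn) (hc : 30 ≤ c) (hs : 0 < s) (hcs : 60 ≤ c*s)
    (hχ : χn = c^2*(1+s)) (hmn : χm ≤ χn)
    (hev : ∀ z, ent c ψm lm (-z) = (1:ℝ) * ent c ψm lm z) (hd : deriv ψm 0 = 0)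
    (hw : deriv ψn (√(1+s)) ≠ 0)
    (Zi : Finset ℝ) (hZi : ∀ w, w ∈ Zi ↔ w ∈ Ioo (-1:ℝ) 1 ∧ ψn w = 0) :
    |(∫ s in (-1:ℝ)..1, ψm s) - ∑ w ∈ Zi, quadWeight ψn w * ψm w| ≤
      6080 * c^6 * (1+s)^3 * √s / (s * |deriv ψn (√(1+s))|) := by
  have hc0 : 0 < c := by linarith
  obtain ⟨u, hu⟩ : ∃ u, u = 1 + s := ⟨_, rfl⟩
  have hu1 : 1 ≤ u := by linarith
  have hu0 : 0 < u := by linarith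
  have hcsu : 1800*u ≤ c^2*s*u := by
    have : 1800 ≤ c^2*s := by nlinarith only [hc, hcs]
    gcongr
  set X0 := √(1.5*(c^2*s*u)) with hX0
  have hX02 : X0^2 = 1.5*(c^2*s*u) := Real.sq_sqrt (by positivity)
  have hX0p : 0 ≤ X0 := Real.sqrt_nonneg _
  have hX050 : 50 ≤ X0 := by nlinarith only [hX02, hX0p, hcsu, hu1]
  obtain ⟨X, hX, hXψ⟩ := hn.rode.exists_X hc hs hχ hw hX050 (by rw [hX02, ← hu]; linarith)
  obtain ⟨r, hr⟩ : ∃ r, r = √(1+s) := ⟨_, rfl⟩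
  rw [← hr] at hw hXψ ⊢
  have hr2 : r^2 = u := by rw [hr, Real.sq_sqrt (by linarith), hu]
  have hr0 : 0 < r := by rw [hr]; positivity
  have hr1 : 1 < r := by nlinarith only [hr2, hr0, hu, hs]
  obtain ⟨q, hq⟩ : ∃ q, q = √s := ⟨_, rfl⟩
  rw [← hq]
  have hq2 : q^2 = s := by rw [hq, Real.sq_sqrt hs.le]
  have hq0 : 0 < q := by rw [hq]; positivity
  have hqr : q ≤ r := by nlinarith only [hr2, hq2, hr0, hq0, hu]
  have hXp : 0 < X := by linarith [hX.1]
  have hXlo : X0^2 ≤ X^2 := by nlinarith only [hX.1, hX0p]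
  have hXhi : X^2 ≤ 1.0201*X0^2 := by nlinarith only [hX.2, hXp, hX0p]
  rw [hX02] at hXlo hXhi
  have hXhi2 : X^2 ≤ 1.53015*(c*q*r)^2 := by rw [mul_pow, mul_pow, hq2, hr2]; linarith
  have hX1 : X ≤ 1.2371*(c*q*r) := by
    have : 0 < c*q*r := by positivity
    nlinarith only [hXhi2, this, hXp]
  set P := X^2-1 with hP
  have hPl : 1.499*(c^2*s*u) ≤ P := by linarith
  have hP2 : 2600*u ≤ P := by linarith
  have hP0 : 0 < P := by linarith
  set Y := 3*c*u with hY
  have hY0 : 0 < Y := by positivity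
  have hcY : c*Y = 3*χn := by rw [hY, hχ, ← hu]; ring
  have hYbig : 90*u ≤ Y := by rw [hY]; nlinarith only [hc, hu0]
  set κ := c - 1.02/Y with hκ
  have hYs : 1.02/Y ≤ 1 := by rw [div_le_one hY0]; linarith
  have hYs0 : 0 < 1.02/Y := by positivity
  have hXb : 50 ≤ X := by linarith [hX.1]
  have hcl := fun (z : ℂ) hz => hn.contour_lower (by linarith) hs hχ (X := X) (Y := Y) (κ := κ) (by linarith) hcY (by linarith) (by linarith)
    (kappa_V hc hs hu hPl hP2 hY) (z := z) hz
  have eκ : (c-κ)*Y = 1.02 := by rw [hκ]; field_simp; ring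
  rw [eκ] at hcl
  set D := s * |deriv ψn r| with hD
  have hD0 : 0 < D := mul_pos hs (abs_pos.2 hw)
  -- lower bound for ψn X
  have hψX : 0.7071 * D ≤ c * X^2 * |ψn X| := by
    apply abs_le_of_sq_le_sq' _ (by positivity) |>.2
    have e1 : (s * deriv ψn r)^2 = D^2 := by rw [hD, mul_pow, mul_pow, sq_abs]
    rw [e1] at hXψ
    have h2 : c^2 * P * (P - s) * ψn X^2 ≤ (c * X^2 * |ψn X|)^2 := by
      have : P * (P-s) ≤ X^2 * X^2 := by
        have h1 : P ≤ X^2 := by linarith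
        have h2 : P - s ≤ X^2 := by linarith
        have h3 : 0 ≤ P - s := by linarith
        exact mul_le_mul h1 h2 h3 (by positivity)
      calc c^2 * P * (P - s) * ψn X^2 = c^2 * (P * (P-s)) * ψn X^2 := by ring
        _ ≤ c^2 * (X^2*X^2) * ψn X^2 := by gcongr
        _ = _ := by rw [mul_pow, sq_abs]; ring
    nlinarith only [h2, hXψ, sq_nonneg D]
  have hsq : q/(2.67*r) ≤ √(P/(X^2+Y^2+1)) := by
    apply Real.le_sqrt_of_sq_le
    rw [div_pow, div_le_div_iff₀ (by positivity) (by positivity), hq2, mul_pow 2.67 r, hr2]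
    have h1 : X^2 + Y^2 + 1 = P + 2 + 9*(c^2*u^2) := by rw [hY, hP]; ring
    rw [h1]
    have h2 : s*P ≤ u*P := by gcongr; linarith
    have h3 : 1.499*(c^2*s*u)*u ≤ P*u := by gcongr
    have h4 : s * 2 ≤ u * P * 0.01 := by nlinarith only [hP2, hu1, hu]
    have h5 : s * (9 * (c^2*u^2)) = 9 * (c^2*s*u*u) := by ring
    nlinarith only [h2, h3, h4, h5, mul_pos hP0 hu0]
  obtain ⟨L, hLd⟩ : ∃ L, L = 0.0149 * D / (c^3*q*r^3) := ⟨_, rfl⟩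
  have hL0 : 0 < L := by rw [hLd]; positivity
  have hLle : L ≤ 0.24 * (√(P/(X^2+Y^2+1)) * |ψn X| * exp (-1.02)) := by
    have h1 : 0.7071 * D / (1.53015*c*(c*q*r)^2) ≤ |ψn X| := by
      rw [div_le_iff₀ (by positivity)]
      calc _ ≤ _ := hψX
        _ ≤ c * (1.53015*(c*q*r)^2) * |ψn X| := by gcongr
        _ = _ := by ring
    calc L = 0.0149 * (D / (c^3*q*r^3)) := by rw [hLd]; ring
      _ ≤ (0.24*0.7071*0.36/2.67/1.53015) * (D / (c^3*q*r^3)) := by gcongr; norm_num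
      _ = 0.24 * (q/(2.67*r) * (0.7071 * D / (1.53015*c*(c*q*r)^2)) * 0.36) := by field_simp
      _ ≤ _ := by gcongr; exact exp_neg_102
  have hdist : ∀ z : ℂ, (z ∈ rectBd X Y ∨ ∃ w : ℝ, √(1+s) ≤ |w| ∧ z = w) → ∀ t ∈ Icc (-1:ℝ) 1, √(1+s) - 1 ≤ ‖z - t‖ := by
    rw [← hr]
    have hrX : r ≤ X := by nlinarith only [hr2, hP2, hP, hXp, hr0, hu1]
    have hrY : r ≤ Y := by nlinarith only [hr2, hYbig, hr1, hu1]
    intro z hz t ht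
    have ht1 : |t| ≤ 1 := abs_le.2 ht
    have hre : |z.re| - 1 ≤ ‖z - t‖ := by
      have h1 := Complex.abs_re_le_norm (z - t)
      rw [Complex.sub_re, Complex.ofReal_re] at h1
      have h2 := abs_sub_abs_le_abs_sub z.re t
      linarith
    rcases hz with (hz | hz) | ⟨w, hw, rfl⟩
    · rw [hz.1] at hre; linarith
    · have h1 := Complex.abs_im_le_norm (z - t)
      rw [Complex.sub_im, Complex.ofReal_im, sub_zero, hz.2] at h1
      linarith
    · rw [Complex.ofReal_re] at hre; linarith
  have hrX : r < X := by nlinarith only [hr2, hP2, hP, hXp, hr0, hu1]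
  have main := error_bound hm hn (by linarith) hs hχ (X := X) (Y := Y) (A := 32*c^2*r) (L := L) (by nlinarith only [hcs])
    (by rw [← hr]; exact hw) (by rw [← hr]; exact hrX) hY0 hL0 (fun z hz => (mul_le_mul_of_nonneg_right hLle (exp_pos _).le).trans (hcl z hz))
    (fun z hz => by rw [hr]; exact fmH_all hm hn hc hs hcs hχ hmn hev hd (hdist z hz)) Zi hZi
  rw [← hr, ← hD] at main
  refine main.trans ?_
  have T1 : 2*(c*X+1) * (32*c^2*r * X^2 / D) ≤ 130 * (c^6*q*r^6/D) := by
    have h1 : c*X+1 ≤ 1.001*(c*X) := by nlinarith only [hc, hXb]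
    have h2 : X * X^2 ≤ (1.2371*(c*q*r)) * (1.53015*(c*q*r)^2) := by gcongr
    calc 2*(c*X+1) * (32*c^2*r * X^2 / D) ≤ 2*(1.001*(c*X)) * (32*c^2*r * X^2 / D) := by gcongr
      _ = 64.064 * c^3 * r / D * (X * X^2) := by ring
      _ ≤ 64.064 * c^3 * r / D * ((1.2371*(c*q*r)) * (1.53015*(c*q*r)^2)) := by gcongr
      _ = (64.064*1.2371*1.53015) * (c^6*q*r^4/D) * q^2 := by ring
      _ ≤ 130 * (c^6*q*r^4/D) * r^2 := by gcongr; norm_num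
      _ = _ := by ring
  have T2 : (4*X+4*Y) * (32*c^2*r/L) / (2*π) ≤ 5900 * (c^6*q*r^6/D) := by
    have h1 : 4*X+4*Y ≤ 16.9484*(c*r^2) := by
      have : c*q*r ≤ c*r*r := by gcongr
      have e : Y = 3*(c*r^2) := by rw [hY, hr2]; ring
      rw [e]; nlinarith only [this, hX1]
    have h2 : 32*c^2*r/L = 32/0.0149 * (c^5*q*r^4/D) := by
      rw [hLd]; field_simp
    have hπ := pi_gt_d4
    rw [h2, div_le_iff₀ (by positivity)]
    calc (4*X+4*Y) * (32/0.0149 * (c^5*q*r^4/D)) ≤ 16.9484*(c*r^2) * (32/0.0149 * (c^5*q*r^4/D)) := by gcongr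
      _ = (16.9484*32/0.0149) * (c^6*q*r^6/D) := by ring
      _ ≤ (5900 * (2*3.1415)) * (c^6*q*r^6/D) := by gcongr; norm_num
      _ = 5900 * (c^6*q*r^6/D) * (2*3.1415) := by ring
      _ ≤ _ := by gcongr
  have e3 : 6080*c^6*(1+s)^3*q/D = 6080 * (c^6*q*r^6/D) := by
    rw [← hu, ← hr2]; ring
  rw [e3]
  have : 0 < c^6*q*r^6/D := by positivity
  linarith

theorem k_mono {c s0 s : ℝ} (hc : 30 ≤ c) (hs0 : 0 ≤ s0) (hs : s0 ≤ s) :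
    0.7853*c*(s0/√(1+s0/4)) - 3.5625*log (1+s0) ≤ 0.7853*c*(s/√(1+s/4)) - 3.5625*log (1+s) := by
  have e : ∀ x : ℝ, 0 ≤ x → 1 ≤ √(1+x/4) ∧ x/√(1+x/4) = 4*(√(1+x/4) - (√(1+x/4))⁻¹) ∧ 1 + x = 4*√(1+x/4)^2 - 3 := by
    intro x hx
    have h1 : 1 ≤ √(1+x/4) := by rw [Real.one_le_sqrt]; linarith
    have h2 : √(1+x/4)^2 = 1+x/4 := Real.sq_sqrt (by positivity)
    set y := √(1+x/4)
    have hx : x = 4*(y^2-1) := by linarith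
    refine ⟨h1, ?_, by linarith⟩
    have hy : y ≠ 0 := by positivity
    rw [hx]; field_simp
  obtain ⟨a1, a2, a3⟩ := e s0 hs0
  obtain ⟨b1, b2, b3⟩ := e s (hs0.trans hs)
  rw [a2, b2, a3, b3]
  have hy : √(1+s0/4) ≤ √(1+s/4) := Real.sqrt_le_sqrt (by linarith)
  set y0 := √(1+s0/4)
  set y := √(1+s/4)
  have hd : ∀ x : ℝ, 1 ≤ x → HasDerivAt (fun x => 0.7853*c*(4*(x - x⁻¹)) - 3.5625*log (4*x^2-3))
      (0.7853*c*(4*(1 - -(x^2)⁻¹)) - 3.5625*((4*(2*x))/(4*x^2-3))) x := by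
    intro x hx
    have hx0 : x ≠ 0 := by positivity
    have hp : 4*x^2-3 ≠ 0 := by nlinarith only [hx]
    have h1 := (((hasDerivAt_id x).sub (hasDerivAt_inv hx0)).const_mul 4).const_mul (0.7853*c)
    have h2 : HasDerivAt (fun x : ℝ => 4*x^2-3) (4*(2*x)) x := by
      simpa using (((hasDerivAt_pow 2 x).const_mul 4).sub_const 3)
    exact h1.sub ((h2.log hp).const_mul 3.5625)
  refine le_of_hasDerivAt_nonneg (f := fun x => 0.7853*c*(4*(x - x⁻¹)) - 3.5625*log (4*x^2-3)) hy
    (fun x hx => (hd x (a1.trans hx.1)).continuousAt.continuousWithinAt) (fun x hx => hd x (a1.trans hx.1.le)) ?_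
  intro x hx
  have hx1 : 1 ≤ x := a1.trans hx.1.le
  have h1 : (4*(2*x))/(4*x^2-3) ≤ 8 := by
    rw [div_le_iff₀ (by nlinarith only [hx1])]; nlinarith only [hx1]
  have h2 : 0 ≤ (x^2)⁻¹ := by positivity
  have h3 : 0 ≤ c * (x^2)⁻¹ := mul_nonneg (by linarith) h2
  nlinarith only [h1, h3, hc]

theorem sqrt_div {a b k x : ℝ} (hx : 0 ≤ x) (hk : 0 < k) (hxb : x ≤ b) (hb : 1 + b/4 ≤ k^2) (ha : 0 ≤ a) : a/k ≤ a/√(1+x/4) := by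
  have h1 : √(1+x/4) ≤ k := Real.sqrt_le_iff.2 ⟨hk.le, by linarith⟩
  have h2 : 0 < √(1+x/4) := by positivity
  gcongr

theorem log_tangent {x x0 : ℝ} (hx : 0 < x) (hx0 : 0 < x0) : log x ≤ log x0 + x/x0 - 1 := by
  have := Real.log_le_sub_one_of_pos (div_pos hx hx0)
  rw [Real.log_div hx.ne' hx0.ne'] at this
  linarith

/-- numerical inequality at the comparison point -/
theorem num_pt {c σ α β : ℝ} (hc : 30 < c) (hα : 89.6 ≤ α) (hσ : α = c*σ) (hσ5 : σ < 5)
    (hlog : 3*log c + 18.5 ≤ 0.32064*α) (hβ : (σ ≤ 1 ∧ β = 0.85) ∨ (1 < σ ∧ β = 0.7)) :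
    3.0625*log c + 3.5625*log (1+β*σ) - 7.15 + 0.32064*α < 0.7853*c*(β*σ/√(1+β*σ/4)) := by
  have hc0 : 0 < c := by linarith
  have hσ0 : 0 < σ := by
    have : 0 < c*σ := by linarith
    exact pos_of_mul_pos_right this hc0.le
  have l2 := log_two_lt_d9
  have l2' := log_two_gt_d9
  have red : ∀ k b : ℝ, 0 < k → β*σ ≤ b → 1 + b/4 ≤ k^2 → 0 ≤ β → 0.7853*β/k*α ≤ 0.7853*c*(β*σ/√(1+β*σ/4)) := by
    intro k b hk hb hk2 hβ0
    have := sqrt_div (x := β*σ) (a := β*σ) (by positivity) hk hb hk2 (by positivity)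
    calc 0.7853*β/k*α = 0.7853*c*(β*σ/k) := by rw [hσ]; ring
      _ ≤ _ := by gcongr
  rcases hβ with ⟨h1, hβ⟩ | ⟨h1, hβ⟩
  · rcases le_or_gt σ 0.1 with h2 | h2
    · have := red 1.0106 0.085 (by norm_num) (by rw [hβ]; linarith) (by norm_num) (by rw [hβ]; norm_num)
      have h3 : log (1+β*σ) ≤ 0.085 := by
        refine (Real.log_le_sub_one_of_pos (by rw [hβ]; positivity)).trans ?_
        rw [hβ]; linarith
      have h4 : 0.66 * α ≤ 0.7853*β/1.0106*α := by rw [hβ]; gcongr; norm_num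
      refine lt_of_lt_of_le ?_ (h4.trans this)
      clear red this h4
      linarith
    · have := red 1.1012 0.85 (by norm_num) (by rw [hβ]; linarith) (by norm_num) (by rw [hβ]; norm_num)
      have h3 : log (1+β*σ) ≤ 0.62 := by
        have h5 : log (1+β*σ) ≤ log 1.85 := log_le_log (by rw [hβ]; positivity) (by rw [hβ]; linarith)
        have h6 := log_le_of_pow (x := 1.85) (by norm_num) 8 9 (by norm_num) (by norm_num)
        norm_num at h6
        norm_num at h5
        linarith
      have h7 := log_tangent (x := c) (x0 := 896) hc0 (by norm_num)
      have h8 : log 896 ≤ 6.82 := by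
        have h6 := log_le_of_pow (x := 896) (by norm_num) 59 6 (by norm_num) (by norm_num)
        norm_num at h6
        linarith
      have h9 : c ≤ 10*α := by rw [hσ]; nlinarith only [h2, hc0]
      have h4 : 0.606 * α ≤ 0.7853*β/1.1012*α := by rw [hβ]; gcongr; norm_num
      refine lt_of_lt_of_le ?_ (h4.trans this)
      clear red this h4
      linarith
  · rcases le_or_gt σ 3 with h2 | h2
    · have := red 1.235 2.1 (by norm_num) (by rw [hβ]; linarith) (by norm_num) (by rw [hβ]; norm_num)
      have h3 : log (1+β*σ) ≤ log 1.7 + log σ := by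
        rw [← Real.log_mul (by norm_num) (by positivity)]
        exact log_le_log (by rw [hβ]; positivity) (by rw [hβ]; linarith)
      have h5 : log 1.7 ≤ 0.5332 := by
        have h6 := log_le_of_pow (x := 1.7) (by norm_num) 10 13 (by norm_num) (by norm_num)
        norm_num at h6
        norm_num
        linarith
      have h10 : log σ ≤ 1.11 := by
        have h6 := log_le_of_pow (x := 3) (by norm_num) 8 5 (by norm_num) (by norm_num)
        have h7 : log σ ≤ log 3 := log_le_log hσ0 h2
        norm_num at h6
        linarith
      have h7 : log α = log c + log σ := by rw [hσ, Real.log_mul hc0.ne' hσ0.ne']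
      have h8 := log_tangent (x := α) (x0 := 89.6) (by linarith) (by norm_num)
      have h9 : log 89.6 ≤ 4.51 := by
        have h6 := log_le_of_pow (x := 89.6) (by norm_num) 13 2 (by norm_num) (by norm_num)
        norm_num at h6
        norm_num
        linarith
      have h4 : 0.445 * α ≤ 0.7853*β/1.235*α := by rw [hβ]; gcongr; norm_num
      refine lt_of_lt_of_le ?_ (h4.trans this)
      clear red this h4
      have h11 : log α ≤ 3.51 + α*(10/896) := by
        have : α/89.6 = α*(10/896) := by norm_num; ring
        rw [this] at h8
        linarith only [h8, h9]
      have h12 : log (1+β*σ) ≤ 0.5332 + log σ := by linarith only [h3, h5]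
      linarith only [h11, h12, h10, h7, hα]
    · have h8 := log_tangent (x := c) (x0 := 30) hc0 (by norm_num)
      have h9 : log 30 ≤ 3.404 := by
        have h6 := log_le_of_pow (x := 30) (by norm_num) 54 11 (by norm_num) (by norm_num)
        norm_num at h6
        linarith
      rcases le_or_gt σ 4 with h3 | h3
      · have := red 1.3039 2.8 (by norm_num) (by rw [hβ]; linarith) (by norm_num) (by rw [hβ]; norm_num)
        have h5 : log (1+β*σ) ≤ 1.36 := by
          have h5 : log (1+β*σ) ≤ log 3.8 := log_le_log (by rw [hβ]; positivity) (by rw [hβ]; linarith)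
          have h6 := log_le_of_pow (x := 3.8) (by norm_num) 27 14 (by norm_num) (by norm_num)
          norm_num at h6
          norm_num at h5
          linarith
        have h4 : 0.4215 * α ≤ 0.7853*β/1.3039*α := by rw [hβ]; gcongr; norm_num
        refine lt_of_lt_of_le ?_ (h4.trans this)
        clear red this h4
        have h10 : c*3 ≤ α := by rw [hσ]; gcongr
        linarith
      · have := red 1.3694 3.5 (by norm_num) (by rw [hβ]; linarith) (by norm_num) (by rw [hβ]; norm_num)
        have h5 : log (1+β*σ) ≤ 1.51 := by
          have h5 : log (1+β*σ) ≤ log 4.5 := log_le_log (by rw [hβ]; positivity) (by rw [hβ]; linarith)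
          have h6 := log_le_of_pow (x := 4.5) (by norm_num) 37 17 (by norm_num) (by norm_num)
          norm_num at h6
          norm_num at h5
          linarith
        have h4 : 0.4014 * α ≤ 0.7853*β/1.3694*α := by rw [hβ]; gcongr; norm_num
        refine lt_of_lt_of_le ?_ (h4.trans this)
        clear red this h4
        have h10 : c*4 ≤ α := by rw [hσ]; gcongr
        linarith

theorem num_all {c s σ α β : ℝ} (hc : 30 < c) (hα : 89.6 ≤ α) (hσ : α = c*σ) (hσ5 : σ < 5)
    (hlog : 3*log c + 18.5 ≤ 0.32064*α) (hβ : (σ ≤ 1 ∧ β = 0.85) ∨ (1 < σ ∧ β = 0.7)) (hs : β*σ ≤ s) :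
    3.0625*log c + 3.5625*log (1+s) - 7.15 + 0.32064*α < π/4*c*s/√(1+s/4) := by
  have h1 := num_pt hc hα hσ hσ5 hlog hβ
  have hσ0 : 0 < σ := by
    have : 0 < c*σ := by linarith
    exact pos_of_mul_pos_right this (by linarith)
  have hβ0 : 0 < β := by rcases hβ with h | h <;> rw [h.2] <;> norm_num
  have hs0 : 0 < s := lt_of_lt_of_le (by positivity) hs
  have h2 := k_mono hc.le (by positivity) hs
  have h3 : 0.7853*c*(s/√(1+s/4)) ≤ π/4*c*(s/√(1+s/4)) := by
    have := pi_gt_d4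
    gcongr
    linarith
  have e : π/4*c*s/√(1+s/4) = π/4*c*(s/√(1+s/4)) := by ring
  rw [e]
  linarith

theorem alpha_facts {c l α : ℝ} (hc : 30 < c) (hl : 0 < l)
    (hlc : l < (5*π/(4*√6)) * c - 3 * log c - log (6^5 * 14340))
    (hα : α = (4*√6/π) * (l + 3 * log c + log (6^5 * 14340))) :
    89.6 ≤ α ∧ α < c*5 ∧ 3*log c + 18.5 ≤ 0.32064*α ∧ l ≤ 0.32064*α - 3*log c - 18.529 := by
  have l2 := log_two_gt_d9
  have l3 := log_three_gt_d9
  have l5 := log_five_gt_d9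
  have l239 : 79/10*log 2 ≤ log 239 := by
    have h : log ((2:ℝ)^79) ≤ log (239^10) := log_le_log (by norm_num) (by norm_num)
    rw [log_pow, log_pow] at h
    push_cast at h
    linarith
  have hM : 18.529 ≤ log (6^5 * 14340) := by
    have e : (6:ℝ)^5*14340 = 2^7*3^6*5*239 := by norm_num
    rw [e, log_mul (by norm_num) (by norm_num), log_mul (by norm_num) (by norm_num), log_mul (by norm_num) (by norm_num), log_pow, log_pow]
    push_cast
    linarith
  have h30 : 3.4011 ≤ log c := by
    have h1 : log 30 ≤ log c := log_le_log (by norm_num) hc.le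
    have e : (30:ℝ) = 2*3*5 := by norm_num
    rw [e, log_mul (by norm_num) (by norm_num), log_mul (by norm_num) (by norm_num)] at h1
    linarith
  set M := log (6^5 * 14340) with hMd
  have p1 := pi_gt_d6
  have p2 := pi_lt_d6
  have hp : 0 < π := pi_pos
  have h6 : 2.449489 ≤ √6 := Real.le_sqrt_of_sq_le (by norm_num)
  have h6p : 0 < √6 := by positivity
  have k1 : 3.1187 ≤ 4*√6/π := by rw [le_div_iff₀ hp]; linarith
  have k2 : π ≤ 0.32064*(4*√6) := by linarith
  have hX : 28.732 ≤ l + 3*log c + M := by linarith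
  have hX0 : 0 < l + 3*log c + M := by linarith
  have k3 : l + 3*log c + M ≤ 0.32064*α := by
    have : 1 ≤ 0.32064*(4*√6/π) := by
      rw [← mul_div_assoc, le_div_iff₀ hp]; linarith
    rw [hα]
    nlinarith only [this, hX0]
  refine ⟨?_, ?_, by linarith, by linarith⟩
  · rw [hα]
    nlinarith only [k1, hX]
  · rw [hα]
    have h1 : l + 3*log c + M < 5*π/(4*√6)*c := by linarith
    calc (4*√6/π) * (l + 3*log c + M) < (4*√6/π)*(5*π/(4*√6)*c) := by gcongr
      _ = c*5 := by field_simp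

theorem final_est {c s K D E l α : ℝ} (hc : 30 < c) (hs : 0 < s) (hD : 0 < D)
    (hN : 3.0625*log c + 3.5625*log (1+s) - 7.15 + 0.32064*α < K)
    (hl : l ≤ 0.32064*α - 3*log c - 18.529)
    (hDK : 1/2*(s/(1+s))*exp (2*K) ≤ 32*log (2*c*(1+s))*D^2)
    (hE : E ≤ 6080*c^6*(1+s)^3*√s/D) : E < exp (-l) := by
  refine lt_of_le_of_lt hE ?_
  have hc0 : 0 < c := by linarith
  have hu : 0 < 1+s := by linarith
  have hs2 : √s^2 = s := Real.sq_sqrt hs.le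
  have hK0 : 0 < exp (2*K) := exp_pos _
  refine lt_of_pow_lt_pow_left₀ 2 (exp_pos _).le ?_
  have hlog : log (2*c*(1+s)) ≤ 8*exp (log (2*c*(1+s))/8 - 1) := by
    have := add_one_le_exp (log (2*c*(1+s))/8 - 1)
    linarith
  have eL : log (2*c*(1+s)) = log 2 + log c + log (1+s) := by
    rw [log_mul (by positivity) hu.ne', log_mul (by norm_num) hc0.ne']
  have h1 : (6080*c^6*(1+s)^3*√s/D)^2 ≤ 6080^2*512*c^12*(1+s)^7*exp (log (2*c*(1+s))/8 - 1)/exp (2*K) := by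
    have e : (6080*c^6*(1+s)^3*√s/D)^2 = 6080^2*c^12*(1+s)^6*s/D^2 := by
      rw [div_pow]; congr 1
      calc (6080*c^6*(1+s)^3*√s)^2 = 6080^2*c^12*(1+s)^6*√s^2 := by ring
        _ = _ := by rw [hs2]
    rw [e, div_le_div_iff₀ (by positivity) hK0]
    have h2 : s*exp (2*K) ≤ 512*(1+s)*exp (log (2*c*(1+s))/8 - 1)*D^2 := by
      have h3 : 1/2*(s/(1+s))*exp (2*K) ≤ 32*(8*exp (log (2*c*(1+s))/8 - 1))*D^2 := hDK.trans (by gcongr)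
      have h4 : s*exp (2*K) = 2*(1+s)*(1/2*(s/(1+s))*exp (2*K)) := by field_simp
      rw [h4]
      calc _ ≤ 2*(1+s)*(32*(8*exp (log (2*c*(1+s))/8 - 1))*D^2) := by gcongr
        _ = _ := by ring
    calc 6080^2*c^12*(1+s)^6*s*exp (2*K) = 6080^2*c^12*(1+s)^6*(s*exp (2*K)) := by ring
      _ ≤ 6080^2*c^12*(1+s)^6*(512*(1+s)*exp (log (2*c*(1+s))/8 - 1)*D^2) := by gcongr
      _ = _ := by ring
  refine lt_of_le_of_lt h1 ?_
  have l2 := log_two_lt_d9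
  have l5 := log_five_lt_d9
  have l19 : log 19 ≤ 17/4*log 2 := by
    have h : log ((19:ℝ)^4) ≤ log (2^17) := log_le_log (by norm_num) (by norm_num)
    rw [log_pow, log_pow] at h
    push_cast at h
    linarith
  have e1 : (6080:ℝ)^2*512 = exp (21*log 2 + 2*log 5 + 2*log 19) := by
    have : (6080:ℝ)^2*512 = 2^21*5^2*19^2 := by norm_num
    rw [this, exp_add, exp_add]
    congr 1
    · congr 1
      · rw [← exp_log (show (0:ℝ) < 2^21 by norm_num), log_pow]; norm_num
      · rw [← exp_log (show (0:ℝ) < 5^2 by norm_num), log_pow]; norm_num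
    · rw [← exp_log (show (0:ℝ) < 19^2 by norm_num), log_pow]; norm_num
  have e2 : c^12 = exp (12*log c) := by
    rw [← exp_log (show 0 < c^12 by positivity), log_pow]; norm_num
  have e3 : (1+s)^7 = exp (7*log (1+s)) := by
    rw [← exp_log (show 0 < (1+s)^7 by positivity), log_pow]; norm_num
  rw [e1, e2, e3, ← exp_add, ← exp_add, ← exp_add, ← exp_sub, ← exp_nat_mul, eL]
  apply exp_lt_exp.2
  push_cast
  linarith

theorem wt_abs {c s χ : ℝ} {n : ℕ} {ψ : ℝ → ℝ} {lam : ℂ} (h : ProlateDatum c n ψ lam χ) (hc : 30 ≤ c) (hs : 0 < s)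
    (hcs : 60 ≤ c*s) (hχ : χ = c^2*(1+s))
    (hbig : 2 ≤ (1/16)*(s/(1+s))*exp (π/2*c*s/√(1+s/4))) :
    1/2*(s/(1+s))*exp (π/2*c*s/√(1+s/4)) ≤ 32*log (2*c*(1+s))*(s*|deriv ψ (√(1+s))|)^2 := by
  have hc0 : 0 < c := by linarith
  have h1 : 1/2 ≤ ψ 1^2 := h.psi_one_sq (by rw [hχ]; nlinarith only [mul_pos (mul_pos hc0 hc0) hs])
  have key : ψ 1^2*(s/(1+s))*exp (π/2*c*s/√(1+s/4)) ≤ 32*log (2*c*(1+s))*(s*deriv ψ (√(1+s)))^2 := by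
    rcases lt_trichotomy (ψ 1) 0 with h2 | h2 | h2
    · have := h.rode.neg.wt_ge hc hs hcs hχ (by simpa using h2) hbig
      simpa using this
    · rw [h2] at h1; norm_num at h1
    · exact h.rode.wt_ge hc hs hcs hχ h2 hbig
  have e : (s*|deriv ψ (√(1+s))|)^2 = (s*deriv ψ (√(1+s)))^2 := by rw [mul_pow, sq_abs, mul_pow]
  rw [e]
  refine le_trans ?_ key
  gcongr

theorem hbig_of {c s K α : ℝ} (hc : 30 < c) (hs : 0 < s) (hcs : 60 ≤ c*s) (hα : 89.6 ≤ α)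
    (hN : 3.0625*log c + 3.5625*log (1+s) - 7.15 + 0.32064*α < K) :
    2 ≤ (1/16)*(s/(1+s))*exp (2*K) := by
  have hc0 : 0 < c := by linarith
  have hu : 0 < 1+s := by linarith
  have hlc : 0 ≤ log c := log_nonneg (by linarith)
  have hlu : 0 ≤ log (1+s) := log_nonneg (by linarith)
  have h1 : c*(1+s) ≤ exp (2*K) := by
    have : c*(1+s) = exp (log c + log (1+s)) := by rw [exp_add, exp_log hc0, exp_log hu]
    rw [this]
    apply exp_le_exp.2
    linarith
  have h2 : s/(1+s)*(c*(1+s)) = c*s := by field_simp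
  have h3 : s/(1+s)*(c*(1+s)) ≤ s/(1+s)*exp (2*K) := by gcongr
  linarith

theorem quad_error_lt_eps_of_n_gt_nu
    (c : ℝ) (hc : c > 30)
    (ε : ℝ) (hε : 0 < ε) (hε0 : 0 < Real.log (1/ε))
    (hεc : Real.log (1/ε) < (5*π/(4*Real.sqrt 6)) * c - 3 * Real.log c - Real.log (6^5 * 14340))
    (α ν : ℝ)
    (hα : α = (4*Real.sqrt 6/π) * (Real.log (1/ε) + 3 * Real.log c + Real.log (6^5 * 14340)))
    (hν : ν = 2*c/π + (α/(2*π)) * Real.log (16 * Real.exp 1 * c / α))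
    (n m : ℕ) (hn : 0 < n) (hmn : m ≤ n - 1)
    (ψm : ℝ → ℝ) (lamm : ℂ) (χm : ℝ)
    (hm : ProlateDatum c m ψm lamm χm)
    (ψn : ℝ → ℝ) (lamn : ℂ) (χn : ℝ)
    (hnd : ProlateDatum c n ψn lamn χn)
    (t : Fin n → ℝ) (ht_mono : StrictMono t)
    (ht_mem : ∀ j, t j ∈ Set.Ioo (-1:ℝ) 1)
    (ht_zero : ∀ j, ψn (t j) = 0)
    (hbig : (n : ℝ) > ν) :
    |(∫ s in (-1:ℝ)..1, ψm s) - ∑ j : Fin n, quadWeight ψn (t j) * ψm (t j)| < ε := by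
  obtain ⟨a1, a2, a3, a4⟩ := alpha_facts hc hε0 hεc hα
  have hc0 : 0 < c := by linarith
  have hσd : α = c*(α/c) := by field_simp
  obtain ⟨σ, hσ⟩ : ∃ σ, σ = α/c := ⟨_, rfl⟩
  rw [← hσ] at hσd
  have hσ0 : 0 < σ := by rw [hσ]; apply div_pos _ hc0; linarith
  have hσ5 : σ < 5 := by rw [hσ, div_lt_iff₀ hc0]; linarith
  have hnν : 2*c/π + (c*σ/(2*π)) * log (16 * exp 1 * c / (c*σ)) < n := by
    rw [← hσd, ← hν]; exact hbig
  obtain ⟨β, hβ, hg⟩ : ∃ β : ℝ, ((σ ≤ 1 ∧ β = 0.85) ∨ (1 < σ ∧ β = 0.7)) ∧ π ≤ c*σ*gnum β σ := by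
    rcases le_or_gt σ 1 with h | h
    · exact ⟨0.85, Or.inl ⟨h, rfl⟩, gnum_85 hσ0 h (by rw [← hσd]; exact a1)⟩
    · exact ⟨0.7, Or.inr ⟨h, rfl⟩, gnum_70 hc hσ0 hσ5 (by rw [← hσd]; exact a1)⟩
  have hβ7 : 0.7 ≤ β := by rcases hβ with h | h <;> rw [h.2]; norm_num
  have hβ0 : 0 < β := by linarith
  have hχl := chi_lower hnd.rode hnd.normalized hc hσ0 hσ5 hβ0 ht_mono ht_mem ht_zero hnν hg
  obtain ⟨s, hs⟩ : ∃ s, s = χn/c^2 - 1 := ⟨_, rfl⟩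
  have hχ : χn = c^2*(1+s) := by rw [hs]; field_simp; ring
  have hβs : β*σ < s := by
    rw [hχ] at hχl
    have := lt_of_mul_lt_mul_left hχl (by positivity)
    linarith
  have hs0 : 0 < s := lt_trans (by positivity) hβs
  have hcs : 60 ≤ c*s := by
    have h1 : c*(β*σ) ≤ c*s := by gcongr
    have h2 : c*(β*σ) = β*α := by rw [hσd]; ring
    have h3 : 0.7*α ≤ β*α := by gcongr
    linarith
  have hN := num_all hc a1 hσd hσ5 a3 hβ hβs.le
  have hb := hbig_of hc hs0 hcs a1 hN
  have eK : 2*(π/4*c*s/√(1+s/4)) = π/2*c*s/√(1+s/4) := by ring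
  have hb' := hb
  rw [eK] at hb'
  have hw := wt_abs hnd hc.le hs0 hcs hχ hb'
  rw [← eK] at hw
  -- zeros
  have hfin : {x : ℝ | x ∈ Ioo (-1:ℝ) 1 ∧ ψn x = 0}.Finite := by
    apply Set.finite_of_encard_eq_coe hnd.zeros_card
  have hinj : Function.Injective t := ht_mono.injective
  have hsub : Finset.univ.image t ⊆ hfin.toFinset := by
    intro w hw
    obtain ⟨j, -, rfl⟩ := Finset.mem_image.1 hw
    simp only [Set.Finite.mem_toFinset, Set.mem_ofPred_eq]
    exact ⟨ht_mem j, ht_zero j⟩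
  have hcard : hfin.toFinset.card = n := by
    have := hnd.zeros_card
    rw [hfin.encard_eq_coe_toFinset_card] at this
    exact_mod_cast this
  have hZeq : Finset.univ.image t = hfin.toFinset := by
    apply Finset.eq_of_subset_of_card_le hsub
    rw [hcard, Finset.card_image_of_injective _ hinj]; simp
  have hZi : ∀ w, w ∈ Finset.univ.image t ↔ w ∈ Ioo (-1:ℝ) 1 ∧ ψn w = 0 := by
    intro w; rw [hZeq]; simp
  have hsum : ∑ j : Fin n, quadWeight ψn (t j) * ψm (t j) = ∑ w ∈ Finset.univ.image t, quadWeight ψn w * ψm w := by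
    rw [Finset.sum_image (fun a _ b _ h => hinj h)]
  rw [hsum]
  obtain ⟨τ, hτ, hz, hx, hx'⟩ := hm.parity
  rcases hτ with hτ | hτ
  · have hd : deriv ψm 0 = 0 := by
      have := hx' 0
      rw [hτ, neg_zero] at this
      linarith
    have hD : 0 < s*|deriv ψn (√(1+s))| := by
      by_contra hcon
      have h0 : s*|deriv ψn (√(1+s))| = 0 := le_antisymm (not_lt.1 hcon) (by positivity)
      rw [h0] at hw
      norm_num at hw
      have : 0 < s/(1+s)*exp (2*(π/4*c*s/√(1+s/4))) := by positivity
      linarith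
    have hne : deriv ψn (√(1+s)) ≠ 0 := by
      intro h0
      rw [h0] at hD; simp at hD
    rw [hτ] at hz
    have hE := core_bound hm hnd hc.le hs0 hcs hχ (sturm_chi hm hnd (by omega)) hz hd hne _ hZi
    have := final_est hc hs0 hD hN a4 hw hE
    have e : exp (-log (1/ε)) = ε := by
      rw [one_div, log_inv, neg_neg, exp_log hε]
    rwa [e] at this
  · have := odd_error hm hnd (fun x => by rw [hx x, hτ]; ring) _ hZi
    rw [this, abs_zero]
    exact hε
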